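/- arXiv:1210.4215 — 2 statements merged into one kernel-verified Lean document; each statement's English description precedes it below -/
import Mathlib

section
/- There exist constants c̃_A ≥ 1 and C, depending only on ξ, A, B, such that for all sufficiently large N (depending only on A) the following holds. Let f satisfy condition (f), let M ≥ 0, write w_n = s_{M+n} for 1 ≤ n ≤ N, and let g be the N^{38}-th partial sum of the Fourier series of f. Then for any τ > 0 satisfying τ ≥ N^{-1/2} and 12 τ ⌈N^{1/8}⌉ ≤ 1 one has ∫_A^B exp( | τ Σ_{n=1}^{N} g(ξ x^{w_n}) | ) dx ≤ C · exp( τ² c̃_A ‖f‖ N ). -/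
open MeasureTheory Filter

/-- The `L²` norm of `f` over `[A,B]`. -/
noncomputable def fnorm (A B : ℝ) (f : ℝ → ℝ) : ℝ :=
  Real.sqrt (∫ x in A..B, (f x) ^ 2)

/-- Fourier cosine coefficient of a 1-periodic function. -/
noncomputable def fourierA (f : ℝ → ℝ) (j : ℕ) : ℝ :=
  2 * ∫ x in (0:ℝ)..1, f x * Real.cos (2 * Real.pi * j * x)

/-- Fourier sine coefficient of a 1-periodic function. -/
noncomputable def fourierB (f : ℝ → ℝ) (j : ℕ) : ℝ :=
  2 * ∫ x in (0:ℝ)..1, f x * Real.sin (2 * Real.pi * j * x)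

/-- The `d`-th partial sum of the Fourier series of `f`. -/
noncomputable def fourierPartial (f : ℝ → ℝ) (d : ℕ) (x : ℝ) : ℝ :=
  ∑ j ∈ Finset.Icc 1 d,
    (fourierA f j * Real.cos (2 * Real.pi * j * x) +
     fourierB f j * Real.sin (2 * Real.pi * j * x))


lemma aux_sup (A B ε : ℝ) (hAB : B - A = 1) (hε : 0 ≤ ε) (Φ Ψ Ψ' : ℝ → ℝ)
    (hΦc : ContinuousOn Φ (Set.Icc A B)) (hΦ : ∀ x ∈ Set.Icc A B, 0 ≤ Φ x)
    (hΨ : ∀ x ∈ Set.Icc A B, HasDerivAt Ψ (Ψ' x) x)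
    (hΨc : ContinuousOn Ψ' (Set.Icc A B))
    (h1 : ∀ x ∈ Set.Icc A B, |Ψ' x| ≤ 2 * ε * Φ x)
    (h2 : ∀ x ∈ Set.Icc A B, Ψ x ≤ ε * Φ x) :
    ∀ x ∈ Set.Icc A B, Ψ x ≤ 3 * ε * ∫ y in A..B, Φ y := by
  intro x hx
  have hle : A ≤ B := by linarith
  have hΦi : IntervalIntegrable Φ volume A B :=
    ContinuousOn.intervalIntegrable (by rwa [Set.uIcc_of_le hle])
  have hΨi : IntervalIntegrable Ψ' volume A B :=
    ContinuousOn.intervalIntegrable (by rwa [Set.uIcc_of_le hle])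
  obtain ⟨x0, hx0, hx0'⟩ : ∃ x0 ∈ Set.Icc A B, Φ x0 ≤ ∫ y in A..B, Φ y := by
    obtain ⟨x0, hx0, hm⟩ := isCompact_Icc.exists_isMinOn (Set.nonempty_Icc.2 hle) hΦc
    refine ⟨x0, hx0, ?_⟩
    have := intervalIntegral.integral_mono_on hle (f := fun _ => Φ x0) (by simp) hΦi
      (fun y hy => hm hy)
    simpa [hAB] using this
  have hsub : Set.uIcc x0 x ⊆ Set.Icc A B := Set.uIcc_subset_Icc hx0 hx
  have hint : IntervalIntegrable Ψ' volume x0 x :=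
    ContinuousOn.intervalIntegrable (hΨc.mono hsub)
  have hFTC := intervalIntegral.integral_eq_sub_of_hasDerivAt
    (fun y hy => hΨ y (hsub hy)) hint
  have hb : |∫ y in x0..x, Ψ' y| ≤ ∫ y in A..B, 2 * ε * Φ y := by
    calc |∫ y in x0..x, Ψ' y| ≤ abs (∫ y in x0..x, abs (Ψ' y)) := by
          simpa [Real.norm_eq_abs] using intervalIntegral.norm_integral_le_abs_integral_norm (f := Ψ') (a := x0) (b := x) (μ := volume)
      _ ≤ abs (∫ y in A..B, abs (Ψ' y)) := by
          apply intervalIntegral.abs_integral_mono_interval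
          · rw [Set.uIoc_of_le hle]
            intro y hy
            rcases le_total x0 x with h | h
            · rw [Set.uIoc_of_le h] at hy
              exact ⟨lt_of_le_of_lt hx0.1 hy.1, hy.2.trans hx.2⟩
            · rw [Set.uIoc_of_ge h] at hy
              exact ⟨lt_of_le_of_lt hx.1 hy.1, hy.2.trans hx0.2⟩
          · exact Eventually.of_forall (fun y => abs_nonneg _)
          · exact hΨi.abs
      _ = ∫ y in A..B, abs (Ψ' y) := abs_of_nonneg
          (intervalIntegral.integral_nonneg hle (fun y _ => abs_nonneg _))
      _ ≤ _ := intervalIntegral.integral_mono_on hle hΨi.abs (hΦi.const_mul _) h1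
  rw [intervalIntegral.integral_const_mul] at hb
  have := h2 x0 hx0
  have h3 := le_abs_self (∫ y in x0..x, Ψ' y)
  have h4 := mul_le_mul_of_nonneg_left hx0' hε
  nlinarith

lemma aux_ibp (A B ε κ : ℝ) (hAB : B - A = 1) (hε : 0 ≤ ε) (hκ : 0 < κ) (Φ Ψ Ψ' : ℝ → ℝ)
    (hΦc : ContinuousOn Φ (Set.Icc A B)) (hΦ : ∀ x ∈ Set.Icc A B, 0 ≤ Φ x)
    (hΨ : ∀ x ∈ Set.Icc A B, HasDerivAt Ψ (Ψ' x) x)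
    (hΨc : ContinuousOn Ψ' (Set.Icc A B))
    (h1 : ∀ x ∈ Set.Icc A B, |Ψ' x| ≤ 2 * ε * Φ x)
    (h2 : ∀ x ∈ Set.Icc A B, Ψ x ≤ ε * Φ x)
    (h0 : ∀ x ∈ Set.Icc A B, 0 ≤ Ψ x)
    (a b : ℝ) (hab : a ≤ b) (haA : A ≤ a) (hbB : b ≤ B)
    (u u' θ θ' : ℝ → ℝ) (hu : ∀ x ∈ Set.Icc a b, HasDerivAt u (u' x) x)
    (huc : ContinuousOn u' (Set.Icc a b))
    (hus : (∀ x ∈ Set.Icc a b, 0 ≤ u' x) ∨ (∀ x ∈ Set.Icc a b, u' x ≤ 0))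
    (hu1 : ∀ x ∈ Set.Icc a b, 1 ≤ |u x|)
    (hθ : ∀ x ∈ Set.Icc a b, HasDerivAt θ (θ' x) x)
    (hθ' : ∀ x ∈ Set.Icc a b, Ψ x * θ' x = κ * u x * Φ x) :
    ‖∫ x in a..b, (Φ x : ℂ) * Complex.exp (Complex.I * θ x)‖
      ≤ 14 * ε / κ * ∫ y in A..B, Φ y := by
  have hle : A ≤ B := by linarith
  have hss : Set.Icc a b ⊆ Set.Icc A B := Set.Icc_subset_Icc haA hbB
  set I := ∫ y in A..B, Φ y with hI
  have hI0 : 0 ≤ I := intervalIntegral.integral_nonneg hle hΦ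
  have hsup := aux_sup A B ε hAB hε Φ Ψ Ψ' hΦc hΦ hΨ hΨc h1 h2
  have hu0 : ∀ x ∈ Set.Icc a b, u x ≠ 0 := fun x hx h => by
    have := hu1 x hx; rw [h] at this; norm_num at this
  have hucont : ContinuousOn u (Set.Icc a b) := fun x hx => (hu x hx).continuousAt.continuousWithinAt
  have hθcont : ContinuousOn θ (Set.Icc a b) := fun x hx => (hθ x hx).continuousAt.continuousWithinAt
  have hΨcont : ContinuousOn Ψ (Set.Icc a b) := fun x hx => (hΨ x (hss hx)).continuousAt.continuousWithinAt
  let v : ℝ → ℝ := fun x => (u x)⁻¹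
  let v' : ℝ → ℝ := fun x => - u' x / (u x) ^ 2
  have hv : ∀ x ∈ Set.Icc a b, HasDerivAt v (v' x) x := fun x hx => (hu x hx).inv (hu0 x hx)
  have hv'c : ContinuousOn v' (Set.Icc a b) :=
    huc.neg.div (hucont.pow 2) (fun x hx => pow_ne_zero _ (hu0 x hx))
  have hv1 : ∀ x ∈ Set.Icc a b, |v x| ≤ 1 := fun x hx => by
    simp only [v, abs_inv]; exact inv_le_one_of_one_le₀ (hu1 x hx)
  have hvc : ContinuousOn v (Set.Icc a b) := fun x hx => (hv x hx).continuousAt.continuousWithinAt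
  have huI : Set.uIcc a b = Set.Icc a b := Set.uIcc_of_le hab
  -- integral of |v'|
  have hv'i : IntervalIntegrable v' volume a b := ContinuousOn.intervalIntegrable (by rwa [huI])
  have hv'int : ∫ x in a..b, |v' x| ≤ 2 := by
    have hF := intervalIntegral.integral_eq_sub_of_hasDerivAt
      (fun y hy => hv y (by rwa [huI] at hy)) hv'i
    have hA := hv1 a ⟨le_rfl, hab⟩
    have hB := hv1 b ⟨hab, le_rfl⟩
    rw [abs_le] at hA hB
    rcases hus with h | h
    · have : ∫ x in a..b, |v' x| = ∫ x in a..b, - v' x := by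
        apply intervalIntegral.integral_congr
        intro x hx
        rw [huI] at hx
        refine abs_of_nonpos ?_
        exact div_nonpos_of_nonpos_of_nonneg (by linarith [h x hx]) (sq_nonneg _)
      rw [this, intervalIntegral.integral_neg, hF]; linarith
    · have : ∫ x in a..b, |v' x| = ∫ x in a..b, v' x := by
        apply intervalIntegral.integral_congr
        intro x hx
        rw [huI] at hx
        refine abs_of_nonneg ?_
        exact div_nonneg (by linarith [h x hx]) (sq_nonneg _)
      rw [this, hF]; linarith
  let e : ℝ → ℂ := fun x => Complex.exp (Complex.I * θ x)
  have hen : ∀ x, ‖e x‖ = 1 := fun x => by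
    simp only [e]; rw [mul_comm]; exact Complex.norm_exp_ofReal_mul_I _
  have hec : ContinuousOn e (Set.Icc a b) := by
    simp only [e]
    exact Complex.continuous_exp.comp_continuousOn
      (continuousOn_const.mul (Complex.continuous_ofReal.comp_continuousOn hθcont))
  let Q : ℝ → ℂ := fun x => ((Ψ' x * v x + Ψ x * v' x : ℝ) : ℂ) * e x
  have hQc : ContinuousOn Q (Set.Icc a b) := by
    refine ContinuousOn.mul (Complex.continuous_ofReal.comp_continuousOn ?_) hec
    exact ((hΨc.mono hss).mul hvc).add (hΨcont.mul hv'c)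
  let R : ℝ → ℂ := fun x => (Φ x : ℂ) * e x
  have hRc : ContinuousOn R (Set.Icc a b) :=
    ContinuousOn.mul (Complex.continuous_ofReal.comp_continuousOn (hΦc.mono hss)) hec
  have hQi : IntervalIntegrable Q volume a b := ContinuousOn.intervalIntegrable (by rwa [huI])
  have hRi : IntervalIntegrable R volume a b := ContinuousOn.intervalIntegrable (by rwa [huI])
  let F : ℝ → ℂ := fun x => ((Ψ x * v x : ℝ) : ℂ) * e x
  have hF : ∀ x ∈ Set.uIcc a b, HasDerivAt F (Q x + Complex.I * κ * R x) x := by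
    intro x hx
    rw [huI] at hx
    have d1 : HasDerivAt (fun x => ((Ψ x * v x : ℝ) : ℂ)) ((Ψ' x * v x + Ψ x * v' x : ℝ) : ℂ) x :=
      ((hΨ x (hss hx)).mul (hv x hx)).ofReal_comp
    have d2 : HasDerivAt e (e x * (Complex.I * (θ' x : ℂ))) x :=
      ((hθ x hx).ofReal_comp.const_mul Complex.I).cexp
    have d3 := d1.mul d2
    refine d3.congr_deriv ?_
    have hk : ((Ψ x * v x : ℝ) : ℂ) * (θ' x : ℂ) = κ * Φ x := by
      have : Ψ x * v x * θ' x = κ * Φ x := by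
        have h3 := hθ' x hx
        have h4 := hu0 x hx
        simp only [v]
        field_simp
        linarith
      exact_mod_cast this
    simp only [Q, R]
    linear_combination (Complex.I * e x) * hk
  have hFTC := intervalIntegral.integral_eq_sub_of_hasDerivAt hF
    (hQi.add (hRi.const_mul _))
  rw [intervalIntegral.integral_add hQi (hRi.const_mul _), intervalIntegral.integral_const_mul] at hFTC
  have hFb : ∀ x ∈ Set.Icc a b, ‖F x‖ ≤ 3 * ε * I := by
    intro x hx
    simp only [F, norm_mul, hen, mul_one, Complex.norm_real, Real.norm_eq_abs, abs_mul]
    rw [abs_of_nonneg (h0 x (hss hx))]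
    calc Ψ x * |v x| ≤ Ψ x * 1 := mul_le_mul_of_nonneg_left (hv1 x hx) (h0 x (hss hx))
      _ ≤ _ := by rw [mul_one]; exact hsup x (hss hx)
  have hΦi : IntervalIntegrable Φ volume A B :=
    ContinuousOn.intervalIntegrable (by rwa [Set.uIcc_of_le hle])
  have hΦi' : IntervalIntegrable Φ volume a b :=
    ContinuousOn.intervalIntegrable (by rw [huI]; exact hΦc.mono hss)
  have hΦab : ∫ x in a..b, Φ x ≤ I := by
    apply intervalIntegral.integral_mono_interval haA hab hbB _ hΦi
    exact (ae_restrict_iff' measurableSet_Ioc).2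
      (Eventually.of_forall fun x hx => hΦ x ⟨hx.1.le, hx.2⟩)
  have hQb : ‖∫ x in a..b, Q x‖ ≤ 2 * ε * I + 6 * ε * I := by
    calc ‖∫ x in a..b, Q x‖ ≤ ∫ x in a..b, (2 * ε * Φ x + 3 * ε * I * |v' x|) := by
          apply intervalIntegral.norm_integral_le_of_norm_le hab
          · refine Eventually.of_forall fun x hx => ?_
            have hx : x ∈ Set.Icc a b := ⟨hx.1.le, hx.2⟩
            simp only [Q, norm_mul, hen, mul_one, Complex.norm_real, Real.norm_eq_abs]
            refine (abs_add_le _ _).trans ?_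
            rw [abs_mul, abs_mul, abs_of_nonneg (h0 x (hss hx))]
            refine add_le_add ?_ (mul_le_mul_of_nonneg_right (hsup x (hss hx)) (abs_nonneg _))
            · calc |Ψ' x| * |v x| ≤ |Ψ' x| * 1 := by gcongr; exact hv1 x hx
                _ ≤ _ := by rw [mul_one]; exact h1 x (hss hx)
          · exact (hΦi'.const_mul _).add (hv'i.abs.const_mul _)
      _ = 2 * ε * (∫ x in a..b, Φ x) + 3 * ε * I * ∫ x in a..b, |v' x| := by
          rw [intervalIntegral.integral_add (hΦi'.const_mul _) (hv'i.abs.const_mul _),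
            intervalIntegral.integral_const_mul, intervalIntegral.integral_const_mul]
      _ ≤ 2 * ε * I + 3 * ε * I * 2 := by gcongr
      _ = _ := by ring
  have hfin : ‖Complex.I * κ * ∫ x in a..b, R x‖ ≤ 14 * ε * I := by
    have : Complex.I * κ * ∫ x in a..b, R x = F b - F a - ∫ x in a..b, Q x := by
      linear_combination hFTC
    rw [this]
    have := norm_sub_le (F b - F a) (∫ x in a..b, Q x)
    have := norm_sub_le (F b) (F a)
    have := hFb a ⟨le_rfl, hab⟩
    have := hFb b ⟨hab, le_rfl⟩
    linarith
  rw [norm_mul, norm_mul, Complex.norm_I, one_mul, Complex.norm_real, Real.norm_eq_abs, abs_of_pos hκ] at hfin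
  change ‖∫ x in a..b, R x‖ ≤ _
  rw [div_mul_eq_mul_div, le_div_iff₀ hκ]
  linarith


structure GoodW (A B ε : ℝ) (Φ : ℝ → ℝ) (m : ℕ) (Ψ' : ℝ → ℝ) : Prop where
  cont : ContinuousOn Φ (Set.Icc A B)
  nonneg : ∀ x ∈ Set.Icc A B, 0 ≤ Φ x
  deriv : ∀ x ∈ Set.Icc A B, HasDerivAt (fun x => Φ x * (m * x ^ (m - 1) : ℝ)⁻¹) (Ψ' x) x
  derivc : ContinuousOn Ψ' (Set.Icc A B)
  bd1 : ∀ x ∈ Set.Icc A B, |Ψ' x| ≤ 2 * ε * Φ x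
  bd2 : ∀ x ∈ Set.Icc A B, Φ x * (m * x ^ (m - 1) : ℝ)⁻¹ ≤ ε * Φ x

lemma aux_set (A B ε ξ : ℝ) (hξ : 0 < ξ) (hA : 1 < A) (hAB : B - A = 1) (hε : 0 ≤ ε) (Φ Ψ' : ℝ → ℝ)
    (m h : ℕ) (hm : 1 ≤ m) (hG : GoodW A B ε Φ m Ψ') (j j' : ℝ) (S : Set ℝ)
    (hS : S ⊆ Set.Icc A B) (hSc : IsClosed S) (hSo : S.OrdConnected)
    (hu : ∀ x ∈ S, 1 ≤ |j * ((m + h : ℝ) / m) * x ^ h + j'|) :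
    ‖∫ x in S, (Φ x : ℂ) * Complex.exp (Complex.I *
        ((2 * Real.pi * ξ * (j * x ^ (m + h) + j' * x ^ m) : ℝ) : ℂ))‖
      ≤ 14 * ε / (2 * Real.pi * ξ) * ∫ y in A..B, Φ y := by
  have hle : A ≤ B := by linarith
  have hκ : 0 < 2 * Real.pi * ξ := by positivity
  rcases S.eq_empty_or_nonempty with hS0 | hS0
  · subst hS0
    simp only [Measure.restrict_empty, integral_zero_measure, norm_zero]
    have := intervalIntegral.integral_nonneg (μ := volume) hle hG.nonneg
    positivity
  have hcomp : IsCompact S := isCompact_Icc.of_isClosed_subset hSc hS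
  have hconn : IsConnected S := ⟨hS0, hSo.isPreconnected⟩
  have hSeq := eq_Icc_of_connected_compact hconn hcomp
  set a := sInf S
  set b := sSup S
  have hab : a ≤ b := by
    rw [hSeq] at hS0; exact Set.nonempty_Icc.1 hS0
  have haA : A ≤ a := (hS (by rw [hSeq]; exact ⟨le_rfl, hab⟩)).1
  have hbB : b ≤ B := (hS (by rw [hSeq]; exact ⟨hab, le_rfl⟩)).2
  rw [hSeq] at hu
  rw [hSeq, integral_Icc_eq_integral_Ioc, ← intervalIntegral.integral_of_le hab]
  have hm0 : (0:ℝ) < m := by exact_mod_cast hm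
  have hpos : ∀ x ∈ Set.Icc a b, 0 < x := fun x hx => by linarith [hx.1]
  refine aux_ibp A B ε (2 * Real.pi * ξ) hAB hε hκ Φ (fun x => Φ x * (m * x ^ (m - 1) : ℝ)⁻¹) Ψ'
    hG.cont hG.nonneg hG.deriv hG.derivc hG.bd1 hG.bd2 ?_ a b hab haA hbB
    (fun x => j * ((m + h : ℝ) / m) * x ^ h + j')
    (fun x => j * ((m + h : ℝ) / m) * (h * x ^ (h - 1)))
    (fun x => 2 * Real.pi * ξ * (j * x ^ (m + h) + j' * x ^ m))
    (fun x => 2 * Real.pi * ξ * (j * ((m + h : ℕ) * x ^ (m + h - 1)) + j' * (m * x ^ (m - 1))))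
    ?_ ?_ ?_ hu ?_ ?_
  · intro x hx
    have h1 : 0 < x := by linarith [hx.1]
    have := hG.nonneg x hx
    positivity
  · intro x hx
    exact ((hasDerivAt_pow h x).const_mul _).add_const _
  · fun_prop
  · rcases le_total 0 j with hj | hj
    · left
      intro x hx
      have := hpos x hx
      positivity
    · right
      intro x hx
      have := hpos x hx
      have h2 : 0 ≤ ((m + h : ℝ) / m) * (h * x ^ (h - 1)) := by positivity
      rw [mul_assoc]
      exact mul_nonpos_of_nonpos_of_nonneg hj h2
  · intro x hx
    exact (((hasDerivAt_pow (m+h) x).const_mul j).add ((hasDerivAt_pow m x).const_mul j')).const_mul _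
  · intro x hx
    have := hpos x hx
    have h3 : x ^ (m + h - 1) = x ^ (m - 1) * x ^ h := by
      rw [← pow_add]; congr 1; omega
    simp only [h3]
    push_cast
    field_simp

lemma aux_pair (A B ε ξ : ℝ) (hξ : 0 < ξ) (hA : 1 < A) (hAB : B - A = 1) (hε : 0 ≤ ε) (Φ Ψ' : ℝ → ℝ)
    (m h : ℕ) (hm : 1 ≤ m) (hG : GoodW A B ε Φ m Ψ') (j j' : ℝ) :
    ‖∫ x in A..B, (Φ x : ℂ) * Complex.exp (Complex.I *
        ((2 * Real.pi * ξ * (j * x ^ (m + h) + j' * x ^ m) : ℝ) : ℂ))‖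
      ≤ 28 * ε / (2 * Real.pi * ξ) * (∫ y in A..B, Φ y) +
        ∫ x in A..B, Φ x * (if |j * ((m + h : ℝ) / m) * x ^ h + j'| < 1 then 1 else 0) := by
  have hle : A ≤ B := by linarith
  set u : ℝ → ℝ := fun x => j * ((m + h : ℝ) / m) * x ^ h + j' with hu
  have huc : Continuous u := by fun_prop
  set R : ℝ → ℂ := fun x => (Φ x : ℂ) * Complex.exp (Complex.I *
        ((2 * Real.pi * ξ * (j * x ^ (m + h) + j' * x ^ m) : ℝ) : ℂ)) with hR
  have hRc : ContinuousOn R (Set.Icc A B) := by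
    refine ContinuousOn.mul (Complex.continuous_ofReal.comp_continuousOn hG.cont) ?_
    exact Continuous.continuousOn (by fun_prop)
  have hRi : IntegrableOn R (Set.Icc A B) := hRc.integrableOn_Icc
  have hΦi : IntegrableOn Φ (Set.Icc A B) := hG.cont.integrableOn_Icc
  have hmon : MonotoneOn u (Set.Icc A B) ∨ AntitoneOn u (Set.Icc A B) := by
    rcases le_total 0 j with hj | hj
    · left
      intro x hx y hy hxy
      have : 0 ≤ x := by linarith [hx.1]
      simp only [hu]
      gcongr
    · right
      intro x hx y hy hxy
      have : 0 ≤ x := by linarith [hx.1]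
      have h1 : x ^ h ≤ y ^ h := by gcongr
      have h2 : j * ((m + h : ℝ) / m) ≤ 0 :=
        mul_nonpos_of_nonpos_of_nonneg hj (by positivity)
      simp only [hu]
      nlinarith
  have hoc1 : (Set.Icc A B ∩ {x | 1 ≤ u x}).OrdConnected := by
    refine ⟨fun x hx y hy z hz => ?_⟩
    have hzI : z ∈ Set.Icc A B := ⟨hx.1.1.trans hz.1, hz.2.trans hy.1.2⟩
    refine ⟨hzI, ?_⟩
    rcases hmon with hm | hm
    · exact le_trans hx.2 (hm hx.1 hzI hz.1)
    · exact le_trans hy.2 (hm hzI hy.1 hz.2)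
  have hoc2 : (Set.Icc A B ∩ {x | u x ≤ -1}).OrdConnected := by
    refine ⟨fun x hx y hy z hz => ?_⟩
    have hzI : z ∈ Set.Icc A B := ⟨hx.1.1.trans hz.1, hz.2.trans hy.1.2⟩
    refine ⟨hzI, ?_⟩
    rcases hmon with hm | hm
    · exact le_trans (hm hzI hy.1 hz.2) hy.2
    · exact le_trans (hm hx.1 hzI hz.1) hx.2
  have hcl1 : IsClosed (Set.Icc A B ∩ {x | 1 ≤ u x}) :=
    isClosed_Icc.inter (isClosed_le continuous_const huc)
  have hcl2 : IsClosed (Set.Icc A B ∩ {x | u x ≤ -1}) :=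
    isClosed_Icc.inter (isClosed_le huc continuous_const)
  have b1 := aux_set A B ε ξ hξ hA hAB hε Φ Ψ' m h hm hG j j' _ Set.inter_subset_left hcl1 hoc1
    (fun x hx => le_trans hx.2 (le_abs_self _))
  have b2 := aux_set A B ε ξ hξ hA hAB hε Φ Ψ' m h hm hG j j' _ Set.inter_subset_left hcl2 hoc2
    (fun x hx => by
      have : u x ≤ -1 := hx.2
      exact le_trans (by linarith) (neg_le_abs _))
  have hopen : MeasurableSet {x | |u x| < 1} := (isOpen_lt huc.abs continuous_const).measurableSet
  have hd1 : Set.Icc A B = ((Set.Icc A B ∩ {x | 1 ≤ u x}) ∪ (Set.Icc A B ∩ {x | u x ≤ -1})) ∪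
      (Set.Icc A B ∩ {x | |u x| < 1}) := by
    ext x
    simp only [Set.mem_union, Set.mem_inter_iff, Set.mem_ofPred_eq, ← and_or_left]
    refine ⟨fun hx => ⟨hx, ?_⟩, fun hx => hx.1⟩
    rcases lt_or_ge (|u x|) 1 with h | h
    · exact Or.inr h
    · left
      rcases le_abs.1 h with h | h
      · exact Or.inl h
      · right; linarith
  have hsplit : ∫ x in Set.Icc A B, R x = (∫ x in Set.Icc A B ∩ {x | 1 ≤ u x}, R x) +
      (∫ x in Set.Icc A B ∩ {x | u x ≤ -1}, R x) + ∫ x in Set.Icc A B ∩ {x | |u x| < 1}, R x := by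
    conv_lhs => rw [hd1]
    rw [setIntegral_union _ (measurableSet_Icc.inter hopen), setIntegral_union _ hcl2.measurableSet]
    · exact hRi.mono_set Set.inter_subset_left
    · exact hRi.mono_set Set.inter_subset_left
    · rw [Set.disjoint_left]
      rintro x ⟨_, (hx : 1 ≤ u x)⟩ ⟨_, (hx' : u x ≤ -1)⟩
      linarith
    · exact (hRi.mono_set Set.inter_subset_left).union (hRi.mono_set Set.inter_subset_left)
    · exact hRi.mono_set Set.inter_subset_left
    · rw [Set.disjoint_left]
      rintro x hx ⟨_, (hx' : |u x| < 1)⟩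
      rw [abs_lt] at hx'
      rcases hx with ⟨_, (hx : 1 ≤ u x)⟩ | ⟨_, (hx : u x ≤ -1)⟩ <;> linarith
  have hn : ∀ x ∈ Set.Icc A B, ‖R x‖ ≤ Φ x := by
    intro x hx
    simp only [hR, norm_mul, Complex.norm_real, Real.norm_eq_abs, abs_of_nonneg (hG.nonneg x hx)]
    rw [mul_comm Complex.I, Complex.norm_exp_ofReal_mul_I, mul_one]
  have b3 : ‖∫ x in Set.Icc A B ∩ {x | |u x| < 1}, R x‖ ≤
      ∫ x in A..B, Φ x * (if |u x| < 1 then 1 else 0) := by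
    rw [intervalIntegral.integral_of_le hle, ← integral_Icc_eq_integral_Ioc]
    have : ∀ x, Φ x * (if |u x| < 1 then 1 else 0) = Set.indicator {x | |u x| < 1} Φ x := by
      intro x
      simp [Set.indicator_apply]
    simp only [this]
    rw [setIntegral_indicator hopen]
    refine norm_integral_le_of_norm_le (hΦi.mono_set Set.inter_subset_left) ?_
    exact (ae_restrict_iff' (measurableSet_Icc.inter hopen)).2
      (Eventually.of_forall fun x hx => hn x hx.1)
  rw [intervalIntegral.integral_of_le hle, ← integral_Icc_eq_integral_Ioc, hsplit]
  refine (norm_add₃_le).trans ?_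
  have : 28 * ε / (2 * Real.pi * ξ) * (∫ y in A..B, Φ y) = 14 * ε / (2 * Real.pi * ξ) * (∫ y in A..B, Φ y) + 14 * ε / (2 * Real.pi * ξ) * (∫ y in A..B, Φ y) := by ring
  rw [this]
  exact add_le_add (add_le_add b1 b2) b3


structure TP (g : ℝ → ℝ) (J : Finset ℤ) (c : ℤ → ℂ) (F L K : ℝ) : Prop where
  ne0 : ∀ j ∈ J, j ≠ 0
  eq : ∀ y : ℝ, (g y : ℂ) = ∑ j ∈ J, c j * Complex.exp (Complex.I * ((2 * Real.pi * j * y : ℝ) : ℂ))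
  dec : ∀ j ∈ J, ‖c j‖ ≤ 2 / |(j : ℝ)|
  F0 : 0 ≤ F
  l2 : ∑ j ∈ J, ‖c j‖ ^ 2 ≤ F ^ 2
  l1 : ∑ j ∈ J, ‖c j‖ ≤ L
  lK : ∑ j ∈ J, ‖c j‖ * |(j : ℝ)| ≤ K
  inv : ∑ j ∈ J, (1 / |(j : ℝ)|) ^ 2 ≤ 4

lemma TP.res {g : ℝ → ℝ} {J : Finset ℤ} {c : ℤ → ℂ} {F L K : ℝ} (T : TP g J c F L K)
    (A ρ x : ℝ) (h : ℕ) (hA : 1 < A) (hρ : 1 ≤ ρ) (hx : A ≤ x) :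
    ∑ j ∈ J, ∑ j' ∈ J, ‖c j‖ * ‖c j'‖ * (if |(j : ℝ) * ρ * x ^ h + j'| < 1 then (1:ℝ) else 0)
      ≤ 16 * F / A ^ h := by
  have hA0 : (0:ℝ) < A ^ h := by positivity
  have hx0 : 0 < x := by linarith
  have key : ∀ j ∈ J, ∑ j' ∈ J, ‖c j'‖ * (if |(j : ℝ) * ρ * x ^ h + j'| < 1 then (1:ℝ) else 0)
      ≤ 8 / A ^ h * (1 / |(j:ℝ)|) := by
    intro j hj
    have hj0 : 0 < |(j:ℝ)| := abs_pos.2 (by exact_mod_cast T.ne0 j hj)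
    set b := (j : ℝ) * ρ * x ^ h with hb
    have hbb : |(j:ℝ)| * A ^ h ≤ |b| := by
      rw [hb, abs_mul, abs_mul, abs_of_nonneg (by positivity : (0:ℝ) ≤ x ^ h),
        abs_of_nonneg (by linarith : (0:ℝ) ≤ ρ), mul_assoc]
      apply mul_le_mul_of_nonneg_left _ hj0.le
      calc A ^ h ≤ x ^ h := by gcongr
        _ ≤ ρ * x ^ h := le_mul_of_one_le_left (by positivity) hρ
    calc ∑ j' ∈ J, ‖c j'‖ * (if |b + j'| < 1 then (1:ℝ) else 0)
        = ∑ j' ∈ J.filter (fun j' : ℤ => |b + j'| < 1), ‖c j'‖ := by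
          rw [Finset.sum_filter]
          apply Finset.sum_congr rfl
          intro j' _
          split_ifs <;> simp
      _ ≤ ∑ j' ∈ J.filter (fun j' : ℤ => |b + j'| < 1), 4 / (|(j:ℝ)| * A ^ h) := by
          apply Finset.sum_le_sum
          intro j' hj'
          rw [Finset.mem_filter] at hj'
          have h1 : (1:ℝ) ≤ |(j':ℝ)| := by
            have := Int.one_le_abs (T.ne0 j' hj'.1)
            exact_mod_cast this
          have h2 : |b| ≤ 2 * |(j':ℝ)| := by
            have : |b| ≤ |b + j'| + |(j':ℝ)| := by
              have := abs_sub (b + j') (j' : ℝ)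
              simpa using this
            linarith [hj'.2]
          refine (T.dec j' hj'.1).trans ?_
          rw [div_le_div_iff₀ (by linarith) (by positivity)]
          nlinarith
      _ = ((J.filter (fun j' : ℤ => |b + j'| < 1)).card : ℝ) * (4 / (|(j:ℝ)| * A ^ h)) := by
          rw [Finset.sum_const, nsmul_eq_mul]
      _ ≤ 2 * (4 / (|(j:ℝ)| * A ^ h)) := by
          apply mul_le_mul_of_nonneg_right _ (by positivity)
          have hsub : J.filter (fun j' : ℤ => |b + j'| < 1) ⊆ Finset.Icc ⌊-b⌋ (⌊-b⌋ + 1) := by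
            intro j' hj'
            rw [Finset.mem_filter, abs_lt] at hj'
            rw [Finset.mem_Icc]
            have f1 := Int.floor_le (-b)
            have f2 := Int.lt_floor_add_one (-b)
            constructor
            · have : (⌊-b⌋ : ℝ) < j' + 1 := by linarith
              have : ⌊-b⌋ < j' + 1 := by exact_mod_cast this
              omega
            · have : (j':ℝ) < ⌊-b⌋ + 1 + 1 := by linarith
              have : j' < ⌊-b⌋ + 1 + 1 := by exact_mod_cast this
              omega
          have := Finset.card_le_card hsub
          rw [Int.card_Icc] at this
          have h3 : (⌊-b⌋ + 1 + 1 - ⌊-b⌋).toNat = 2 := by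
            have : ⌊-b⌋ + 1 + 1 - ⌊-b⌋ = 2 := by ring
            rw [this]; rfl
          rw [h3] at this
          exact_mod_cast this
      _ = _ := by field_simp; norm_num
  calc ∑ j ∈ J, ∑ j' ∈ J, ‖c j‖ * ‖c j'‖ * (if |(j : ℝ) * ρ * x ^ h + j'| < 1 then (1:ℝ) else 0)
      = ∑ j ∈ J, ‖c j‖ * ∑ j' ∈ J, ‖c j'‖ * (if |(j : ℝ) * ρ * x ^ h + j'| < 1 then (1:ℝ) else 0) := by
        simp only [Finset.mul_sum, mul_assoc]
    _ ≤ ∑ j ∈ J, ‖c j‖ * (8 / A ^ h * (1 / |(j:ℝ)|)) := by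
        apply Finset.sum_le_sum
        intro j hj
        exact mul_le_mul_of_nonneg_left (key j hj) (norm_nonneg _)
    _ = 8 / A ^ h * ∑ j ∈ J, ‖c j‖ * (1 / |(j:ℝ)|) := by
        rw [Finset.mul_sum]
        apply Finset.sum_congr rfl
        intros; ring
    _ ≤ 8 / A ^ h * (F * 2) := by
        apply mul_le_mul_of_nonneg_left _ (by positivity)
        have := Finset.sum_mul_sq_le_sq_mul_sq J (fun j => ‖c j‖) (fun j => 1 / |(j:ℝ)|)
        have hF := T.F0
        apply le_of_sq_le_sq _ (by positivity)
        calc _ ≤ _ := this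
          _ ≤ F ^ 2 * 4 := by
            apply mul_le_mul T.l2 T.inv _ (by positivity)
            exact Finset.sum_nonneg (fun _ _ => sq_nonneg _)
          _ = _ := by ring
    _ = _ := by ring

lemma TP.lin {g : ℝ → ℝ} {J : Finset ℤ} {c : ℤ → ℂ} {F L K : ℝ} (T : TP g J c F L K)
    (A B ε ξ : ℝ) (hξ : 0 < ξ) (hA : 1 < A) (hAB : B - A = 1) (hε : 0 ≤ ε) (Φ Ψ' : ℝ → ℝ)
    (m : ℕ) (hm : 1 ≤ m) (hG : GoodW A B ε Φ m Ψ') :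
    |∫ x in A..B, Φ x * g (ξ * x ^ m)| ≤ 28 * ε / (2 * Real.pi * ξ) * L * ∫ y in A..B, Φ y := by
  have hle : A ≤ B := by linarith
  have hI0 : 0 ≤ ∫ y in A..B, Φ y := intervalIntegral.integral_nonneg hle hG.nonneg
  have hΦC : ContinuousOn (fun x => (Φ x : ℂ)) (Set.uIcc A B) := by
    rw [Set.uIcc_of_le hle]; exact Complex.continuous_ofReal.comp_continuousOn hG.cont
  have e1 : ((∫ x in A..B, Φ x * g (ξ * x ^ m) : ℝ) : ℂ) = ∑ j ∈ J, c j *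
      ∫ x in A..B, (Φ x : ℂ) * Complex.exp (Complex.I *
        ((2 * Real.pi * ξ * (0 * x ^ (m + 0) + j * x ^ m) : ℝ) : ℂ)) := by
    rw [← intervalIntegral.integral_ofReal]
    simp only [← intervalIntegral.integral_const_mul]
    rw [← intervalIntegral.integral_finsetSum]
    · apply intervalIntegral.integral_congr
      intro x _
      simp only [Complex.ofReal_mul, T.eq, Finset.mul_sum]
      apply Finset.sum_congr rfl
      intro j _
      push_cast
      ring_nf
    · intro j _
      apply ContinuousOn.intervalIntegrable
      exact continuousOn_const.mul (hΦC.mul (Continuous.continuousOn (by fun_prop)))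
  have e2 : |∫ x in A..B, Φ x * g (ξ * x ^ m)| = ‖((∫ x in A..B, Φ x * g (ξ * x ^ m) : ℝ) : ℂ)‖ := by
    rw [Complex.norm_real, Real.norm_eq_abs]
  rw [e2, e1]
  refine (norm_sum_le _ _).trans ?_
  calc _ ≤ ∑ j ∈ J, ‖c j‖ * (28 * ε / (2 * Real.pi * ξ) * ∫ y in A..B, Φ y) := by
        apply Finset.sum_le_sum
        intro j hj
        rw [norm_mul]
        apply mul_le_mul_of_nonneg_left _ (norm_nonneg _)
        have := aux_pair A B ε ξ hξ hA hAB hε Φ Ψ' m 0 hm hG 0 j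
        refine this.trans ?_
        have h1 : (1:ℝ) ≤ |(j:ℝ)| := by
          have := Int.one_le_abs (T.ne0 j hj)
          exact_mod_cast this
        have h2 : ¬ (|(j:ℝ)| < 1) := not_lt.2 h1
        simp [h2]
    _ ≤ _ := by
        rw [← Finset.sum_mul]
        have := T.l1
        have h0 : 0 ≤ 28 * ε / (2 * Real.pi * ξ) := by positivity
        have := mul_le_mul_of_nonneg_right this (mul_nonneg h0 hI0)
        refine this.trans (le_of_eq ?_)
        ring

lemma TP.quad {g : ℝ → ℝ} {J : Finset ℤ} {c : ℤ → ℂ} {F L K : ℝ} (T : TP g J c F L K)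
    (A B ε ξ : ℝ) (hξ : 0 < ξ) (hA : 1 < A) (hAB : B - A = 1) (hε : 0 ≤ ε) (Φ Ψ' : ℝ → ℝ)
    (m h : ℕ) (hm : 1 ≤ m) (hG : GoodW A B ε Φ m Ψ') :
    |∫ x in A..B, Φ x * (g (ξ * x ^ (m + h)) * g (ξ * x ^ m))| ≤
      (28 * ε / (2 * Real.pi * ξ) * L ^ 2 + 16 * F / A ^ h) * ∫ y in A..B, Φ y := by
  have hle : A ≤ B := by linarith
  have hI0 : 0 ≤ ∫ y in A..B, Φ y := intervalIntegral.integral_nonneg hle hG.nonneg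
  have hΦC : ContinuousOn (fun x => (Φ x : ℂ)) (Set.uIcc A B) := by
    rw [Set.uIcc_of_le hle]; exact Complex.continuous_ofReal.comp_continuousOn hG.cont
  have hΦi : IntervalIntegrable Φ volume A B :=
    ContinuousOn.intervalIntegrable (by rw [Set.uIcc_of_le hle]; exact hG.cont)
  have hL0 : 0 ≤ L := le_trans (Finset.sum_nonneg (fun _ _ => norm_nonneg _)) T.l1
  have e1 : ((∫ x in A..B, Φ x * (g (ξ * x ^ (m + h)) * g (ξ * x ^ m)) : ℝ) : ℂ) =
      ∑ j ∈ J, ∑ j' ∈ J, c j * c j' *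
      ∫ x in A..B, (Φ x : ℂ) * Complex.exp (Complex.I *
        ((2 * Real.pi * ξ * (j * x ^ (m + h) + j' * x ^ m) : ℝ) : ℂ)) := by
    rw [← intervalIntegral.integral_ofReal]
    simp only [← intervalIntegral.integral_const_mul]
    have hint : ∀ j ∈ J, ∀ j' ∈ J, IntervalIntegrable (fun x : ℝ => c j * c j' *
        ((Φ x : ℂ) * Complex.exp (Complex.I *
        ((2 * Real.pi * ξ * (j * x ^ (m + h) + j' * x ^ m) : ℝ) : ℂ)))) volume A B := by
      intro j _ j' _
      apply ContinuousOn.intervalIntegrable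
      exact continuousOn_const.mul (hΦC.mul (Continuous.continuousOn (by fun_prop)))
    have : ∀ j ∈ J, ∑ j' ∈ J, ∫ x in A..B, c j * c j' *
        ((Φ x : ℂ) * Complex.exp (Complex.I *
        ((2 * Real.pi * ξ * (j * x ^ (m + h) + j' * x ^ m) : ℝ) : ℂ))) =
        ∫ x in A..B, ∑ j' ∈ J, c j * c j' *
        ((Φ x : ℂ) * Complex.exp (Complex.I *
        ((2 * Real.pi * ξ * (j * x ^ (m + h) + j' * x ^ m) : ℝ) : ℂ))) := by
      intro j hj
      rw [intervalIntegral.integral_finsetSum (hint j hj)]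
    rw [Finset.sum_congr rfl this, ← intervalIntegral.integral_finsetSum]
    · apply intervalIntegral.integral_congr
      intro x _
      simp only [Complex.ofReal_mul, T.eq]
      rw [Finset.sum_mul_sum, Finset.mul_sum]
      apply Finset.sum_congr rfl
      intro j _
      rw [Finset.mul_sum]
      apply Finset.sum_congr rfl
      intro j' _
      rw [mul_mul_mul_comm, ← Complex.exp_add]
      push_cast
      ring_nf
    · intro j hj
      have := IntervalIntegrable.sum J (hint j hj)
      rw [Finset.sum_fn] at this
      exact this
  have e2 : |∫ x in A..B, Φ x * (g (ξ * x ^ (m + h)) * g (ξ * x ^ m))| =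
      ‖((∫ x in A..B, Φ x * (g (ξ * x ^ (m + h)) * g (ξ * x ^ m)) : ℝ) : ℂ)‖ := by
    rw [Complex.norm_real, Real.norm_eq_abs]
  rw [e2, e1]
  set κ := 28 * ε / (2 * Real.pi * ξ) with hκ
  set I := ∫ y in A..B, Φ y with hI
  have h0 : 0 ≤ κ := by positivity
  set χ : ℤ → ℤ → ℝ → ℝ := fun j j' x =>
    (if |(j:ℝ) * ((m + h : ℝ) / m) * x ^ h + j'| < 1 then (1:ℝ) else 0) with hχ
  have hχi : ∀ j j', IntervalIntegrable (fun x => Φ x * χ j j' x) volume A B := by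
    intro j j'
    have hopen : MeasurableSet {x : ℝ | |(j:ℝ) * ((m + h : ℝ) / m) * x ^ h + j'| < 1} :=
      (isOpen_lt (by fun_prop) continuous_const).measurableSet
    have : (fun x => Φ x * χ j j' x) =
        Set.indicator {x : ℝ | |(j:ℝ) * ((m + h : ℝ) / m) * x ^ h + j'| < 1} Φ := by
      ext x
      simp [Set.indicator_apply, hχ]
    rw [this, intervalIntegrable_iff]
    exact (intervalIntegrable_iff.1 hΦi).indicator hopen
  have hχi2 : ∀ j j', IntervalIntegrable (fun x => ‖c j‖ * ‖c j'‖ * (Φ x * χ j j' x)) volume A B :=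
    fun j j' => (hχi j j').const_mul _
  have hχi3 : ∀ j, IntervalIntegrable (fun x => ∑ j' ∈ J, ‖c j‖ * ‖c j'‖ * (Φ x * χ j j' x)) volume A B := by
    intro j
    have := IntervalIntegrable.sum J (fun j' _ => hχi2 j j')
    rw [Finset.sum_fn] at this
    exact this
  have hχi4 : IntervalIntegrable (fun x => ∑ j ∈ J, ∑ j' ∈ J, ‖c j‖ * ‖c j'‖ * (Φ x * χ j j' x)) volume A B := by
    have := IntervalIntegrable.sum J (fun j _ => hχi3 j)
    rw [Finset.sum_fn] at this
    exact this
  have hρ : (1:ℝ) ≤ (m + h : ℝ) / m := by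
    have hm0 : (0:ℝ) < m := by exact_mod_cast hm
    rw [le_div_iff₀ hm0]
    have : (0:ℝ) ≤ h := by positivity
    linarith
  have hres : ∑ j ∈ J, ∑ j' ∈ J, ‖c j‖ * ‖c j'‖ * ∫ x in A..B, Φ x * χ j j' x ≤ 16 * F / A ^ h * I := by
    simp only [← intervalIntegral.integral_const_mul]
    have : ∀ j ∈ J, ∑ j' ∈ J, ∫ x in A..B, ‖c j‖ * ‖c j'‖ * (Φ x * χ j j' x) =
        ∫ x in A..B, ∑ j' ∈ J, ‖c j‖ * ‖c j'‖ * (Φ x * χ j j' x) := by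
      intro j _
      rw [intervalIntegral.integral_finsetSum (fun j' _ => hχi2 j j')]
    rw [Finset.sum_congr rfl this, ← intervalIntegral.integral_finsetSum (fun j _ => hχi3 j)]
    rw [hI, ← intervalIntegral.integral_const_mul]
    apply intervalIntegral.integral_mono_on hle hχi4 (hΦi.const_mul _)
    intro x hx
    have := T.res A ((m + h : ℝ) / m) x h hA hρ hx.1
    have h5 := mul_le_mul_of_nonneg_right this (hG.nonneg x hx)
    refine le_trans (le_of_eq ?_) h5
    simp only [Finset.sum_mul, hχ]
    apply Finset.sum_congr rfl
    intro j _
    apply Finset.sum_congr rfl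
    intro j' _
    ring
  calc _ ≤ ∑ j ∈ J, ∑ j' ∈ J, ‖c j‖ * ‖c j'‖ * (κ * I + ∫ x in A..B, Φ x * χ j j' x) := by
        refine (norm_sum_le _ _).trans ?_
        apply Finset.sum_le_sum
        intro j hj
        refine (norm_sum_le _ _).trans ?_
        apply Finset.sum_le_sum
        intro j' hj'
        rw [norm_mul, norm_mul]
        apply mul_le_mul_of_nonneg_left _ (by positivity)
        exact aux_pair A B ε ξ hξ hA hAB hε Φ Ψ' m h hm hG j j'
    _ = (∑ j ∈ J, ‖c j‖) * (∑ j ∈ J, ‖c j‖) * (κ * I) +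
        ∑ j ∈ J, ∑ j' ∈ J, ‖c j‖ * ‖c j'‖ * ∫ x in A..B, Φ x * χ j j' x := by
        rw [Finset.sum_mul_sum]
        simp only [mul_add, Finset.sum_add_distrib, Finset.sum_mul]
    _ ≤ L * L * (κ * I) + 16 * F / A ^ h * I := by
        have hs0 : 0 ≤ ∑ j ∈ J, ‖c j‖ := Finset.sum_nonneg (fun _ _ => norm_nonneg _)
        have := mul_le_mul T.l1 T.l1 hs0 hL0
        have h6 := mul_le_mul_of_nonneg_right this (mul_nonneg h0 hI0)
        linarith
    _ = _ := by ring


lemma geo_aux (r : ℝ) (hr0 : 0 ≤ r) (hr1 : r < 1) (E : Finset ℕ) (φ : ℕ → ℕ) (hφ : Set.InjOn φ E) :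
    ∑ e ∈ E, r ^ (φ e) ≤ (1 - r)⁻¹ := by
  rw [← Finset.sum_image (f := fun h => r ^ h) hφ, ← tsum_geometric_of_lt_one hr0 hr1]
  exact (summable_geometric_of_lt_one hr0 hr1).sum_le_tsum _ (fun i _ => by positivity)

lemma geo_sum (r : ℝ) (hr0 : 0 ≤ r) (hr1 : r < 1) (E : Finset ℕ) (e : ℕ) :
    ∑ e' ∈ E, r ^ ((e - e') + (e' - e)) ≤ 2 * (1 - r)⁻¹ := by
  rw [← Finset.sum_filter_add_sum_filter_not E (fun e' => e' ≤ e), two_mul]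
  apply add_le_add
  · apply geo_aux r hr0 hr1
    intro a ha b hb hab
    simp only [Finset.coe_filter, Set.mem_ofPred_eq] at ha hb
    simp only at hab
    omega
  · apply geo_aux r hr0 hr1
    intro a ha b hb hab
    simp only [Finset.coe_filter, Set.mem_ofPred_eq] at ha hb
    simp only at hab
    omega

lemma TP.deriv {g : ℝ → ℝ} {J : Finset ℤ} {c : ℤ → ℂ} {F L K : ℝ} (T : TP g J c F L K) :
    ∃ g' : ℝ → ℝ, Continuous g' ∧ (∀ y, HasDerivAt g (g' y) y) ∧ ∀ y, |g' y| ≤ 2 * Real.pi * K := by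
  refine ⟨fun y => (∑ j ∈ J, c j * (Complex.exp (Complex.I * ((2 * Real.pi * j * y : ℝ) : ℂ)) *
    (Complex.I * ((2 * Real.pi * j : ℝ) : ℂ)))).re, ?_, ?_, ?_⟩
  · fun_prop
  · intro y
    have hg : g = fun y => (∑ j ∈ J, c j * Complex.exp (Complex.I * ((2 * Real.pi * j * y : ℝ) : ℂ))).re := by
      ext y; rw [← T.eq]; simp
    rw [hg]
    have : HasDerivAt (fun y : ℝ => ∑ j ∈ J, c j * Complex.exp (Complex.I * ((2 * Real.pi * j * y : ℝ) : ℂ)))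
        (∑ j ∈ J, c j * (Complex.exp (Complex.I * ((2 * Real.pi * j * y : ℝ) : ℂ)) *
    (Complex.I * ((2 * Real.pi * j : ℝ) : ℂ)))) y := by
      apply HasDerivAt.fun_sum
      intro j _
      apply HasDerivAt.const_mul
      apply HasDerivAt.cexp
      apply HasDerivAt.const_mul
      apply HasDerivAt.ofReal_comp
      simpa using (hasDerivAt_id y).const_mul (2 * Real.pi * (j:ℝ))
    exact Complex.reCLM.hasFDerivAt.comp_hasDerivAt y this
  · intro y
    refine (Complex.abs_re_le_norm _).trans ((norm_sum_le _ _).trans ?_)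
    calc _ = ∑ j ∈ J, 2 * Real.pi * (‖c j‖ * |(j:ℝ)|) := by
          apply Finset.sum_congr rfl
          intro j _
          rw [norm_mul, norm_mul, norm_mul, mul_comm Complex.I, Complex.norm_exp_ofReal_mul_I,
            Complex.norm_I, Complex.norm_real, Real.norm_eq_abs, abs_mul, abs_of_pos Real.two_pi_pos]
          ring
      _ ≤ _ := by
          rw [← Finset.mul_sum]
          exact mul_le_mul_of_nonneg_left T.lK Real.two_pi_pos.le

lemma TP.bdd {g : ℝ → ℝ} {J : Finset ℤ} {c : ℤ → ℂ} {F L K : ℝ} (T : TP g J c F L K) (y : ℝ) :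
    |g y| ≤ L := by
  have : |g y| = ‖(g y : ℂ)‖ := by rw [Complex.norm_real, Real.norm_eq_abs]
  rw [this, T.eq]
  refine (norm_sum_le _ _).trans (le_trans (le_of_eq ?_) T.l1)
  apply Finset.sum_congr rfl
  intro j _
  rw [norm_mul, mul_comm Complex.I, Complex.norm_exp_ofReal_mul_I, mul_one]

lemma TP.good {g : ℝ → ℝ} {J : Finset ℤ} {c : ℤ → ℂ} {F L K : ℝ} (T : TP g J c F L K)
    (A B ξ t : ℝ) (hξ : 0 < ξ) (hA : 1 < A) (hAB : B - A = 1) (ht : 0 ≤ t) (hK : 0 ≤ K)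
    (P : Finset ℕ) (m q : ℕ) (hm : 1 ≤ m) (hq : q ≤ m) (hP : ∀ e ∈ P, e + q ≤ m) (ε : ℝ)
    (hε : (B + 1 + t * P.card * (2 * Real.pi * K * ξ)) / A ^ q ≤ ε) :
    ∃ Ψ', GoodW A B ε (fun x => Real.exp (t * ∑ e ∈ P, g (ξ * x ^ e))) m Ψ' := by
  obtain ⟨g', hg'c, hg', hg'b⟩ := T.deriv
  have hgc : Continuous g := continuous_iff_continuousAt.2 fun y => (hg' y).continuousAt
  set Φ : ℝ → ℝ := fun x => Real.exp (t * ∑ e ∈ P, g (ξ * x ^ e)) with hΦ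
  set S' : ℝ → ℝ := fun x => ∑ e ∈ P, g' (ξ * x ^ e) * (ξ * (e * x ^ (e - 1))) with hS'
  have hm0 : (0:ℝ) < m := by exact_mod_cast hm
  have hAq : (0:ℝ) < A ^ q := by positivity
  have hΦc : Continuous Φ := by simp only [hΦ]; fun_prop
  have hS'c : Continuous S' := by simp only [hS']; fun_prop
  have hpos : ∀ x ∈ Set.Icc A B, 0 < x := fun x hx => by linarith [hx.1]
  have hΦpos : ∀ x, 0 < Φ x := fun x => Real.exp_pos _
  have hPc : 0 ≤ t * P.card * (2 * Real.pi * K * ξ) := by positivity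
  have hB : 0 < B := by linarith
  refine ⟨fun x => Φ x * (t * S' x) * (m * x ^ (m - 1) : ℝ)⁻¹ +
    Φ x * (-(m * ((m - 1 : ℕ) * x ^ (m - 1 - 1))) / (m * x ^ (m - 1)) ^ 2), ?_, ?_, ?_, ?_, ?_, ?_⟩
  · exact hΦc.continuousOn
  · exact fun x _ => (hΦpos x).le
  · intro x hx
    have hx0 := hpos x hx
    have d1 : HasDerivAt Φ (Φ x * (t * S' x)) x := by
      apply HasDerivAt.exp
      apply HasDerivAt.const_mul
      apply HasDerivAt.fun_sum
      intro e _
      exact (hg' (ξ * x ^ e)).comp x ((hasDerivAt_pow e x).const_mul ξ)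
    have d2 := (((hasDerivAt_pow (m - 1) x).const_mul (m:ℝ)).inv (by positivity))
    exact d1.mul d2
  · have hne : ∀ x ∈ Set.Icc A B, (m * x ^ (m - 1) : ℝ) ≠ 0 := fun x hx => by
      have := hpos x hx; positivity
    refine ContinuousOn.add ?_ ?_
    · refine ContinuousOn.mul (by fun_prop) (ContinuousOn.inv₀ (by fun_prop) hne)
    · refine ContinuousOn.mul (by fun_prop) (ContinuousOn.div (by fun_prop) (by fun_prop) ?_)
      exact fun x hx => pow_ne_zero _ (hne x hx)
  · intro x hx
    have hx0 := hpos x hx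
    have hx1 : 1 ≤ x := by linarith [hx.1]
    have b1 : |S' x| * (m * x ^ (m - 1) : ℝ)⁻¹ ≤ P.card * (2 * Real.pi * K * ξ) / A ^ q := by
      have : |S' x| ≤ ∑ e ∈ P, (2 * Real.pi * K) * (ξ * (e * x ^ (e - 1))) := by
        refine (Finset.abs_sum_le_sum_abs _ _).trans (Finset.sum_le_sum fun e _ => ?_)
        rw [abs_mul, abs_of_nonneg (by positivity : 0 ≤ ξ * (e * x ^ (e - 1)))]
        exact mul_le_mul_of_nonneg_right (hg'b _) (by positivity)
      calc _ ≤ (∑ e ∈ P, (2 * Real.pi * K) * (ξ * (e * x ^ (e - 1)))) * (m * x ^ (m - 1) : ℝ)⁻¹ :=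
            mul_le_mul_of_nonneg_right this (by positivity)
        _ = ∑ e ∈ P, (2 * Real.pi * K * ξ) * (e * x ^ (e - 1) * (m * x ^ (m - 1) : ℝ)⁻¹) := by
            rw [Finset.sum_mul]
            apply Finset.sum_congr rfl
            intros; ring
        _ ≤ ∑ e ∈ P, (2 * Real.pi * K * ξ) * (1 / A ^ q) := by
            apply Finset.sum_le_sum
            intro e he
            apply mul_le_mul_of_nonneg_left _ (by positivity)
            rw [← div_eq_mul_inv, div_le_div_iff₀ (by positivity) hAq, one_mul]
            have hem := hP e he
            rcases Nat.eq_zero_or_pos e with h0 | h0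
            · subst h0; simp; positivity
            · have h1 : A ^ q ≤ x ^ q := by gcongr; exact hx.1
              have h2 : x ^ (e - 1) * x ^ q ≤ x ^ (m - 1) := by
                rw [← pow_add]; exact pow_le_pow_right₀ hx1 (by omega)
              have h3 : (e:ℝ) ≤ m := by exact_mod_cast (by omega : e ≤ m)
              calc (e:ℝ) * x ^ (e - 1) * A ^ q ≤ e * x ^ (e - 1) * x ^ q := by gcongr
                _ = e * (x ^ (e - 1) * x ^ q) := by ring
                _ ≤ m * x ^ (m - 1) := by gcongr
        _ = _ := by rw [Finset.sum_const, nsmul_eq_mul]; ring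
    have b2 : |(-(m * ((m - 1 : ℕ) * x ^ (m - 1 - 1))) / (m * x ^ (m - 1)) ^ 2 : ℝ)| ≤ 1 / A ^ q := by
      rw [abs_div, abs_neg, abs_of_nonneg (by positivity : (0:ℝ) ≤ (m * ((m - 1 : ℕ) * x ^ (m - 1 - 1)))),
        abs_of_nonneg (by positivity : (0:ℝ) ≤ (m * x ^ (m - 1)) ^ 2),
        div_le_div_iff₀ (by positivity) hAq, one_mul]
      rcases Nat.lt_or_ge 1 m with h1 | h1
      · have h1' : A ^ q ≤ x ^ q := by gcongr; exact hx.1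
        have h2 : x ^ (m - 1 - 1) * x ^ q ≤ (x ^ (m - 1)) ^ 2 := by
          rw [← pow_add, ← pow_mul]; exact pow_le_pow_right₀ hx1 (by omega)
        have h3 : (((m - 1 : ℕ)) : ℝ) ≤ m := by exact_mod_cast (by omega : m - 1 ≤ m)
        calc (m * ((m - 1 : ℕ) * x ^ (m - 1 - 1))) * A ^ q
            ≤ (m * (m * x ^ (m - 1 - 1))) * x ^ q := by gcongr
          _ = m ^ 2 * (x ^ (m - 1 - 1) * x ^ q) := by ring
          _ ≤ m ^ 2 * (x ^ (m - 1)) ^ 2 := by gcongr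
          _ = _ := by ring
      · have : m = 1 := by omega
        subst this
        simp
    have : 0 < Φ x := hΦpos x
    refine (abs_add_le _ _).trans ?_
    rw [abs_mul, abs_mul, abs_mul, abs_mul, abs_of_pos this, abs_of_nonneg ht,
      abs_of_nonneg (by positivity : (0:ℝ) ≤ (m * x ^ (m - 1) : ℝ)⁻¹)]
    have hε' : t * (P.card * (2 * Real.pi * K * ξ) / A ^ q) + 1 / A ^ q ≤ ε := by
      refine le_trans ?_ hε
      have : t * (P.card * (2 * Real.pi * K * ξ) / A ^ q) + 1 / A ^ q
        = (1 + t * P.card * (2 * Real.pi * K * ξ)) / A ^ q := by ring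
      rw [this]
      gcongr
      linarith
    have hε0 : 0 ≤ ε := le_trans (by positivity) hε'
    calc Φ x * (t * |S' x|) * (m * x ^ (m - 1) : ℝ)⁻¹ + Φ x * |(-(m * ((m - 1 : ℕ) * x ^ (m - 1 - 1))) / (m * x ^ (m - 1)) ^ 2 : ℝ)|
        = Φ x * (t * (|S' x| * (m * x ^ (m - 1) : ℝ)⁻¹) + |(-(m * ((m - 1 : ℕ) * x ^ (m - 1 - 1))) / (m * x ^ (m - 1)) ^ 2 : ℝ)|) := by ring
      _ ≤ Φ x * (t * (P.card * (2 * Real.pi * K * ξ) / A ^ q) + 1 / A ^ q) := by gcongr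
      _ ≤ Φ x * ε := by gcongr
      _ ≤ _ := by nlinarith
  · intro x hx
    have hx0 := hpos x hx
    have hx1 : 1 ≤ x := by linarith [hx.1]
    have : (m * x ^ (m - 1) : ℝ)⁻¹ ≤ ε := by
      refine le_trans ?_ hε
      rw [inv_eq_one_div, div_le_div_iff₀ (by positivity) hAq, one_mul]
      have h1 : A ^ q ≤ x ^ q := by gcongr; exact hx.1
      have h2 : x ^ q ≤ x * x ^ (m - 1) := by
        rw [← pow_succ']; exact pow_le_pow_right₀ hx1 (by omega)
      have h3 : (1:ℝ) ≤ m := by exact_mod_cast hm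
      calc A ^ q ≤ x * x ^ (m - 1) := h1.trans h2
        _ ≤ B * (m * x ^ (m - 1)) := by
          apply mul_le_mul hx.2 _ (by positivity) hB.le
          exact le_mul_of_one_le_left (by positivity) h3
        _ ≤ _ := by
          apply mul_le_mul_of_nonneg_right _ (by positivity)
          linarith
    have h4 := (hΦpos x).le
    calc _ ≤ Φ x * ε := mul_le_mul_of_nonneg_left this h4
      _ = _ := mul_comm _ _


lemma TP.step {g : ℝ → ℝ} {J : Finset ℤ} {c : ℤ → ℂ} {F L K : ℝ} (T : TP g J c F L K)
    (A B ξ t : ℝ) (hξ : 0 < ξ) (hA : 1 < A) (hAB : B - A = 1) (ht : 0 ≤ t) (hK : 0 ≤ K)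
    (P E : Finset ℕ) (q : ℕ) (hE : ∀ m ∈ E, 1 ≤ m) (hq : ∀ m ∈ E, q ≤ m)
    (hP : ∀ e ∈ P, ∀ m ∈ E, e + q ≤ m) (ε : ℝ)
    (hε : (B + 1 + t * P.card * (2 * Real.pi * K * ξ)) / A ^ q ≤ ε) (p : ℕ) (hp : E.card ≤ p)
    (htp : t * (p * L) ≤ 1) :
    ∫ x in A..B, Real.exp (t * (∑ e ∈ P, g (ξ * x ^ e) + ∑ e ∈ E, g (ξ * x ^ e))) ≤
      (1 + (28 * ε / (2 * Real.pi * ξ) * 2 + t ^ 2 * (p * (F * (32 * (1 - A⁻¹)⁻¹))))) *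
        ∫ x in A..B, Real.exp (t * ∑ e ∈ P, g (ξ * x ^ e)) := by
  have hle : A ≤ B := by linarith
  have hB : 0 < B := by linarith
  have hL0 : 0 ≤ L := le_trans (Finset.sum_nonneg (fun _ _ => norm_nonneg _)) T.l1
  have hF0 := T.F0
  have hε0 : 0 ≤ ε := le_trans (by positivity) hε
  obtain ⟨g', hg'c, hg', hg'b⟩ := T.deriv
  have hgc : Continuous g := continuous_iff_continuousAt.2 fun y => (hg' y).continuousAt
  set Φ : ℝ → ℝ := fun x => Real.exp (t * ∑ e ∈ P, g (ξ * x ^ e)) with hΦ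
  have hgood : ∀ m ∈ E, ∃ Ψ', GoodW A B ε Φ m Ψ' := fun m hm =>
    T.good A B ξ t hξ hA hAB ht hK P m q (hE m hm) (hq m hm) (fun e he => hP e he m hm) ε hε
  have hΦc : Continuous Φ := by simp only [hΦ]; fun_prop
  set U : ℝ → ℝ := fun x => ∑ e ∈ E, g (ξ * x ^ e) with hU
  have hUc : Continuous U := by simp only [hU]; fun_prop
  set κ := 28 * ε / (2 * Real.pi * ξ) with hκ
  have hκ0 : 0 ≤ κ := by positivity
  set I := ∫ x in A..B, Φ x with hI
  have hI0 : 0 ≤ I := intervalIntegral.integral_nonneg hle (fun x _ => (Real.exp_pos _).le)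
  have hUb : ∀ x, |t * U x| ≤ 1 := by
    intro x
    rw [abs_mul, abs_of_nonneg ht]
    refine le_trans (mul_le_mul_of_nonneg_left ?_ ht) htp
    calc |U x| ≤ ∑ e ∈ E, |g (ξ * x ^ e)| := Finset.abs_sum_le_sum_abs _ _
      _ ≤ ∑ e ∈ E, L := Finset.sum_le_sum fun e _ => T.bdd _
      _ = E.card * L := by rw [Finset.sum_const, nsmul_eq_mul]
      _ ≤ p * L := by gcongr
  have h1 : ∫ x in A..B, Real.exp (t * (∑ e ∈ P, g (ξ * x ^ e) + ∑ e ∈ E, g (ξ * x ^ e))) ≤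
      ∫ x in A..B, (Φ x + t * (Φ x * U x) + t ^ 2 * (Φ x * (U x * U x))) := by
    apply intervalIntegral.integral_mono_on hle
    · apply Continuous.intervalIntegrable; fun_prop
    · apply Continuous.intervalIntegrable; fun_prop
    · intro x _
      rw [mul_add, Real.exp_add]
      have h2 := Real.abs_exp_sub_one_sub_id_le (hUb x)
      have h3 := (le_abs_self _).trans h2
      have h4 : Real.exp (t * U x) ≤ 1 + t * U x + (t * U x) ^ 2 := by linarith
      have := mul_le_mul_of_nonneg_left h4 (Real.exp_pos (t * ∑ e ∈ P, g (ξ * x ^ e))).le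
      refine this.trans (le_of_eq ?_)
      simp only [hΦ]
      ring
  have h2 : ∫ x in A..B, (Φ x + t * (Φ x * U x) + t ^ 2 * (Φ x * (U x * U x))) =
      I + t * (∫ x in A..B, Φ x * U x) + t ^ 2 * ∫ x in A..B, Φ x * (U x * U x) := by
    rw [intervalIntegral.integral_add, intervalIntegral.integral_add,
      intervalIntegral.integral_const_mul, intervalIntegral.integral_const_mul]
    all_goals apply Continuous.intervalIntegrable; fun_prop
  have h3 : ∫ x in A..B, Φ x * U x ≤ p * (κ * L * I) := by
    simp only [hU, Finset.mul_sum]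
    rw [intervalIntegral.integral_finsetSum
      (fun e _ => by apply Continuous.intervalIntegrable; fun_prop)]
    calc _ ≤ ∑ e ∈ E, κ * L * I := by
          apply Finset.sum_le_sum
          intro m hm
          obtain ⟨Ψ', hG⟩ := hgood m hm
          exact (le_abs_self _).trans (T.lin A B ε ξ hξ hA hAB hε0 Φ Ψ' m (hE m hm) hG)
      _ = E.card * (κ * L * I) := by rw [Finset.sum_const, nsmul_eq_mul]
      _ ≤ _ := by gcongr
  have hsym : ∀ e ∈ E, ∀ m ∈ E, m ≤ e → ∫ x in A..B, Φ x * (g (ξ * x ^ e) * g (ξ * x ^ m)) ≤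
      (κ * L ^ 2 + 16 * F * A⁻¹ ^ ((e - m) + (m - e))) * I := by
    intro e he m hm hme
    obtain ⟨Ψ', hG⟩ := hgood m hm
    obtain ⟨h, rfl⟩ := Nat.exists_eq_add_of_le hme
    have := (le_abs_self _).trans (T.quad A B ε ξ hξ hA hAB hε0 Φ Ψ' m h (hE m hm) hG)
    refine this.trans (le_of_eq ?_)
    have h5 : m + h - m + (m - (m + h)) = h := by omega
    rw [h5, inv_pow]
    ring
  have h4 : ∫ x in A..B, Φ x * (U x * U x) ≤ (p * p * (κ * L ^ 2) + p * (16 * F * (2 * (1 - A⁻¹)⁻¹))) * I := by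
    simp only [hU, Finset.sum_mul_sum]
    simp only [Finset.mul_sum]
    rw [intervalIntegral.integral_finsetSum
      (fun e _ => by apply Continuous.intervalIntegrable; fun_prop)]
    have hr0 : 0 ≤ A⁻¹ := by positivity
    have hr1 : A⁻¹ < 1 := inv_lt_one_of_one_lt₀ hA
    have hr2 : 0 ≤ (1 - A⁻¹)⁻¹ := inv_nonneg.2 (by linarith)
    calc _ ≤ ∑ e ∈ E, ∑ m ∈ E, (κ * L ^ 2 + 16 * F * A⁻¹ ^ ((e - m) + (m - e))) * I := by
          apply Finset.sum_le_sum
          intro e he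
          rw [intervalIntegral.integral_finsetSum
            (fun e _ => by apply Continuous.intervalIntegrable; fun_prop)]
          apply Finset.sum_le_sum
          intro m hm
          rcases le_total m e with h | h
          · exact hsym e he m hm h
          · have := hsym m hm e he h
            rw [add_comm (m - e)] at this
            refine le_trans (le_of_eq ?_) this
            apply intervalIntegral.integral_congr
            intro x _
            simp only
            ring
      _ = (∑ e ∈ E, (E.card * (κ * L ^ 2) + 16 * F * ∑ m ∈ E, A⁻¹ ^ ((e - m) + (m - e)))) * I := by
          rw [Finset.sum_mul]
          apply Finset.sum_congr rfl
          intro e _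
          rw [← Finset.sum_mul, Finset.sum_add_distrib, Finset.sum_const, nsmul_eq_mul, Finset.mul_sum]
      _ ≤ (∑ e ∈ E, (p * (κ * L ^ 2) + 16 * F * (2 * (1 - A⁻¹)⁻¹))) * I := by
          apply mul_le_mul_of_nonneg_right _ hI0
          apply Finset.sum_le_sum
          intro e _
          have := geo_sum A⁻¹ hr0 hr1 E e
          gcongr
      _ = (E.card * (p * (κ * L ^ 2) + 16 * F * (2 * (1 - A⁻¹)⁻¹))) * I := by
          rw [Finset.sum_const, nsmul_eq_mul]
      _ ≤ (p * (p * (κ * L ^ 2) + 16 * F * (2 * (1 - A⁻¹)⁻¹))) * I := by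
          gcongr
      _ = _ := by ring
  have h5 : t * (∫ x in A..B, Φ x * U x) ≤ κ * I := by
    calc _ ≤ t * (p * (κ * L * I)) := mul_le_mul_of_nonneg_left h3 ht
      _ = (t * (p * L)) * (κ * I) := by ring
      _ ≤ 1 * (κ * I) := mul_le_mul_of_nonneg_right htp (by positivity)
      _ = _ := one_mul _
  have h6 : t ^ 2 * ∫ x in A..B, Φ x * (U x * U x) ≤
      κ * I + t ^ 2 * (p * (16 * F * (2 * (1 - A⁻¹)⁻¹))) * I := by
    calc _ ≤ t ^ 2 * ((p * p * (κ * L ^ 2) + p * (16 * F * (2 * (1 - A⁻¹)⁻¹))) * I) :=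
          mul_le_mul_of_nonneg_left h4 (by positivity)
      _ = (t * (p * L)) ^ 2 * (κ * I) + t ^ 2 * (p * (16 * F * (2 * (1 - A⁻¹)⁻¹))) * I := by ring
      _ ≤ 1 * (κ * I) + _ := by
          apply add_le_add_left
          apply mul_le_mul_of_nonneg_right _ (by positivity)
          apply pow_le_one₀ (by positivity) htp
      _ = _ := by ring
  refine h1.trans ?_
  rw [h2]
  have : (1 + (κ * 2 + t ^ 2 * (p * (F * (32 * (1 - A⁻¹)⁻¹))))) * I =
    I + κ * I + (κ * I + t ^ 2 * (p * (16 * F * (2 * (1 - A⁻¹)⁻¹))) * I) := by ring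
  rw [this]
  linarith

/-- Iterating over separated blocks. -/
lemma TP.iter {g : ℝ → ℝ} {J : Finset ℤ} {c : ℤ → ℂ} {F L K : ℝ} (T : TP g J c F L K)
    (A B ξ t : ℝ) (hξ : 0 < ξ) (hA : 1 < A) (hAB : B - A = 1) (ht : 0 ≤ t) (hK : 0 ≤ K)
    (E : ℕ → Finset ℕ) (q : ℕ) (hE : ∀ k, ∀ m ∈ E k, 1 ≤ m) (hq : ∀ k, 1 ≤ k → ∀ m ∈ E k, q ≤ m)
    (hP : ∀ i k, i < k → ∀ e ∈ E i, ∀ m ∈ E k, e + q < m) (N : ℕ) (ε : ℝ)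
    (hN : ∀ k, ((Finset.range k).biUnion E).card ≤ N)
    (hε : (B + 1 + t * N * (2 * Real.pi * K * ξ)) / A ^ q ≤ ε) (p : ℕ) (hp : ∀ k, (E k).card ≤ p)
    (htp : t * (p * L) ≤ 1) (k : ℕ) :
    ∫ x in A..B, Real.exp (t * (∑ i ∈ Finset.range (k + 1), ∑ e ∈ E i, g (ξ * x ^ e))) ≤
      Real.exp 1 * Real.exp (k * (28 * ε / (2 * Real.pi * ξ) * 2 + t ^ 2 * (p * (F * (32 * (1 - A⁻¹)⁻¹))))) := by
  have hle : A ≤ B := by linarith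
  have hB : 0 < B := by linarith
  have hF0 := T.F0
  have hL0 : 0 ≤ L := le_trans (Finset.sum_nonneg (fun _ _ => norm_nonneg _)) T.l1
  obtain ⟨g', hg'c, hg', hg'b⟩ := T.deriv
  have hgc : Continuous g := continuous_iff_continuousAt.2 fun y => (hg' y).continuousAt
  induction k with
  | zero =>
    simp only [zero_add, Finset.sum_range_one, Nat.cast_zero, zero_mul, Real.exp_zero, mul_one]
    have : ∫ x in A..B, Real.exp (t * ∑ e ∈ E 0, g (ξ * x ^ e)) ≤ ∫ x in A..B, Real.exp 1 := by
      apply intervalIntegral.integral_mono_on hle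
      · apply Continuous.intervalIntegrable; fun_prop
      · simp
      · intro x _
        apply Real.exp_le_exp.2
        refine le_trans (mul_le_mul_of_nonneg_left ?_ ht) htp
        calc ∑ e ∈ E 0, g (ξ * x ^ e) ≤ ∑ e ∈ E 0, L :=
              Finset.sum_le_sum fun e _ => (le_abs_self _).trans (T.bdd _)
          _ = (E 0).card * L := by rw [Finset.sum_const, nsmul_eq_mul]
          _ ≤ p * L := by gcongr; exact hp 0
    refine this.trans (le_of_eq ?_)
    simp [hAB]
  | succ k ih =>
    set δ := (28 * ε / (2 * Real.pi * ξ) * 2 + t ^ 2 * (p * (F * (32 * (1 - A⁻¹)⁻¹)))) with hδ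
    set P := (Finset.range (k + 1)).biUnion E with hPd
    have hPs : ∀ x : ℝ, ∑ i ∈ Finset.range (k + 1), ∑ e ∈ E i, g (ξ * x ^ e) = ∑ e ∈ P, g (ξ * x ^ e) := by
      intro x
      rw [hPd, Finset.sum_biUnion]
      intro a _ b _ hab
      rw [Function.onFun, Finset.disjoint_left]
      intro e hea heb
      rcases lt_or_gt_of_ne hab with h | h
      · have := hP a b h e hea e heb; omega
      · have := hP b a h e heb e hea; omega
    have hs := T.step A B ξ t hξ hA hAB ht hK P (E (k + 1)) q (hE _) (hq _ (by omega))
      (by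
        intro e he m hm
        rw [hPd, Finset.mem_biUnion] at he
        obtain ⟨i, hi, hei⟩ := he
        exact (hP i (k + 1) (Finset.mem_range.1 hi) e hei m hm).le) ε
      (by
        refine le_trans ?_ hε
        have : (P.card : ℝ) ≤ N := by exact_mod_cast hN (k + 1)
        gcongr) p (hp _) htp
    simp only [Finset.sum_range_succ _ (k + 1)]
    simp only [hPs] at ih ⊢
    refine hs.trans ?_
    calc (1 + δ) * _ ≤ Real.exp δ * (Real.exp 1 * Real.exp (k * δ)) := by
          apply mul_le_mul _ ih
          · exact intervalIntegral.integral_nonneg hle (fun x _ => (Real.exp_pos _).le)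
          · exact (Real.exp_pos _).le
          · linarith [Real.add_one_le_exp δ]
      _ = _ := by
          have h9 : ((k + 1 : ℕ) : ℝ) * δ = k * δ + δ := by push_cast; ring
          rw [h9, Real.exp_add (k * δ) δ]
          ring


lemma ii_ofReal {f : ℝ → ℝ} {a b : ℝ} (h : IntervalIntegrable f volume a b) :
    IntervalIntegrable (fun x => (f x : ℂ)) volume a b := ⟨h.1.ofReal, h.2.ofReal⟩

noncomputable def fJ (d : ℕ) : Finset ℤ :=
  (Finset.Icc 1 d).image (fun n : ℕ => (n : ℤ)) ∪ (Finset.Icc 1 d).image (fun n : ℕ => -(n : ℤ))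

lemma fJ_sum {X : Type*} [AddCommMonoid X] (d : ℕ) (h : ℤ → X) :
    ∑ j ∈ fJ d, h j = ∑ j ∈ Finset.Icc 1 d, (h (j : ℤ) + h (-(j : ℤ))) := by
  unfold fJ
  rw [Finset.sum_union, Finset.sum_image, Finset.sum_image, Finset.sum_add_distrib]
  · intro a _ b _ hab
    simpa using hab
  · intro a _ b _ hab
    simpa using hab
  · rw [Finset.disjoint_left]
    intro x hx hy
    simp only [Finset.mem_image, Finset.mem_Icc] at hx hy
    obtain ⟨a, ha, rfl⟩ := hx
    obtain ⟨b, hb, hab⟩ := hy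
    omega

lemma fJ_ne (d : ℕ) (j : ℤ) (hj : j ∈ fJ d) : j ≠ 0 := by
  simp only [fJ, Finset.mem_union, Finset.mem_image, Finset.mem_Icc] at hj
  rcases hj with ⟨a, ha, rfl⟩ | ⟨a, ha, rfl⟩ <;> omega

noncomputable def fc (f : ℝ → ℝ) (j : ℤ) : ℂ :=
  ∫ x in (0:ℝ)..1, (f x : ℂ) * Complex.exp (-(2 * Real.pi * j * Complex.I) * x)

lemma f_int (f : ℝ → ℝ) (hf : eVariationOn f (Set.Icc (0:ℝ) 1) ≤ 2) :
    IntervalIntegrable f volume 0 1 := by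
  have hb : BoundedVariationOn f (Set.Icc (0:ℝ) 1) := (hf.trans_lt (by simp)).ne
  obtain ⟨p, q, hp, hq, rfl⟩ := hb.locallyBoundedVariationOn.exists_monotoneOn_sub_monotoneOn
  have h1 : IntervalIntegrable p volume 0 1 := by
    apply MonotoneOn.intervalIntegrable
    rwa [Set.uIcc_of_le zero_le_one]
  have h2 : IntervalIntegrable q volume 0 1 := by
    apply MonotoneOn.intervalIntegrable
    rwa [Set.uIcc_of_le zero_le_one]
  exact h1.sub h2

lemma f_bdd (f : ℝ → ℝ) (hf : eVariationOn f (Set.Icc (0:ℝ) 1) ≤ 2) (x : ℝ)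
    (hx : x ∈ Set.Icc (0:ℝ) 1) : |f x| ≤ |f 0| + 2 := by
  have hb : BoundedVariationOn f (Set.Icc (0:ℝ) 1) := (hf.trans_lt (by simp)).ne
  have h := hb.dist_le hx (show (0:ℝ) ∈ Set.Icc (0:ℝ) 1 by simp)
  have h2 : (eVariationOn f (Set.Icc (0:ℝ) 1)).toReal ≤ 2 := by
    have := ENNReal.toReal_mono (by simp) hf
    simpa using this
  rw [Real.dist_eq] at h
  have := abs_sub_abs_le_abs_sub (f x) (f 0)
  linarith

lemma fc_decay (f : ℝ → ℝ) (hf : eVariationOn f (Set.Icc (0:ℝ) 1) ≤ 2) (j : ℤ) (hj : j ≠ 0) :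
    ‖fc f j‖ ≤ 2 / |(j : ℝ)| := by
  set n := j.natAbs with hn
  have hn0 : 0 < n := Int.natAbs_pos.2 hj
  have hnR : (0:ℝ) < n := by exact_mod_cast hn0
  have hnj : |(j : ℝ)| = n := by
    rw [hn, Nat.cast_natAbs]; simp
  set I : ℕ → ℝ := fun k => k / n with hI
  have hmono : Monotone I := by
    intro a b hab
    simp only [hI]
    gcongr
  have hI0 : I 0 = 0 := by simp [hI]
  have hIn : I n = 1 := by simp only [hI]; field_simp
  have hs := eVariationOn.sum' f hmono (n := n)
  rw [hI0, hIn] at hs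
  have hfi := f_int f hf
  set c : ℂ := -(2 * Real.pi * j * Complex.I) with hc
  have hc0 : c ≠ 0 := by
    rw [hc]
    simp [Real.pi_ne_zero, hj]
  have hcont : Continuous fun x : ℝ => Complex.exp (c * x) := by fun_prop
  have hgi : IntervalIntegrable (fun x : ℝ => (f x : ℂ) * Complex.exp (c * x)) volume 0 1 :=
    (ii_ofReal hfi).mul_continuousOn hcont.continuousOn
  have hsub : ∀ k < n, Set.Icc (I k) (I (k+1)) ⊆ Set.Icc 0 1 := by
    intro k hk
    apply Set.Icc_subset_Icc
    · rw [← hI0]; exact hmono (Nat.zero_le _)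
    · rw [← hIn]; exact hmono hk
  have hle : ∀ k, I k ≤ I (k+1) := fun k => hmono (Nat.le_succ k)
  have hii : ∀ k < n, IntervalIntegrable (fun x : ℝ => (f x : ℂ) * Complex.exp (c * x)) volume (I k) (I (k+1)) := by
    intro k hk
    apply hgi.mono_set
    rw [Set.uIcc_of_le (hle k), Set.uIcc_of_le zero_le_one]
    exact hsub k hk
  have hsum := intervalIntegral.sum_integral_adjacent_intervals hii
  rw [hI0, hIn] at hsum
  have hfc : fc f j = ∑ k ∈ Finset.range n, ∫ x in I k..I (k+1), (f x : ℂ) * Complex.exp (c * x) := by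
    rw [hsum]; rfl
  have hz : ∀ k : ℕ, ∫ x in I k..I (k+1), Complex.exp (c * x) = 0 := by
    intro k
    rw [integral_exp_mul_complex hc0]
    have : Complex.exp (c * (I (k+1) : ℝ)) = Complex.exp (c * (I k : ℝ)) := by
      rw [Complex.exp_eq_exp_iff_exists_int]
      refine ⟨-(j.sign), ?_⟩
      have hjs : (j : ℂ) = (j.sign : ℂ) * n := by
        have := Int.sign_mul_natAbs j
        rw [← hn] at this
        exact_mod_cast this.symm
      have hnC : (n : ℂ) ≠ 0 := by exact_mod_cast hn0.ne'
      simp only [hI, hc]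
      push_cast
      rw [hjs]
      field_simp
      ring
    rw [this]; simp
  have hb : ∀ k < n, BoundedVariationOn f (Set.Icc (I k) (I (k+1))) := by
    intro k hk
    exact ((eVariationOn.mono f (hsub k hk)).trans_lt (hf.trans_lt (by simp))).ne
  have hk : ∀ k ∈ Finset.range n, ‖∫ x in I k..I (k+1), (f x : ℂ) * Complex.exp (c * x)‖ ≤
      (eVariationOn f (Set.Icc (I k) (I (k+1)))).toReal * (1 / n) := by
    intro k hk
    have hk := Finset.mem_range.1 hk
    have e1 : ∫ x in I k..I (k+1), (f x : ℂ) * Complex.exp (c * x) =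
        ∫ x in I k..I (k+1), ((f x : ℂ) - f (I k)) * Complex.exp (c * x) := by
      simp_rw [sub_mul]
      rw [intervalIntegral.integral_sub (hii k hk)
        ((hcont.intervalIntegrable _ _).const_mul _), intervalIntegral.integral_const_mul, hz]
      simp
    rw [e1]
    have hlen : |I (k+1) - I k| = 1 / n := by
      rw [abs_of_nonneg (sub_nonneg.2 (hle k))]
      simp only [hI]; push_cast; field_simp; ring
    rw [← hlen]
    apply intervalIntegral.norm_integral_le_of_norm_le_const
    intro x hx
    rw [Set.uIoc_of_le (hle k)] at hx
    have : ‖Complex.exp (c * x)‖ = 1 := by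
      rw [Complex.norm_exp, hc]; simp
    rw [norm_mul, this, mul_one, ← Complex.ofReal_sub, Complex.norm_real, ← dist_eq_norm]
    exact (hb k hk).dist_le ⟨hx.1.le, hx.2⟩ ⟨le_rfl, hle k⟩
  rw [hfc, hnj]
  refine (norm_sum_le _ _).trans ((Finset.sum_le_sum hk).trans ?_)
  rw [← Finset.sum_mul, ← ENNReal.toReal_sum (fun k hk => hb k (Finset.mem_range.1 hk)), hs]
  have h2 : (eVariationOn f (Set.Icc (0:ℝ) 1)).toReal ≤ 2 := by
    have := ENNReal.toReal_mono (by simp) hf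
    simpa using this
  rw [mul_one_div]
  gcongr

lemma fc_bessel (f : ℝ → ℝ) (hf : eVariationOn f (Set.Icc (0:ℝ) 1) ≤ 2) (J : Finset ℤ) :
    ∑ j ∈ J, ‖fc f j‖ ^ 2 ≤ ∫ x in (0:ℝ)..1, f x ^ 2 := by
  have hfi := f_int f hf
  have hm : MemLp (fun x => (f x : ℂ)) 2 (volume.restrict (Set.Ioc (0:ℝ) 1)) := by
    apply MemLp.of_bound (C := |f 0| + 2)
    · have := ii_ofReal hfi
      exact this.1.aestronglyMeasurable
    · filter_upwards [ae_restrict_mem measurableSet_Ioc] with x hx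
      rw [Complex.norm_real]
      exact f_bdd f hf x ⟨hx.1.le, hx.2⟩
  have h := hasSum_sq_fourierCoeffOn zero_lt_one hm
  have e : ∀ j, fourierCoeffOn zero_lt_one (fun x => (f x : ℂ)) j = fc f j := by
    intro j
    rw [fourierCoeffOn_eq_integral]
    unfold fc
    simp only [sub_zero, div_one, one_smul]
    congr 1
    ext x
    rw [fourier_coe_apply, smul_eq_mul, mul_comm]
    congr 2
    push_cast
    ring
  simp only [e] at h
  have := sum_le_hasSum J (fun i _ => by positivity) h
  simpa using this

lemma fc_eq (f : ℝ → ℝ) (hf : eVariationOn f (Set.Icc (0:ℝ) 1) ≤ 2) (j : ℕ) (σ : ℤ)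
    (hσ : σ = 1 ∨ σ = -1) :
    fc f (σ * j) = (fourierA f j - σ * Complex.I * fourierB f j) / 2 := by
  have hfi := f_int f hf
  have h1 : IntervalIntegrable (fun x => f x * Real.cos (2 * Real.pi * j * x)) volume 0 1 :=
    hfi.mul_continuousOn (by fun_prop)
  have h2 : IntervalIntegrable (fun x => f x * Real.sin (2 * Real.pi * j * x)) volume 0 1 :=
    hfi.mul_continuousOn (by fun_prop)
  unfold fc fourierA fourierB
  push_cast
  rw [← intervalIntegral.integral_ofReal, ← intervalIntegral.integral_ofReal]
  have : ∀ x : ℝ, (f x : ℂ) * Complex.exp (-(2 * Real.pi * (σ * j) * Complex.I) * x) =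
     ((f x * Real.cos (2 * Real.pi * j * x) : ℝ) : ℂ) - σ * Complex.I * ((f x * Real.sin (2 * Real.pi * j * x) : ℝ) : ℂ) := by
    intro x
    have : (-(2 * Real.pi * (σ * j) * Complex.I) * x : ℂ) = (-(σ * (2 * Real.pi * j * x))) * Complex.I := by ring
    rw [this, Complex.exp_mul_I]
    push_cast
    rcases hσ with rfl | rfl <;> simp [Complex.cos_neg, Complex.sin_neg] <;> ring
  simp_rw [this]
  rw [intervalIntegral.integral_sub (ii_ofReal h1) ((ii_ofReal h2).const_mul _), intervalIntegral.integral_const_mul]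
  ring

lemma fourier_TP (f : ℝ → ℝ) (hf : eVariationOn f (Set.Icc (0:ℝ) 1) ≤ 2) (d : ℕ) (σ : ℝ) (hσ : σ = 1 ∨ σ = -1) :
    TP (fun y => σ * fourierPartial f d y) (fJ d) (fun j => (σ : ℂ) * fc f j)
      (Real.sqrt (∫ x in (0:ℝ)..1, f x ^ 2)) (4 * (1 + Real.log d)) (4 * d) := by
  have hn : ∀ j, ‖(σ : ℂ) * fc f j‖ = ‖fc f j‖ := by
    intro j
    rw [norm_mul]
    rcases hσ with rfl | rfl <;> simp
  have hd := fc_decay f hf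
  refine ⟨fJ_ne d, ?_, ?_, Real.sqrt_nonneg _, ?_, ?_, ?_, ?_⟩
  · intro y
    rw [fJ_sum]
    unfold fourierPartial
    push_cast
    rw [Finset.mul_sum]
    apply Finset.sum_congr rfl
    intro j _
    have e1 := fc_eq f hf j 1 (Or.inl rfl)
    have e2 := fc_eq f hf j (-1) (Or.inr rfl)
    simp only [one_mul, neg_mul] at e1 e2
    rw [e1, e2]
    have a1 : Complex.I * (2 * Real.pi * (j : ℂ) * y) = (2 * Real.pi * j * y) * Complex.I := by ring
    have a2 : Complex.I * (2 * Real.pi * (-(j : ℂ)) * y) = (-(2 * Real.pi * j * y)) * Complex.I := by ring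
    rw [a1, a2, Complex.exp_mul_I, Complex.exp_mul_I, Complex.cos_neg, Complex.sin_neg]
    have := Complex.I_sq
    push_cast
    linear_combination (σ * fourierB f j * Complex.sin (2 * Real.pi * j * y)) * this
  · intro j hj
    rw [hn]
    exact hd j (fJ_ne d j hj)
  · simp only [hn]
    rw [Real.sq_sqrt]
    · exact fc_bessel f hf _
    · exact intervalIntegral.integral_nonneg zero_le_one (fun x _ => sq_nonneg _)
  · simp only [hn]
    calc ∑ j ∈ fJ d, ‖fc f j‖ ≤ ∑ j ∈ fJ d, 2 / |(j : ℝ)| :=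
          Finset.sum_le_sum fun j hj => hd j (fJ_ne d j hj)
      _ = 4 * (harmonic d : ℝ) := by
          rw [fJ_sum, harmonic_eq_sum_Icc]
          push_cast
          rw [Finset.mul_sum]
          apply Finset.sum_congr rfl
          intro j _
          rw [abs_neg, abs_of_nonneg (by positivity : (0:ℝ) ≤ j)]
          ring
      _ ≤ _ := by
          gcongr
          exact harmonic_le_one_add_log d
  · simp only [hn]
    calc ∑ j ∈ fJ d, ‖fc f j‖ * |(j : ℝ)| ≤ ∑ j ∈ fJ d, (2 : ℝ) := by
          apply Finset.sum_le_sum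
          intro j hj
          have h0 : 0 < |(j : ℝ)| := by
            have := fJ_ne d j hj
            positivity
          have := hd j (fJ_ne d j hj)
          rwa [le_div_iff₀ h0] at this
      _ = 4 * d := by
          rw [fJ_sum]; simp; ring
      _ ≤ _ := le_rfl
  · rw [fJ_sum]
    have h := sum_Ioo_inv_sq_le (α := ℝ) 0 (d + 1)
    have he : Finset.Ioo 0 (d+1) = Finset.Icc 1 d := by
      ext x; simp only [Finset.mem_Ioo, Finset.mem_Icc]; omega
    rw [he] at h
    have : ∑ j ∈ Finset.Icc 1 d, ((1 / |(((j : ℕ) : ℤ) : ℝ)|) ^ 2 + (1 / |((-((j : ℕ) : ℤ) : ℤ) : ℝ)|) ^ 2) =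
        2 * ∑ j ∈ Finset.Icc 1 d, ((j : ℝ) ^ 2)⁻¹ := by
      rw [Finset.mul_sum]
      apply Finset.sum_congr rfl
      intro j _
      push_cast
      rw [abs_neg, div_pow, sq_abs]
      ring
    rw [this]
    norm_num at h
    linarith

lemma fnorm_eq (A B : ℝ) (hAB : B - A = 1) (f : ℝ → ℝ) (hp : ∀ x : ℝ, f (x + 1) = f x) :
    fnorm A B f = Real.sqrt (∫ x in (0:ℝ)..1, f x ^ 2) := by
  unfold fnorm
  have hB : B = A + 1 := by linarith
  have : Function.Periodic (fun x => f x ^ 2) 1 := by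
    intro x
    simp [hp]
  have h := this.intervalIntegral_add_eq A 0
  rw [hB, h]
  simp


lemma asym (b C : ℝ) (hb : 0 < b) (hC : 0 < C) : ∃ N₀ : ℕ, ∀ N : ℕ, N₀ ≤ N →
    10 ≤ (N : ℝ) ^ ((1:ℝ)/16) ∧ Real.log ((N : ℝ) ^ ((1:ℝ)/16)) ≤ (N : ℝ) ^ ((1:ℝ)/16) / 2000 ∧
    C * ((N : ℝ) ^ ((1:ℝ)/16)) ^ 640 ≤ Real.exp (b * (N : ℝ) ^ ((1:ℝ)/16)) := by
  have ht : Tendsto (fun N : ℕ => (N : ℝ) ^ ((1:ℝ)/16)) atTop atTop :=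
    (tendsto_rpow_atTop (by norm_num)).comp tendsto_natCast_atTop_atTop
  have h1 : ∀ᶠ x : ℝ in atTop, 10 ≤ x := eventually_ge_atTop 10
  have h2 := (Real.isLittleO_log_id_atTop).bound (show (0:ℝ) < 1/2000 by norm_num)
  have h3 := (isLittleO_pow_exp_pos_mul_atTop 640 hb).bound (show (0:ℝ) < 1 / C by positivity)
  have h : ∀ᶠ x : ℝ in atTop, 10 ≤ x ∧ Real.log x ≤ x / 2000 ∧ C * x ^ 640 ≤ Real.exp (b * x) := by
    filter_upwards [h1, h2, h3] with x h1 h2 h3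
    refine ⟨h1, ?_, ?_⟩
    · have := (le_abs_self _).trans h2
      simp only [id, Real.norm_eq_abs] at this
      rw [abs_of_nonneg (by linarith : 0 ≤ x)] at this
      linarith
    · have := (le_abs_self _).trans h3
      rw [Real.norm_eq_abs, abs_of_pos (Real.exp_pos _), one_div, inv_mul_eq_div, le_div_iff₀ hC] at this
      linarith
  exact eventually_atTop.1 (ht.eventually h)

def blk (N p i : ℕ) : Finset ℕ := (Finset.Icc 1 N).filter (fun n => n / p = i)

lemma blk_mem {N p i n : ℕ} (hp : 0 < p) (h : n ∈ blk N p i) :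
    1 ≤ n ∧ n ≤ N ∧ i * p ≤ n ∧ n < (i + 1) * p := by
  simp only [blk, Finset.mem_filter, Finset.mem_Icc] at h
  obtain ⟨⟨h1, h2⟩, rfl⟩ := h
  refine ⟨h1, h2, Nat.div_mul_le_self n p, ?_⟩
  have := Nat.lt_div_mul_add (a := n) hp
  linarith

lemma blk_card {N p i : ℕ} (hp : 0 < p) : (blk N p i).card ≤ p := by
  have : blk N p i ⊆ Finset.Ico (i * p) ((i + 1) * p) := by
    intro n hn
    have := blk_mem hp hn
    rw [Finset.mem_Ico]; exact this.2.2
  have h := Finset.card_le_card this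
  rw [Nat.card_Ico] at h
  have e : (i + 1) * p = i * p + p := by ring
  omega

lemma blk_sum (N p r : ℕ) (hr : N / p < 2 * r) (h : ℕ → ℝ) :
    ∑ n ∈ Finset.Icc 1 N, h n = ∑ k ∈ Finset.range r, ∑ n ∈ blk N p (2 * k + 0), h n +
      ∑ k ∈ Finset.range r, ∑ n ∈ blk N p (2 * k + 1), h n := by
  have h1 : ∑ i ∈ Finset.range (2 * r), ∑ n ∈ blk N p i, h n = ∑ n ∈ Finset.Icc 1 N, h n := by
    apply Finset.sum_fiberwise_of_maps_to
    intro n hn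
    rw [Finset.mem_range]
    rw [Finset.mem_Icc] at hn
    exact (Nat.div_le_div_right hn.2).trans_lt hr
  rw [← h1]
  clear h1 hr
  induction r with
  | zero => simp
  | succ r ih =>
    rw [show 2 * (r + 1) = 2 * r + 1 + 1 by ring, Finset.sum_range_succ, Finset.sum_range_succ, ih,
      Finset.sum_range_succ, Finset.sum_range_succ]
    simp only [Nat.add_zero]
    ring

lemma half_bound {g : ℝ → ℝ} {J : Finset ℤ} {c : ℤ → ℂ} {F L K : ℝ} (T : TP g J c F L K)
    (A B ξ t : ℝ) (hξ : 0 < ξ) (hA : 1 < A) (hAB : B - A = 1) (ht : 0 ≤ t) (hK : 0 ≤ K)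
    (s : ℕ → ℕ) (hs : StrictMono s) (hs1 : ∀ n, 1 ≤ n → 1 ≤ s n) (N M p par : ℕ) (hp : 0 < p)
    (htp : t * (p * L) ≤ 1) (k : ℕ) (hk : k * p ≤ N)
    (hsm : N * (28 * ((B + 1 + t * N * (2 * Real.pi * K * ξ)) / A ^ p) / (2 * Real.pi * ξ) * 2) ≤ 1) :
    ∫ x in A..B, Real.exp (t * (∑ i ∈ Finset.range (k + 1), ∑ n ∈ blk N p (2 * i + par), g (ξ * x ^ s (M + n)))) ≤
      Real.exp 1 * Real.exp 1 * Real.exp (t ^ 2 * (N * (F * (32 * (1 - A⁻¹)⁻¹)))) := by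
  set E : ℕ → Finset ℕ := fun k => (blk N p (2 * k + par)).image (fun n => s (M + n)) with hE
  have hinj : Function.Injective (fun n => s (M + n)) := by
    intro a b hab
    have := hs.injective hab
    omega
  have hsE : ∀ x : ℝ, ∀ i, ∑ e ∈ E i, g (ξ * x ^ e) = ∑ n ∈ blk N p (2 * i + par), g (ξ * x ^ s (M + n)) := by
    intro x i
    rw [hE, Finset.sum_image (fun a _ b _ hab => hinj hab)]
  have hgap : ∀ a b, s a + b ≤ s (a + b) := by
    intro a b
    induction b with
    | zero => simp
    | succ b ih =>
      have := hs (show a + b < a + (b + 1) by omega)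
      omega
  set ε := (B + 1 + t * N * (2 * Real.pi * K * ξ)) / A ^ p with hεd
  have hit := T.iter A B ξ t hξ hA hAB ht hK E p
    (by
      intro k m hm
      simp only [hE, Finset.mem_image] at hm
      obtain ⟨n, hn, rfl⟩ := hm
      exact hs1 _ (by have := blk_mem hp hn; omega))
    (by
      intro k hk m hm
      simp only [hE, Finset.mem_image] at hm
      obtain ⟨n, hn, rfl⟩ := hm
      have h1 := (blk_mem hp hn).2.2.1
      have h2 : 1 * p ≤ (2 * k + par) * p := Nat.mul_le_mul_right p (by omega)
      have h3 := hs.id_le (M + n)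
      simp only [id] at h3
      omega)
    (by
      intro i k hik e he m hm
      simp only [hE, Finset.mem_image] at he hm
      obtain ⟨n, hn, rfl⟩ := he
      obtain ⟨n', hn', rfl⟩ := hm
      have h1 := (blk_mem hp hn).2.2.2
      have h2 := (blk_mem hp hn').2.2.1
      have h3 : (2 * i + par + 1 + 1) * p ≤ (2 * k + par) * p := Nat.mul_le_mul_right p (by omega)
      have h4 : (2 * i + par + 1 + 1) * p = (2 * i + par + 1) * p + p := by ring
      have h5 := hgap (M + n) (n' - n)
      rw [show M + n + (n' - n) = M + n' by omega] at h5
      omega) N ε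
    (by
      intro k
      have : (Finset.range k).biUnion E ⊆ (Finset.Icc 1 N).image (fun n => s (M + n)) := by
        intro e he
        simp only [Finset.mem_biUnion, hE, Finset.mem_image] at he
        obtain ⟨i, _, n, hn, rfl⟩ := he
        have := blk_mem hp hn
        exact Finset.mem_image.2 ⟨n, Finset.mem_Icc.2 ⟨this.1, this.2.1⟩, rfl⟩
      refine (Finset.card_le_card this).trans (Finset.card_image_le.trans ?_)
      simp) le_rfl p
    (by
      intro k
      exact Finset.card_image_le.trans (blk_card hp)) htp k
  simp only [hsE] at hit
  refine hit.trans ?_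
  rw [mul_assoc (Real.exp 1) (Real.exp 1), ← Real.exp_add 1 (t ^ 2 * (N * (F * (32 * (1 - A⁻¹)⁻¹))))]
  have hAi : 0 < 1 - A⁻¹ := by
    have := inv_lt_one_of_one_lt₀ hA
    linarith
  have hF := T.F0
  have hε0 : 0 ≤ ε := by
    have : 0 ≤ B := by linarith
    have : 0 < A := by linarith
    positivity
  have hkN : (k : ℝ) ≤ N := by
    have : k * 1 ≤ k * p := Nat.mul_le_mul_left k hp
    exact_mod_cast (by omega : k ≤ N)
  have hkp : (k : ℝ) * p ≤ N := by exact_mod_cast hk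
  gcongr
  calc (k : ℝ) * (28 * ε / (2 * Real.pi * ξ) * 2 + t ^ 2 * (p * (F * (32 * (1 - A⁻¹)⁻¹))))
      = k * (28 * ε / (2 * Real.pi * ξ) * 2) + t ^ 2 * ((k * p) * (F * (32 * (1 - A⁻¹)⁻¹))) := by ring
    _ ≤ N * (28 * ε / (2 * Real.pi * ξ) * 2) + t ^ 2 * (N * (F * (32 * (1 - A⁻¹)⁻¹))) := by
        gcongr
    _ ≤ _ := by linarith

lemma exp_key (τ : ℝ) (hτ : 0 < τ) (u v : ℝ) :
    Real.exp (τ * (u + v)) ≤ Real.exp (2 * τ * u) + Real.exp (2 * τ * v) := by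
  rcases le_total u v with h | h
  · have : Real.exp (τ * (u + v)) ≤ Real.exp (2 * τ * v) := by
      apply Real.exp_le_exp.2; nlinarith
    linarith [Real.exp_pos (2 * τ * u)]
  · have : Real.exp (τ * (u + v)) ≤ Real.exp (2 * τ * u) := by
      apply Real.exp_le_exp.2; nlinarith
    linarith [Real.exp_pos (2 * τ * v)]

lemma exp_key2 (τ : ℝ) (hτ : 0 < τ) (a b : ℝ) :
    Real.exp |τ * (a + b)| ≤ (Real.exp (2 * τ * (1 * a)) + Real.exp (2 * τ * (1 * b))) +
      (Real.exp (2 * τ * (-1 * a)) + Real.exp (2 * τ * (-1 * b))) := by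
  have k1 := exp_key τ hτ (1 * a) (1 * b)
  have k2 := exp_key τ hτ (-1 * a) (-1 * b)
  have q1 := Real.exp_pos (τ * (1 * a + 1 * b))
  have q2 := Real.exp_pos (τ * (-1 * a + -1 * b))
  rcases abs_choice (τ * (a + b)) with h | h
  · rw [h]
    have : τ * (a + b) = τ * (1 * a + 1 * b) := by ring
    rw [this]
    linarith
  · rw [h]
    have : -(τ * (a + b)) = τ * (-1 * a + -1 * b) := by ring
    rw [this]
    linarith

set_option maxHeartbeats 1000000 in
theorem stmt9 (ξ A B : ℝ) (hξ : 0 < ξ) (hA : 1 < A) (hAB : B - A = 1) :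
    ∃ (c C : ℝ) (N₀ : ℕ), 1 ≤ c ∧ 0 < C ∧
      ∀ s : ℕ → ℕ, StrictMono s → (∀ n, 1 ≤ n → 1 ≤ s n) →
      ∀ N : ℕ, N₀ ≤ N →
      ∀ f : ℝ → ℝ, (∀ x : ℝ, f (x + 1) = f x) → (∫ x in (0:ℝ)..1, f x) = 0 →
        eVariationOn f (Set.Icc (0:ℝ) 1) ≤ 2 →
      ∀ M : ℕ, ∀ τ : ℝ, 0 < τ →
        (N : ℝ) ^ (-(1/2) : ℝ) ≤ τ →
        12 * τ * (Nat.ceil ((N : ℝ) ^ ((1:ℝ)/8)) : ℝ) ≤ 1 →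
        (∫ x in A..B,
            Real.exp |τ * ∑ n ∈ Finset.Icc 1 N,
              fourierPartial f (N ^ 38) (ξ * x ^ s (M + n))|) ≤
          C * Real.exp (τ ^ 2 * c * fnorm A B f * N) := by
  have hA0 : 0 < A := by linarith
  have hAi : 0 < 1 - A⁻¹ := by
    have := inv_lt_one_of_one_lt₀ hA
    linarith
  have hB0 : 0 ≤ B := by linarith
  have hle : A ≤ B := by linarith
  set D : ℝ := 56 * (B + 1 + 8 * Real.pi * ξ) / (2 * Real.pi * ξ) with hD
  have hπ := Real.pi_pos
  obtain ⟨N₀, hN₀⟩ := asym (Real.log A) D (Real.log_pos hA) (by positivity)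
  refine ⟨128 * (1 - A⁻¹)⁻¹, 4 * (Real.exp 1 * Real.exp 1), N₀, ?_, by positivity, ?_⟩
  · have h1 : 1 - A⁻¹ ≤ 1 := by
      have : 0 < A⁻¹ := by positivity
      linarith
    have := (one_le_inv₀ hAi).2 h1
    linarith
  intro s hs hs1 N hN f hper _ hvar M τ hτ _ hτ2
  obtain ⟨hx10, hxlog, hxexp⟩ := hN₀ N hN
  set x : ℝ := (N : ℝ) ^ ((1:ℝ)/16) with hx
  have hx0 : 0 < x := by linarith
  have hxN : x ^ 16 = N := by
    rw [hx, ← Real.rpow_natCast, ← Real.rpow_mul (by positivity)]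
    norm_num
  have hx2 : (N : ℝ) ^ ((1:ℝ)/8) = x ^ 2 := by
    rw [hx, ← Real.rpow_natCast, ← Real.rpow_mul (by positivity)]
    norm_num
  have hN1 : (1:ℝ) ≤ N := by
    rw [← hxN]; exact one_le_pow₀ (by linarith)
  set p := Nat.ceil x with hp
  have hp0 : 0 < p := Nat.ceil_pos.2 hx0
  have hpx : x ≤ p := Nat.le_ceil x
  have hp2 : (p : ℝ) ≤ 2 * x := by
    have := (Nat.ceil_lt_add_one hx0.le).le
    linarith
  have hτx : 12 * τ * x ^ 2 ≤ 1 := by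
    refine le_trans ?_ hτ2
    rw [hx2]
    gcongr
    exact Nat.le_ceil _
  have hτ1 : 2 * τ ≤ 1 := by nlinarith
  have hlog : Real.log ((N ^ 38 : ℕ) : ℝ) = 608 * Real.log x := by
    push_cast
    rw [← hxN, ← pow_mul, Real.log_pow]
    norm_num
  have hlx : 0 ≤ Real.log x := Real.log_nonneg (by linarith)
  have htp : 2 * τ * (p * (4 * (1 + Real.log ((N ^ 38 : ℕ) : ℝ)))) ≤ 1 := by
    rw [hlog]
    calc 2 * τ * (p * (4 * (1 + 608 * Real.log x))) ≤ 2 * τ * ((2 * x) * (4 * (x / 10 + 608 * (x / 2000)))) := by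
          gcongr
          linarith
      _ = (12 * τ * x ^ 2) * (4 / 3 * (1 / 10 + 608 / 2000)) := by ring
      _ ≤ 1 * (4 / 3 * (1 / 10 + 608 / 2000)) := by gcongr
      _ ≤ 1 := by norm_num
  have hAp : D * x ^ 640 ≤ A ^ p := by
    refine hxexp.trans ?_
    rw [← Real.rpow_natCast A p, Real.rpow_def_of_pos hA0]
    have := Real.log_pos hA
    gcongr
  have hsm : N * (28 * ((B + 1 + 2 * τ * N * (2 * Real.pi * (4 * ((N ^ 38 : ℕ) : ℝ)) * ξ)) / A ^ p) / (2 * Real.pi * ξ) * 2) ≤ 1 := by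
    have hApos : 0 < A ^ p := by positivity
    have h1 : B + 1 + 2 * τ * N * (2 * Real.pi * (4 * ((N ^ 38 : ℕ) : ℝ)) * ξ) ≤ (B + 1 + 8 * Real.pi * ξ) * (N : ℝ) ^ 39 := by
      have h39 : (1:ℝ) ≤ (N : ℝ) ^ 39 := one_le_pow₀ hN1
      calc B + 1 + 2 * τ * N * (2 * Real.pi * (4 * ((N ^ 38 : ℕ) : ℝ)) * ξ)
          ≤ (B + 1) * (N : ℝ) ^ 39 + 1 * N * (2 * Real.pi * (4 * ((N ^ 38 : ℕ) : ℝ)) * ξ) := by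
            gcongr
            exact le_mul_of_one_le_right (by linarith) h39
        _ = _ := by push_cast; ring
    calc N * (28 * ((B + 1 + 2 * τ * N * (2 * Real.pi * (4 * ((N ^ 38 : ℕ) : ℝ)) * ξ)) / A ^ p) / (2 * Real.pi * ξ) * 2)
        ≤ N * (28 * (((B + 1 + 8 * Real.pi * ξ) * (N : ℝ) ^ 39) / A ^ p) / (2 * Real.pi * ξ) * 2) := by
          gcongr
      _ = (D * x ^ 640) / A ^ p := by
          rw [show x ^ 640 = (N : ℝ) * (N : ℝ) ^ 39 by rw [← hxN]; ring, hD]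
          ring
      _ ≤ 1 := by rw [div_le_one hApos]; exact hAp
  set k := N / (2 * p) with hk
  have hkp : k * p ≤ N := by
    have := Nat.div_mul_le_self N (2 * p)
    rw [← hk] at this
    nlinarith
  have hr : N / p < 2 * (k + 1) := by
    rw [Nat.div_lt_iff_lt_mul hp0]
    have := Nat.lt_div_mul_add (a := N) (b := 2 * p) (by omega)
    rw [← hk] at this
    linarith
  set F := Real.sqrt (∫ x in (0:ℝ)..1, f x ^ 2) with hF
  have hfn : fnorm A B f = F := fnorm_eq A B hAB f hper
  have hcont : Continuous (fourierPartial f (N ^ 38)) := by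
    unfold fourierPartial; fun_prop
  set G : ℝ → ℕ → ℝ → ℝ := fun σ par x => Real.exp (2 * τ * (∑ i ∈ Finset.range (k + 1),
    ∑ n ∈ blk N p (2 * i + par), σ * fourierPartial f (N ^ 38) (ξ * x ^ s (M + n)))) with hG
  have hGc : ∀ σ par, Continuous (G σ par) := by
    intro σ par
    simp only [hG]
    fun_prop
  set R := Real.exp 1 * Real.exp 1 * Real.exp (τ ^ 2 * (128 * (1 - A⁻¹)⁻¹) * F * N) with hR
  have hb : ∀ σ : ℝ, (σ = 1 ∨ σ = -1) → ∀ par, ∫ x in A..B, G σ par x ≤ R := by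
    intro σ hσ par
    have h := half_bound (fourier_TP f hvar (N ^ 38) σ hσ) A B ξ (2 * τ) hξ hA hAB (by positivity)
      (by positivity) s hs hs1 N M p par hp0 htp k hkp hsm
    refine h.trans (le_of_eq ?_)
    rw [hR]
    congr 2
    ring
  have hi : ∀ σ par, IntervalIntegrable (G σ par) volume A B := fun σ par =>
    (hGc σ par).intervalIntegrable _ _
  have hmain : ∫ x in A..B, Real.exp |τ * ∑ n ∈ Finset.Icc 1 N,
      fourierPartial f (N ^ 38) (ξ * x ^ s (M + n))| ≤
      ∫ x in A..B, ((G 1 0 x + G 1 1 x) + (G (-1) 0 x + G (-1) 1 x)) := by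
    apply intervalIntegral.integral_mono_on hle
    · apply Continuous.intervalIntegrable
      fun_prop
    · exact ((hi _ _).add (hi _ _)).add ((hi _ _).add (hi _ _))
    · intro y _
      rw [blk_sum N p (k + 1) hr]
      simp only [hG, ← Finset.mul_sum]
      set a := ∑ k ∈ Finset.range (k + 1), ∑ n ∈ blk N p (2 * k + 0), fourierPartial f (N ^ 38) (ξ * y ^ s (M + n))
      set b := ∑ k ∈ Finset.range (k + 1), ∑ n ∈ blk N p (2 * k + 1), fourierPartial f (N ^ 38) (ξ * y ^ s (M + n))
      exact exp_key2 τ hτ a b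
  refine hmain.trans ?_
  rw [intervalIntegral.integral_add ((hi _ _).add (hi _ _)) ((hi _ _).add (hi _ _)),
    intervalIntegral.integral_add (hi _ _) (hi _ _), intervalIntegral.integral_add (hi _ _) (hi _ _), hfn]
  have b1 := hb 1 (Or.inl rfl) 0
  have b2 := hb 1 (Or.inl rfl) 1
  have b3 := hb (-1) (Or.inr rfl) 0
  have b4 := hb (-1) (Or.inr rfl) 1
  have : 4 * (Real.exp 1 * Real.exp 1) * Real.exp (τ ^ 2 * (128 * (1 - A⁻¹)⁻¹) * F * N) = 4 * R := by
    rw [hR]; ring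
  rw [this]
  linarith
end

section
/- There exist constants c_A ≥ 1, m_0 and C, depending only on ξ, A, B, such that for all m ≥ m_0 the following holds. Let f satisfy condition (f) and assume ‖f‖ ≥ 2^{-m/4}/√2. Then for any γ ≥ 1: P( x ∈ [A,B] : max_{1 ≤ M ≤ 2^m} |Σ_{n=1}^{M} f(ξ x^{s_n})| ≥ 84 γ c_A ‖f‖^{1/4} √(2^m log log 2^m) ) ≤ C ( exp(−γ ‖f‖^{-1/2} log log 2^m) + 2^{-3m} ). -/
open MeasureTheory Filter

/-- The natural logarithm, interpreted as `max {1, log x}`. -/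
noncomputable def plog (x : ℝ) : ℝ := max 1 (Real.log x)

lemma ii_of_bdd {g : ℝ → ℝ} (hg : Measurable g) {G : ℝ} (hb : ∀ x, |g x| ≤ G) (a b : ℝ) :
    IntervalIntegrable g volume a b := by
  refine (intervalIntegrable_const (c := G)).mono_fun hg.aestronglyMeasurable ?_
  refine Eventually.of_forall fun x => ?_
  change |g x| ≤ |G|
  exact (hb x).trans (le_abs_self G)

lemma per_int_bdd {g : ℝ → ℝ} (hg : Measurable g) {G : ℝ} (hb : ∀ x, |g x| ≤ G)
    (hp : ∀ x, g (x + 1) = g x) (h0 : ∫ x in (0:ℝ)..1, g x = 0) (u v : ℝ) :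
    |∫ x in u..v, g x| ≤ G := by
  have hG : 0 ≤ G := (abs_nonneg _).trans (hb 0)
  have hper : Function.Periodic g 1 := hp
  have h1 : ∀ n : ℤ, ∫ x in u..(u + n), g x = 0 := by
    intro n
    have := hper.intervalIntegral_add_zsmul_eq n u (fun a b => ii_of_bdd hg hb a b)
    simp only [zsmul_eq_mul, mul_one] at this
    rw [this, hper.intervalIntegral_add_eq u 0, zero_add, h0, mul_zero]
  have h2 := intervalIntegral.integral_add_adjacent_intervals
    (ii_of_bdd hg hb u (u + ⌊v - u⌋)) (ii_of_bdd hg hb (u + ⌊v - u⌋) v)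
  rw [h1, zero_add] at h2
  rw [← h2]
  have h3 := intervalIntegral.norm_integral_le_of_norm_le_const (a := u + ⌊v - u⌋) (b := v) (C := G)
    (f := g) (fun x _ => by rw [Real.norm_eq_abs]; exact hb x)
  rw [Real.norm_eq_abs] at h3
  refine h3.trans ?_
  have : |v - (u + ⌊v - u⌋)| ≤ 1 := by
    rw [abs_le]; constructor <;> linarith [Int.floor_le (v - u), Int.lt_floor_add_one (v - u)]
  nlinarith

/-- Equidistribution lemma. -/
lemma equi {g : ℝ → ℝ} (hg : Measurable g) {G : ℝ} (hb : ∀ x, |g x| ≤ G)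
    (hp : ∀ x, g (x + 1) = g x) (h0 : ∫ x in (0:ℝ)..1, g x = 0)
    {ξ : ℝ} (hξ : 0 < ξ) {s : ℕ} (hs : 1 ≤ s) {c d : ℝ} (hc : 0 < c) (hcd : c ≤ d) :
    |∫ x in c..d, g (ξ * x ^ s)| ≤ G / (ξ * s * c ^ (s - 1)) := by
  have hG : 0 ≤ G := (abs_nonneg _).trans (hb 0)
  have hs0 : (0:ℝ) < s := by exact_mod_cast hs
  set D : ℝ → ℝ := fun x => ξ * s * x ^ (s - 1) with hD
  have hDpos : ∀ x, 0 < x → 0 < D x := fun x hx => by positivity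
  set φ : ℝ → ℝ := fun x => ξ * x ^ s with hφ
  have hφ' : ∀ x, HasDerivAt φ (D x) x := fun x => by
    have := (hasDerivAt_pow s x).const_mul ξ
    simpa [hφ, hD, mul_assoc] using this
  have hφm : Measurable φ := by fun_prop
  have hDc : Continuous D := by fun_prop
  set k : ℝ → ℝ := fun x => (g ∘ φ) x * D x with hk
  have hki : ∀ a b : ℝ, IntervalIntegrable k volume a b := fun a b =>
    (ii_of_bdd (hg.comp hφm) (fun x => hb _) a b).mul_continuousOn hDc.continuousOn
  set Φ : ℝ → ℝ := fun y => ∫ x in c..y, k x with hΦ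
  have hΦb : ∀ y ∈ Set.Icc c d, |Φ y| ≤ G := by
    intro y hy
    have := intervalIntegral.integral_comp_mul_deriv_of_deriv_nonneg (a := c) (b := y) (f := φ)
      (f' := D) (g := g) (by fun_prop) (fun x _ => hφ' x) (fun x hx => by
        rw [min_eq_left hy.1] at hx
        exact (hDpos x (hc.trans hx.1)).le)
    rw [hΦ]; simp only [hk]; rw [this]
    exact per_int_bdd hg hb hp h0 _ _
  have hΦac : AbsolutelyContinuousOnInterval Φ c d :=
    (hki c d).absolutelyContinuousOnInterval_intervalIntegral (Set.left_mem_uIcc)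
  set w : ℝ → ℝ := fun x => (D x)⁻¹ with hw
  set w' : ℝ → ℝ := fun x => -(ξ * s * ((s - 1 : ℕ) * x ^ (s - 1 - 1))) / (D x) ^ 2 with hw'
  have hwd : ∀ x, 0 < x → HasDerivAt w (w' x) x := by
    intro x hx
    have := ((hasDerivAt_pow (s - 1) x).const_mul (ξ * s)).inv (hDpos x hx).ne'
    exact this
  have hwneg : ∀ x, 0 < x → w' x ≤ 0 := by
    intro x hx
    apply div_nonpos_of_nonpos_of_nonneg _ (sq_nonneg _)
    have : 0 ≤ ξ * s * ((s - 1 : ℕ) * x ^ (s - 1 - 1)) := by positivity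
    linarith
  have hpos : ∀ x ∈ Set.uIcc c d, 0 < x := fun x hx => by
    rw [Set.uIcc_of_le hcd] at hx; exact hc.trans_le hx.1
  have hwac : AbsolutelyContinuousOnInterval w c d := by
    apply ContDiffOn.absolutelyContinuousOnInterval
    apply ContDiffOn.inv
    · fun_prop
    · intro x hx; exact (hDpos x (hpos x hx)).ne'
  have hibp := hwac.integral_mul_deriv_eq_deriv_mul hΦac
  have hlhs : ∫ x in c..d, w x * deriv Φ x = ∫ x in c..d, g (ξ * x ^ s) := by
    apply intervalIntegral.integral_congr_ae
    filter_upwards [(hki c d).ae_hasDerivAt_integral] with x hx hxm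
    have hxm' : x ∈ Set.uIcc c d := Set.uIoc_subset_uIcc hxm
    have h1 := (hx hxm' c Set.left_mem_uIcc).deriv
    have : deriv Φ x = k x := h1
    rw [this]
    simp only [hw, hk, Function.comp, hφ]
    have := (hDpos x (hpos x hxm')).ne'
    field_simp
  have hΦc : Φ c = 0 := by simp [hΦ]
  rw [hlhs, hΦc, mul_zero, sub_zero] at hibp
  rw [hibp]
  have hftc := hwac.integral_deriv_eq_sub
  have hwi : IntervalIntegrable (deriv w) volume c d := hwac.intervalIntegrable_deriv
  have h2 : |∫ x in c..d, deriv w x * Φ x| ≤ ∫ x in c..d, G * (-deriv w x) := by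
    have := intervalIntegral.norm_integral_le_of_norm_le (f := fun x => deriv w x * Φ x)
      (g := fun x => G * (-deriv w x)) (a := c) (b := d) hcd ?_ (hwi.neg.const_mul G)
    · rwa [Real.norm_eq_abs] at this
    · refine Eventually.of_forall fun x hx => ?_
      have hx' : x ∈ Set.Icc c d := Set.Ioc_subset_Icc_self hx
      have hx0 : 0 < x := hc.trans hx.1
      have e : deriv w x = w' x := (hwd x hx0).deriv
      rw [norm_mul, Real.norm_eq_abs, Real.norm_eq_abs, e, abs_of_nonpos (hwneg x hx0), mul_comm]
      exact mul_le_mul_of_nonneg_right (hΦb x hx') (by linarith [hwneg x hx0])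
  rw [intervalIntegral.integral_const_mul, intervalIntegral.integral_neg, hftc] at h2
  have h3 : |w d * Φ d| ≤ w d * G := by
    rw [abs_mul, abs_of_nonneg (inv_nonneg.2 (hDpos d (hc.trans_le hcd)).le)]
    exact mul_le_mul_of_nonneg_left (hΦb d ⟨hcd, le_rfl⟩)
      (inv_nonneg.2 (hDpos d (hc.trans_le hcd)).le)
  have h4 : G / (ξ * s * c ^ (s - 1)) = G * w c := by simp only [hw, hD]; rw [div_eq_mul_inv]
  rw [h4]
  calc |w d * Φ d - ∫ x in c..d, deriv w x * Φ x| ≤ |w d * Φ d| + |∫ x in c..d, deriv w x * Φ x| :=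
        abs_sub _ _
    _ ≤ G * w c := by linarith

structure GF (f V : ℝ → ℝ) (σ v : ℝ) : Prop where
  per : ∀ x, f (x + 1) = f x
  zero : ∫ x in (0:ℝ)..1, f x = 0
  bd : ∀ x, |f x| ≤ 2
  sq : ∫ x in (0:ℝ)..1, f x ^ 2 = σ ^ 2
  mono : Monotone V
  Vper : ∀ x, V (x + 1) = V x + v
  vle : v ≤ 2
  osc : ∀ x y, x ≤ y → |f x - f y| ≤ V y - V x

namespace GF
variable {f V : ℝ → ℝ} {σ v : ℝ}

lemma meas (h : GF f V σ v) : Measurable f := by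
  have h1 : Monotone (fun x => V x + f x) := by
    intro x y hxy
    have := abs_le.1 (h.osc x y hxy)
    simp only; linarith
  have h2 : f = fun x => (V x + f x) - V x := by ext; ring
  rw [h2]
  exact h1.measurable.sub h.mono.measurable

lemma neg (h : GF f V σ v) : GF (fun x => - f x) V σ v where
  per x := by rw [h.per]
  zero := by rw [intervalIntegral.integral_neg, h.zero, neg_zero]
  bd x := by rw [abs_neg]; exact h.bd x
  sq := by simp only [neg_sq]; exact h.sq
  mono := h.mono
  Vper := h.Vper
  vle := h.vle
  osc x y hxy := by
    rw [show - f x - - f y = -(f x - f y) by ring, abs_neg]; exact h.osc x y hxy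

lemma v_nonneg (h : GF f V σ v) : 0 ≤ v := by
  have := h.mono (show (0:ℝ) ≤ 0 + 1 by norm_num)
  rw [h.Vper] at this; linarith

lemma sq_le (h : GF f V σ v) : σ ^ 2 ≤ 4 := by
  rw [← h.sq]
  have := intervalIntegral.norm_integral_le_of_norm_le_const (a := (0:ℝ)) (b := 1) (C := 4)
    (f := fun x => f x ^ 2) (fun x _ => by
      rw [Real.norm_eq_abs, abs_pow]
      have := h.bd x
      nlinarith [abs_nonneg (f x)])
  rw [Real.norm_eq_abs] at this
  norm_num at this
  exact (le_abs_self _).trans this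

end GF

/-- oscillation bound -/
noncomputable def Wf (V : ℝ → ℝ) (θ u : ℝ) : ℝ := V (u + θ) - V (u - θ)

namespace GF
variable {f V : ℝ → ℝ} {σ v : ℝ}

lemma W_meas (h : GF f V σ v) (θ : ℝ) : Measurable (Wf V θ) := by
  have := h.mono.measurable
  unfold Wf
  fun_prop

lemma W_nonneg (h : GF f V σ v) {θ : ℝ} (hθ : 0 ≤ θ) (u : ℝ) : 0 ≤ Wf V θ u := by
  have := h.mono (show u - θ ≤ u + θ by linarith)
  unfold Wf; linarith

lemma W_le (h : GF f V σ v) {θ : ℝ} (hθ : θ ≤ 1) (u : ℝ) : Wf V θ u ≤ 4 := by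
  have h1 := h.mono (show u + θ ≤ (u - 1 + 1) + 1 by linarith)
  have h2 := h.mono (show u - 1 ≤ u - θ by linarith)
  rw [h.Vper, h.Vper] at h1
  unfold Wf; linarith [h.vle]

lemma W_per (h : GF f V σ v) (θ u : ℝ) : Wf V θ (u + 1) = Wf V θ u := by
  unfold Wf
  rw [show u + 1 + θ = (u + θ) + 1 by ring, show u + 1 - θ = (u - θ) + 1 by ring, h.Vper, h.Vper]
  ring

lemma W_int (h : GF f V σ v) (θ : ℝ) : ∫ u in (0:ℝ)..1, Wf V θ u = 2 * θ * v := by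
  have hi : ∀ a b, IntervalIntegrable V volume a b := fun a b => h.mono.intervalIntegrable
  have m1 : Monotone (fun u => V (u + θ)) := fun a b hab => h.mono (by linarith)
  have m2 : Monotone (fun u => V (u - θ)) := fun a b hab => h.mono (by linarith)
  unfold Wf
  rw [intervalIntegral.integral_sub m1.intervalIntegrable m2.intervalIntegrable,
    intervalIntegral.integral_comp_add_right, intervalIntegral.integral_comp_sub_right]
  have h1 : ∫ x in (1 - θ)..(1 + θ), V x = ∫ x in (-θ)..θ, V (x + 1) := by
    rw [intervalIntegral.integral_comp_add_right]; congr 1 <;> ring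
  have h2 : ∫ x in (-θ)..θ, V (x + 1) = (∫ x in (-θ)..θ, V x) + 2 * θ * v := by
    simp_rw [h.Vper]
    rw [intervalIntegral.integral_add (hi _ _) intervalIntegrable_const]
    rw [intervalIntegral.integral_const, smul_eq_mul]; ring
  have h3 := intervalIntegral.integral_add_adjacent_intervals (hi (-θ) θ) (hi θ (1 + θ))
  have h4 := intervalIntegral.integral_add_adjacent_intervals (hi (-θ) (1 - θ)) (hi (1 - θ) (1 + θ))
  rw [zero_add, zero_sub]
  linarith

lemma osc_le_W (h : GF f V σ v) {θ x y : ℝ} (hxy : |x - y| ≤ θ) : f y ≤ f x + Wf V θ x := by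
  have hh := abs_le.1 hxy
  unfold Wf
  rcases le_total x y with hl | hl
  · have := abs_le.1 (h.osc x y hl)
    have a := h.mono (show y ≤ x + θ by linarith)
    have b := h.mono (show x - θ ≤ x by linarith)
    linarith
  · have := abs_le.1 (h.osc y x hl)
    have a := h.mono (show x - θ ≤ y by linarith)
    have b := h.mono (show x ≤ x + θ by linarith)
    linarith

lemma osc_le_W' (h : GF f V σ v) {θ x y : ℝ} (hxy : |x - y| ≤ θ) : |f x - f y| ≤ Wf V θ x := by
  have h1 := h.osc_le_W hxy
  have h2 := h.neg.osc_le_W hxy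
  rw [abs_le]; constructor <;> linarith

end GF

lemma evar_shift {f : ℝ → ℝ} (hp : ∀ x, f (x + 1) = f x) (a b : ℝ) :
    eVariationOn f (Set.Icc (a + 1) (b + 1)) = eVariationOn f (Set.Icc a b) := by
  have := eVariationOn.comp_eq_of_monotoneOn f (t := Set.Icc a b) (fun x => x + 1)
    (fun x _ y _ hxy => by simpa using hxy)
  rw [Set.image_add_const_Icc] at this
  rw [← this]
  congr 1
  ext x; exact hp x

lemma exists_V {f : ℝ → ℝ} (hp : ∀ x, f (x + 1) = f x)
    (hv : eVariationOn f (Set.Icc (0:ℝ) 1) ≤ 2) :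
    ∃ V : ℝ → ℝ, ∃ v : ℝ, Monotone V ∧ (∀ x, V (x + 1) = V x + v) ∧ v ≤ 2 ∧
      ∀ x y, x ≤ y → |f x - f y| ≤ V y - V x := by
  have hN : ∀ n : ℕ, eVariationOn f (Set.Icc (-(n:ℝ)) (-(n:ℝ) + 1)) ≤ 2 := by
    intro n
    induction n with
    | zero => simpa using hv
    | succ k ih =>
      rw [← evar_shift hp]
      convert ih using 3 <;> (push_cast; ring)
  have hN2 : ∀ n k : ℕ, eVariationOn f (Set.Icc (-(n:ℝ)) (-(n:ℝ) + k)) ≠ ⊤ := by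
    intro n k
    induction k generalizing n with
    | zero => simp
    | succ k ih =>
      have := eVariationOn.Icc_add_Icc f (s := Set.univ) (a := -(n:ℝ)) (b := -(n:ℝ) + 1)
        (c := -(n:ℝ) + (k + 1 : ℕ)) (by linarith) (by push_cast; linarith [(Nat.cast_nonneg k : (0:ℝ) ≤ k)])
        (Set.mem_univ _)
      simp only [Set.univ_inter] at this
      rw [← this]
      refine ENNReal.add_ne_top.2 ⟨ne_top_of_le_ne_top (by simp) (hN n), ?_⟩
      have := evar_shift hp (-(n:ℝ)) (-(n:ℝ) + k)
      rw [show -(n:ℝ) + (k + 1 : ℕ) = -(n:ℝ) + k + 1 by push_cast; ring, this]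
      exact ih n
  have hlb : LocallyBoundedVariationOn f Set.univ := by
    intro a b _ _
    rw [Set.univ_inter]
    obtain ⟨n, hn⟩ := exists_nat_ge (-a)
    obtain ⟨k, hk⟩ := exists_nat_ge (b + n)
    exact ne_top_of_le_ne_top (hN2 n k)
      (eVariationOn.mono f (Set.Icc_subset_Icc (by linarith) (by linarith)))
  set V := variationOnFromTo f Set.univ 0 with hV
  have hsub : ∀ x y, V y - V x = variationOnFromTo f Set.univ x y := fun x y =>
    variationOnFromTo.sub_right hlb (Set.mem_univ _) (Set.mem_univ _) (Set.mem_univ _)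
  have hshift : ∀ x y, x ≤ y → V (y + 1) - V (x + 1) = V y - V x := by
    intro x y hxy
    rw [hsub, hsub, variationOnFromTo.eq_of_le _ _ hxy,
      variationOnFromTo.eq_of_le _ _ (by linarith), Set.univ_inter, Set.univ_inter, evar_shift hp]
  refine ⟨V, V 1 - V 0, ?_, ?_, ?_, ?_⟩
  · exact monotoneOn_univ.1 (variationOnFromTo.monotoneOn hlb (Set.mem_univ _))
  · intro x
    rcases le_total 0 x with hx | hx
    · have := hshift 0 x hx
      rw [zero_add] at this; linarith
    · have := hshift x 0 hx
      rw [zero_add] at this; linarith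
  · rw [hsub, variationOnFromTo.eq_of_le _ _ zero_le_one, Set.univ_inter]
    exact ENNReal.toReal_le_of_le_ofReal (by norm_num) (by simpa using hv)
  · intro x y hxy
    rw [hsub, variationOnFromTo.eq_of_le _ _ hxy, Set.univ_inter]
    have h1 := eVariationOn.edist_le f (s := Set.Icc x y) (x := x) (y := y) ⟨le_rfl, hxy⟩ ⟨hxy, le_rfl⟩
    rw [edist_dist] at h1
    have h2 := hlb x y (Set.mem_univ _) (Set.mem_univ _)
    rw [Set.univ_inter] at h2
    rw [← Real.dist_eq]
    exact (ENNReal.ofReal_le_iff_le_toReal h2).1 h1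

lemma exists_GF {f : ℝ → ℝ} (hp : ∀ x, f (x + 1) = f x) (h0 : ∫ x in (0:ℝ)..1, f x = 0)
    (hv : eVariationOn f (Set.Icc (0:ℝ) 1) ≤ 2) (A B : ℝ) (hAB : B - A = 1) :
    ∃ V v, GF f V (Real.sqrt (∫ x in A..B, (f x) ^ 2)) v := by
  obtain ⟨V, v, hm, hVp, hv2, hosc⟩ := exists_V hp hv
  have hfm : Measurable f := by
    have h1 : Monotone (fun x => V x + f x) := by
      intro x y hxy
      have := abs_le.1 (hosc x y hxy)
      simp only; linarith
    have h2 : f = fun x => (V x + f x) - V x := by ext; ring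
    rw [h2]
    exact h1.measurable.sub hm.measurable
  have hd : ∀ x y, x ∈ Set.Icc (0:ℝ) 1 → y ∈ Set.Icc (0:ℝ) 1 → |f x - f y| ≤ 2 := by
    have key : ∀ x y, x ∈ Set.Icc (0:ℝ) 1 → y ∈ Set.Icc (0:ℝ) 1 → x ≤ y → |f x - f y| ≤ 2 := by
      intro x y hx hy hxy
      have := hosc x y hxy
      have a := hm hx.1
      have b := hm (show y ≤ 0 + 1 by linarith [hy.2])
      rw [hVp] at b; linarith
    intro x y hx hy
    rcases le_total x y with h | h
    · exact key x y hx hy h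
    · rw [abs_sub_comm]; exact key y x hy hx h
  have hper : Function.Periodic f 1 := hp
  have hfr : ∀ x, f x = f (Int.fract x) := by
    intro x
    have := hper.sub_int_mul_eq ⌊x⌋ (x := x)
    rw [mul_one] at this
    rw [Int.fract]; exact this.symm
  have hfr_mem : ∀ x : ℝ, Int.fract x ∈ Set.Icc (0:ℝ) 1 := fun x =>
    ⟨Int.fract_nonneg x, (Int.fract_lt_one x).le⟩
  have hbd0 : ∀ x, |f x| ≤ |f 0| + 2 := by
    intro x
    rw [hfr x]
    have := hd _ 0 (hfr_mem x) ⟨le_rfl, zero_le_one⟩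
    have h3 := abs_sub_abs_le_abs_sub (f (Int.fract x)) (f 0)
    linarith
  have hbd : ∀ x, |f x| ≤ 2 := by
    intro x
    rw [hfr x]
    set y := Int.fract x with hy
    have h1 : ∫ z in (0:ℝ)..1, (f y - f z) = f y := by
      rw [intervalIntegral.integral_sub intervalIntegrable_const (ii_of_bdd hfm hbd0 _ _), h0]
      simp
    have h2 := intervalIntegral.norm_integral_le_of_norm_le_const (a := (0:ℝ)) (b := 1) (C := 2)
      (f := fun z => f y - f z) (fun z hz => by
        rw [Set.uIoc_of_le zero_le_one] at hz
        exact hd _ _ (hfr_mem x) ⟨hz.1.le, hz.2⟩)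
    rw [h1, Real.norm_eq_abs] at h2
    simpa using h2
  refine ⟨V, v, hp, h0, hbd, ?_, hm, hVp, hv2, hosc⟩
  have hper2 : Function.Periodic (fun x => f x ^ 2) 1 := fun x => by simp only [hp]
  have := hper2.intervalIntegral_add_eq A 0
  rw [zero_add, show A + 1 = B by linarith] at this
  rw [Real.sq_sqrt, this]
  rw [this]
  exact intervalIntegral.integral_nonneg zero_le_one (fun x _ => sq_nonneg _)

/-- derivative of `ξ x^s` -/
noncomputable def Dv (ξ : ℝ) (s : ℕ) (c : ℝ) : ℝ := ξ * s * c ^ (s - 1)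

lemma Dv_pos {ξ : ℝ} (hξ : 0 < ξ) {s : ℕ} (hs : 1 ≤ s) {c : ℝ} (hc : 0 < c) : 0 < Dv ξ s c := by
  have : (0:ℝ) < s := by exact_mod_cast hs
  unfold Dv; positivity

lemma pow_sub_le (t : ℕ) {c d : ℝ} (hc : 0 ≤ c) (hcd : c ≤ d) :
    d ^ (t + 1) - c ^ (t + 1) ≤ (t + 1) * d ^ t * (d - c) := by
  induction t with
  | zero => simp
  | succ t ih =>
    have h1 : c ^ (t + 1) ≤ d ^ (t + 1) := by gcongr
    have hd : 0 ≤ d := hc.trans hcd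
    have h2 := mul_le_mul_of_nonneg_left ih hd
    have h3 := mul_le_mul_of_nonneg_left h1 (sub_nonneg.2 hcd)
    push_cast
    calc d ^ (t + 1 + 1) - c ^ (t + 1 + 1)
        = d * (d ^ (t + 1) - c ^ (t + 1)) + (d - c) * c ^ (t + 1) := by ring
      _ ≤ d * ((t + 1) * d ^ t * (d - c)) + (d - c) * d ^ (t + 1) := by linarith
      _ = _ := by ring

lemma le_pow_sub (t : ℕ) {c d : ℝ} (hc : 0 ≤ c) (hcd : c ≤ d) :
    (t + 1) * c ^ t * (d - c) ≤ d ^ (t + 1) - c ^ (t + 1) := by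
  induction t with
  | zero => simp
  | succ t ih =>
    have h1 : c ^ (t + 1) ≤ d ^ (t + 1) := by gcongr
    have h2 := mul_le_mul_of_nonneg_left ih hc
    have h3 := mul_le_mul_of_nonneg_left h1 (sub_nonneg.2 hcd)
    push_cast
    calc ((t:ℝ) + 1 + 1) * c ^ (t + 1) * (d - c)
        = c * ((t + 1) * c ^ t * (d - c)) + (d - c) * c ^ (t + 1) := by ring
      _ ≤ c * (d ^ (t + 1) - c ^ (t + 1)) + (d - c) * d ^ (t + 1) := by linarith
      _ = _ := by ring

lemma phi_sub_ge {ξ : ℝ} (hξ : 0 < ξ) {s : ℕ} (hs : 1 ≤ s) {c d : ℝ} (hc : 0 ≤ c) (hcd : c ≤ d) :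
    Dv ξ s c * (d - c) ≤ ξ * d ^ s - ξ * c ^ s := by
  obtain ⟨t, rfl⟩ := Nat.exists_eq_add_of_le' hs
  have := mul_le_mul_of_nonneg_left (le_pow_sub t hc hcd) hξ.le
  unfold Dv
  push_cast
  calc _ = ξ * ((t + 1) * c ^ t * (d - c)) := by ring
    _ ≤ _ := this
    _ = _ := by ring

lemma piece {ξ : ℝ} (hξ : 0 < ξ) {s : ℕ} (hs : 1 ≤ s) {c d θ : ℝ} (hc : 1 ≤ c) (hcd : c ≤ d)
    (hθ : θ ≤ 1) (h1 : θ / 2 ≤ ξ * d ^ s - ξ * c ^ s) (h2 : ξ * d ^ s - ξ * c ^ s ≤ θ) :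
    θ / 2 ≤ (1 + 1 / ξ) * Dv ξ s c * (d - c) := by
  obtain ⟨t, rfl⟩ := Nat.exists_eq_add_of_le' hs
  have hc0 : 0 < c := by linarith
  have hd0 : 0 < d := by linarith
  have h3 := mul_le_mul_of_nonneg_left (pow_sub_le t hc0.le hcd) hξ.le
  have hct : 1 ≤ c ^ t := one_le_pow₀ hc
  have hct1 : 1 ≤ c ^ (t+1) := one_le_pow₀ hc
  -- d^t ≤ κ c^t
  have h4 : d ^ (t + 1) ≤ (1 + 1 / ξ) * c ^ (t + 1) := by
    have : d ^ (t+1) ≤ c ^ (t+1) + 1 / ξ := by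
      rw [← sub_le_iff_le_add', le_div_iff₀ hξ]; linarith
    have h5 : 0 < 1 / ξ := by positivity
    nlinarith
  have h5 : d ^ t ≤ (1 + 1 / ξ) * c ^ t := by
    have h6 : 0 < 1 / ξ := by positivity
    have : c * d ^ t ≤ c * ((1 + 1 / ξ) * c ^ t) := by
      calc c * d ^ t ≤ d * d ^ t := by gcongr
        _ = d ^ (t + 1) := by ring
        _ ≤ _ := h4
        _ = _ := by ring
    exact le_of_mul_le_mul_left this hc0
  unfold Dv
  push_cast
  have h6 : ξ * ((t + 1) * d ^ t * (d - c)) ≤ ξ * ((t + 1) * ((1 + 1 / ξ) * c ^ t) * (d - c)) := by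
    have := sub_nonneg.2 hcd
    gcongr
  calc θ / 2 ≤ ξ * d ^ (t+1) - ξ * c ^ (t+1) := h1
    _ = ξ * (d ^ (t+1) - c ^ (t+1)) := by ring
    _ ≤ _ := h3
    _ ≤ _ := h6
    _ = _ := by ring

lemma Dv_mono {ξ : ℝ} (hξ : 0 < ξ) {s s' : ℕ} (hs : 1 ≤ s) (hss : s ≤ s') {A c : ℝ} (hA : 1 ≤ A)
    (hc : A ≤ c) : A ^ (s' - s) * Dv ξ s c ≤ Dv ξ s' c := by
  have hc0 : 0 < c := by linarith
  have e : c ^ (s' - 1) = c ^ (s' - s) * c ^ (s - 1) := by rw [← pow_add]; congr 1; omega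
  unfold Dv
  rw [e]
  have h1 : A ^ (s' - s) ≤ c ^ (s' - s) := by gcongr
  have h2 : (s:ℝ) ≤ s' := by exact_mod_cast hss
  calc A ^ (s' - s) * (ξ * s * c ^ (s - 1)) ≤ c ^ (s' - s) * (ξ * s' * c ^ (s - 1)) := by gcongr
    _ = _ := by ring

lemma partition {ξ : ℝ} (hξ : 0 < ξ) {s : ℕ} (hs : 1 ≤ s) {a b θ : ℝ} (ha : 0 < a) (hab : a ≤ b)
    (hθ : 0 < θ) (h : θ ≤ ξ * b ^ s - ξ * a ^ s) :
    ∃ (K : ℕ) (x : ℕ → ℝ), Monotone x ∧ x 0 = a ∧ x K = b ∧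
      ∀ k < K, θ / 2 ≤ ξ * x (k + 1) ^ s - ξ * x k ^ s ∧ ξ * x (k + 1) ^ s - ξ * x k ^ s ≤ θ := by
  have hs0 : s ≠ 0 := by omega
  set L := ξ * b ^ s - ξ * a ^ s with hL
  have hLpos : 0 < L := hθ.trans_le h
  set K := ⌈L / θ⌉₊ with hK
  have hq : 1 ≤ L / θ := by rwa [le_div_iff₀ hθ, one_mul]
  have hK1 : L / θ ≤ K := Nat.le_ceil _
  have hK2 : (K:ℝ) < L / θ + 1 := Nat.ceil_lt_add_one (by positivity)
  have hKpos : (0:ℝ) < K := by linarith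
  set x : ℕ → ℝ := fun k => (a ^ s + k * (L / ξ / K)) ^ ((s:ℝ)⁻¹) with hx
  have hxp : ∀ k, x k ^ s = a ^ s + k * (L / ξ / K) := fun k =>
    Real.rpow_inv_natCast_pow (by positivity) hs0
  refine ⟨K, x, ?_, ?_, ?_, ?_⟩
  · intro i j hij
    have : (i:ℝ) ≤ j := by exact_mod_cast hij
    simp only [hx]
    apply Real.rpow_le_rpow (by positivity) _ (by positivity)
    gcongr
  · simp only [hx]; rw [Nat.cast_zero, zero_mul, add_zero]
    exact Real.pow_rpow_inv_natCast ha.le hs0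
  · simp only [hx]
    have : a ^ s + K * (L / ξ / K) = b ^ s := by
      rw [mul_div_cancel₀ _ hKpos.ne', hL]; field_simp; ring
    rw [this]
    exact Real.pow_rpow_inv_natCast (ha.le.trans hab) hs0
  · intro k _
    have e : ξ * x (k + 1) ^ s - ξ * x k ^ s = L / K := by
      rw [hxp, hxp]; push_cast; field_simp; ring
    rw [e]
    constructor
    · rw [le_div_iff₀ hKpos]
      have : (K:ℝ) ≤ 2 * (L / θ) := by linarith
      have h3 : θ * (L / θ) = L := by field_simp
      nlinarith
    · rw [div_le_iff₀ hKpos]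
      rw [div_le_iff₀ hθ] at hK1; linarith

section est
variable {f V : ℝ → ℝ} {σ v : ℝ} {ξ : ℝ} {a b ε : ℝ} {s : ℕ}

lemma inv_Dv_le (hξ : 0 < ξ) (hs : 1 ≤ s) (ha : 0 < a) (hI : 1 ≤ ε * (b - a) * Dv ξ s a) {G : ℝ}
    (hG : 0 ≤ G) : G / (ξ * s * a ^ (s - 1)) ≤ G * ε * (b - a) := by
  have := Dv_pos hξ hs ha
  change G / Dv ξ s a ≤ _
  rw [div_le_iff₀ this]
  nlinarith

lemma est1 (h : GF f V σ v) (hξ : 0 < ξ) (hs : 1 ≤ s) (ha : 0 < a) (hab : a ≤ b)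
    (hI : 1 ≤ ε * (b - a) * Dv ξ s a) :
    |∫ x in a..b, f (ξ * x ^ s)| ≤ 2 * ε * (b - a) :=
  (equi h.meas h.bd h.per h.zero hξ hs ha hab).trans (inv_Dv_le hξ hs ha hI (by norm_num))

lemma est2 (h : GF f V σ v) (hξ : 0 < ξ) (hs : 1 ≤ s) (ha : 0 < a) (hab : a ≤ b)
    (hI : 1 ≤ ε * (b - a) * Dv ξ s a) :
    ∫ x in a..b, f (ξ * x ^ s) ^ 2 ≤ (σ ^ 2 + 4 * ε) * (b - a) := by
  have hfm := h.meas
  have hb4 : ∀ x, f x ^ 2 ≤ 4 := fun x => by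
    have := abs_le.1 (h.bd x); nlinarith
  have hb4' : ∀ x, |f x ^ 2| ≤ 4 := fun x => by rw [abs_of_nonneg (sq_nonneg _)]; exact hb4 x
  have hm2 : Measurable (fun x => f x ^ 2) := by fun_prop
  have := equi (g := fun x => f x ^ 2 - σ ^ 2) (G := 4) (by fun_prop)
    (fun x => by
      have h1 := hb4 x; have h2 := h.sq_le
      rw [abs_le]; constructor <;> nlinarith [sq_nonneg (f x), sq_nonneg σ])
    (fun x => by simp only [h.per])
    (by
      rw [intervalIntegral.integral_sub (ii_of_bdd hm2 hb4' _ _) intervalIntegrable_const, h.sq]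
      simp) hξ hs ha hab
  have h3 := this.trans (inv_Dv_le hξ hs ha hI (by norm_num))
  rw [intervalIntegral.integral_sub
    (ii_of_bdd (g := fun x => f (ξ * x ^ s) ^ 2) (by fun_prop) (fun x => hb4' _) _ _)
    intervalIntegrable_const, intervalIntegral.integral_const, smul_eq_mul] at h3
  have := (abs_le.1 h3).2
  linarith

lemma est3 (h : GF f V σ v) (hξ : 0 < ξ) (hs : 1 ≤ s) (ha : 0 < a) (hab : a ≤ b)
    (hI : 1 ≤ ε * (b - a) * Dv ξ s a) {θ : ℝ} (hθ : 0 ≤ θ) (hθ1 : θ ≤ 1) :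
    ∫ x in a..b, Wf V θ (ξ * x ^ s) ≤ (4 * θ + 4 * ε) * (b - a) := by
  have hWm := h.W_meas θ
  have hv0 := h.v_nonneg
  have hv2 := h.vle
  have hb4' : ∀ x, |Wf V θ x| ≤ 4 := fun x => by
    rw [abs_of_nonneg (h.W_nonneg hθ x)]; exact h.W_le hθ1 x
  have hvv : 2 * θ * v ≤ 4 * θ := by nlinarith
  have hvv0 : 0 ≤ 2 * θ * v := by positivity
  have := equi (g := fun x => Wf V θ x - 2 * θ * v) (G := 4) (by fun_prop)
    (fun x => by
      have h1 := h.W_nonneg hθ x; have h2 := h.W_le hθ1 x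
      rw [abs_le]; constructor <;> linarith)
    (fun x => by simp only [h.W_per])
    (by
      rw [intervalIntegral.integral_sub (ii_of_bdd hWm hb4' _ _) intervalIntegrable_const, h.W_int]
      simp) hξ hs ha hab
  have h3 := this.trans (inv_Dv_le hξ hs ha hI (by norm_num))
  rw [intervalIntegral.integral_sub
    (ii_of_bdd (g := fun x => Wf V θ (ξ * x ^ s)) (by fun_prop) (fun x => hb4' _) _ _)
    intervalIntegrable_const, intervalIntegral.integral_const, smul_eq_mul] at h3
  have := (abs_le.1 h3).2
  nlinarith

lemma est4 (h : GF f V σ v) (hξ : 0 < ξ) (hs : 1 ≤ s) {A : ℝ} (hA : 1 ≤ A) (ha : A ≤ a) (hab : a ≤ b)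
    (hI : 1 ≤ ε * (b - a) * Dv ξ s a) (hε1 : ε ≤ 1) {s' : ℕ} (hss : s ≤ s')
    {θ : ℝ} (hθ : 0 < θ) (hθ1 : θ ≤ 1) :
    |∫ x in a..b, f (ξ * x ^ s) * f (ξ * x ^ s')| ≤
      (8 * (1 + 1 / ξ) / (θ * A ^ (s' - s)) + 8 * θ + 8 * ε) * (b - a) := by
  have ha0 : 0 < a := by linarith
  have hfm := h.meas
  have hWm := h.W_meas θ
  have hDp := Dv_pos hξ hs ha0
  have hlen : θ ≤ ξ * b ^ s - ξ * a ^ s := by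
    have h1 := phi_sub_ge hξ hs ha0.le hab
    have h2 : ε * (b - a) * Dv ξ s a ≤ (b - a) * Dv ξ s a := by
      have : 0 ≤ (b - a) * Dv ξ s a := mul_nonneg (by linarith) hDp.le
      nlinarith
    nlinarith
  obtain ⟨K, x, xm, x0, xK, hx⟩ := partition hξ hs ha0 hab hθ hlen
  have hprodb : ∀ y, |f (ξ * y ^ s) * f (ξ * y ^ s')| ≤ 4 := fun y => by
    rw [abs_mul]
    have h1 := h.bd (ξ * y ^ s); have h2 := h.bd (ξ * y ^ s')
    nlinarith [abs_nonneg (f (ξ * y ^ s)), abs_nonneg (f (ξ * y ^ s'))]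
  have hWb : ∀ y, |Wf V θ (ξ * y ^ s)| ≤ 4 := fun x => by
    rw [abs_of_nonneg (h.W_nonneg hθ.le _)]; exact h.W_le hθ1 _
  have hip : ∀ c d, IntervalIntegrable (fun y => f (ξ * y ^ s) * f (ξ * y ^ s')) volume c d :=
    fun c d => ii_of_bdd (by fun_prop) hprodb c d
  have hiW : ∀ c d, IntervalIntegrable (fun y => Wf V θ (ξ * y ^ s)) volume c d :=
    fun c d => ii_of_bdd (by fun_prop) hWb c d
  have hsum := intervalIntegral.sum_integral_adjacent_intervals (n := K) (a := x)
    (fun k _ => hip (x k) (x (k + 1)))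
  have hsumW := intervalIntegral.sum_integral_adjacent_intervals (n := K) (a := x)
    (fun k _ => hiW (x k) (x (k + 1)))
  rw [x0, xK] at hsum hsumW
  have hpiece : ∀ k ∈ Finset.range K, |∫ y in x k..x (k+1), f (ξ * y ^ s) * f (ξ * y ^ s')| ≤
      8 * (1 + 1 / ξ) / (θ * A ^ (s' - s)) * (x (k+1) - x k) +
        2 * ∫ y in x k..x (k+1), Wf V θ (ξ * y ^ s) := by
    intro k hk
    obtain ⟨hk1, hk2⟩ := hx k (Finset.mem_range.1 hk)
    have hc : a ≤ x k := x0 ▸ xm (Nat.zero_le k)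
    have hcd : x k ≤ x (k+1) := xm (Nat.le_succ k)
    generalize x k = c at *
    generalize x (k+1) = d at *
    have hc0 : 0 < c := by linarith
    have hp := piece hξ hs (by linarith) hcd hθ1 hk1 hk2
    have hDm := Dv_mono hξ hs hss hA (ha.trans hc)
    have hDc := Dv_pos hξ hs hc0
    have hs' : 1 ≤ s' := hs.trans hss
    have heq := equi h.meas h.bd h.per h.zero hξ hs' hc0 hcd
    have hAp : 0 < A ^ (s' - s) := by positivity
    have hinv : 2 / Dv ξ s' c ≤ 4 * (1 + 1 / ξ) / (θ * A ^ (s' - s)) * (d - c) := by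
      have hcd' : 0 ≤ d - c := by linarith
      have hξ1 : 0 < 1 + 1 / ξ := by positivity
      calc 2 / Dv ξ s' c ≤ 2 / (A ^ (s' - s) * Dv ξ s c) := by gcongr
        _ ≤ _ := by
          rw [div_le_iff₀ (by positivity)]
          have : 4 * (1 + 1 / ξ) / (θ * A ^ (s' - s)) * (d - c) * (A ^ (s' - s) * Dv ξ s c)
            = 4 / θ * ((1 + 1 / ξ) * Dv ξ s c * (d - c)) := by field_simp
          rw [this]
          calc 2 = 4 / θ * (θ / 2) := by field_simp; norm_num
            _ ≤ _ := by gcongr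
    have hi' : IntervalIntegrable (fun y => f (ξ * y ^ s')) volume c d :=
      ii_of_bdd (by fun_prop) (fun y => h.bd _) c d
    have hsplit : ∫ y in c..d, f (ξ * y ^ s) * f (ξ * y ^ s') =
        f (ξ * c ^ s) * (∫ y in c..d, f (ξ * y ^ s')) +
        ∫ y in c..d, (f (ξ * y ^ s) - f (ξ * c ^ s)) * f (ξ * y ^ s') := by
      rw [← intervalIntegral.integral_const_mul, ← intervalIntegral.integral_add]
      · congr 1; ext y; ring
      · exact hi'.const_mul _
      · have := (hip c d).sub (hi'.const_mul (f (ξ * c ^ s)))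
        refine this.congr (fun y _ => ?_)
        ring
    have hA1 : |f (ξ * c ^ s) * (∫ y in c..d, f (ξ * y ^ s'))| ≤
        8 * (1 + 1 / ξ) / (θ * A ^ (s' - s)) * (d - c) := by
      rw [abs_mul]
      have h1 := h.bd (ξ * c ^ s)
      have h2 : |∫ y in c..d, f (ξ * y ^ s')| ≤ 4 * (1 + 1 / ξ) / (θ * A ^ (s' - s)) * (d - c) :=
        heq.trans hinv
      calc _ ≤ 2 * (4 * (1 + 1 / ξ) / (θ * A ^ (s' - s)) * (d - c)) :=
            mul_le_mul h1 h2 (abs_nonneg _) (by norm_num)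
        _ = _ := by ring
    have hA2 : |∫ y in c..d, (f (ξ * y ^ s) - f (ξ * c ^ s)) * f (ξ * y ^ s')| ≤
        2 * ∫ y in c..d, Wf V θ (ξ * y ^ s) := by
      rw [← intervalIntegral.integral_const_mul, ← Real.norm_eq_abs]
      refine intervalIntegral.norm_integral_le_of_norm_le hcd ?_ ((hiW c d).const_mul 2)
      refine Eventually.of_forall fun y hy => ?_
      rw [norm_mul, Real.norm_eq_abs, Real.norm_eq_abs, mul_comm]
      apply mul_le_mul (h.bd _) _ (abs_nonneg _) (by norm_num)
      apply h.osc_le_W'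
      have h1 : c ^ s ≤ y ^ s := by have := hy.1.le; gcongr
      have h2 : y ^ s ≤ d ^ s := by have := hy.2; have : 0 ≤ y := by linarith [hy.1]
                                    gcongr
      rw [abs_of_nonneg (by nlinarith)]
      nlinarith
    rw [hsplit]
    exact (abs_add_le _ _).trans (add_le_add hA1 hA2)
  rw [← hsum]
  refine (Finset.abs_sum_le_sum_abs _ _).trans ((Finset.sum_le_sum hpiece).trans ?_)
  rw [Finset.sum_add_distrib, ← Finset.mul_sum, ← Finset.mul_sum, hsumW, Finset.sum_range_sub, x0, xK]
  have := est3 h hξ hs ha0 hab hI hθ.le hθ1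
  linarith
end est

lemma geom_dist {q : ℝ} (hq : 0 ≤ q) (hq1 : q < 1) (S : Finset ℕ) (n : ℕ) :
    ∑ k ∈ S, q ^ ((n - k) + (k - n)) ≤ 2 / (1 - q) := by
  have hs := summable_geometric_of_lt_one hq hq1
  have h1 : ∑ k ∈ S with k ≤ n, q ^ ((n - k) + (k - n)) ≤ (1 - q)⁻¹ := by
    rw [← tsum_geometric_of_lt_one hq hq1]
    have : ∑ k ∈ S with k ≤ n, q ^ ((n - k) + (k - n)) =
        ∑ j ∈ (S.filter (· ≤ n)).image (fun k => n - k), q ^ j := by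
      rw [Finset.sum_image]
      · apply Finset.sum_congr rfl
        intro k hk
        have := (Finset.mem_filter.1 hk).2
        congr 1; omega
      · intro i hi j hj hij
        have hi := (Finset.mem_filter.1 hi).2
        have hj := (Finset.mem_filter.1 hj).2
        simp only at hij; omega
    rw [this]
    exact hs.sum_le_tsum _ (fun i _ => pow_nonneg hq i)
  have h2 : ∑ k ∈ S with ¬ k ≤ n, q ^ ((n - k) + (k - n)) ≤ (1 - q)⁻¹ := by
    rw [← tsum_geometric_of_lt_one hq hq1]
    have : ∑ k ∈ S with ¬ k ≤ n, q ^ ((n - k) + (k - n)) =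
        ∑ j ∈ (S.filter (¬ · ≤ n)).image (fun k => k - n), q ^ j := by
      rw [Finset.sum_image]
      · apply Finset.sum_congr rfl
        intro k hk
        have := (Finset.mem_filter.1 hk).2
        congr 1; omega
      · intro i hi j hj hij
        have hi := (Finset.mem_filter.1 hi).2
        have hj := (Finset.mem_filter.1 hj).2
        simp only at hij; omega
    rw [this]
    exact hs.sum_le_tsum _ (fun i _ => pow_nonneg hq i)
  rw [← Finset.sum_filter_add_sum_filter_not S (· ≤ n)]
  rw [div_eq_mul_inv]; linarith

/-- block sum -/
noncomputable def Bl (g : ℝ → ℝ) (ξ : ℝ) (s : ℕ → ℕ) (u p : ℕ) (x : ℝ) : ℝ :=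
  ∑ n ∈ Finset.Ioc u (u + p), g (ξ * x ^ s n)

lemma Bl_meas {g : ℝ → ℝ} (hg : Measurable g) (ξ : ℝ) (s : ℕ → ℕ) (u p : ℕ) :
    Measurable (Bl g ξ s u p) := by
  unfold Bl; fun_prop

lemma Bl_abs {g : ℝ → ℝ} {G : ℝ} (hg : ∀ x, |g x| ≤ G) (ξ : ℝ) (s : ℕ → ℕ) (u p : ℕ) (x : ℝ) :
    |Bl g ξ s u p x| ≤ p * G := by
  unfold Bl
  refine (Finset.abs_sum_le_sum_abs _ _).trans ((Finset.sum_le_sum fun n _ => hg _).trans ?_)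
  simp

lemma Bl_int {g : ℝ → ℝ} {G : ℝ} (hm : Measurable g) (hg : ∀ x, |g x| ≤ G) (ξ : ℝ) (s : ℕ → ℕ)
    (u p : ℕ) (a b : ℝ) :
    ∫ x in a..b, Bl g ξ s u p x = ∑ n ∈ Finset.Ioc u (u + p), ∫ x in a..b, g (ξ * x ^ s n) := by
  unfold Bl
  exact intervalIntegral.integral_finsetSum fun n _ => ii_of_bdd (by fun_prop) (fun x => hg _) a b

section blk
variable {f V : ℝ → ℝ} {σ v : ℝ} {ξ A β δ : ℝ} {a b : ℝ} {s : ℕ → ℕ}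

lemma corr (h : GF f V σ v) (hξ : 0 < ξ) (hA : 1 ≤ A) (hβ : 1 < β) (hβA : β ^ 4 ≤ A)
    (hδ : 0 < δ) (hδ1 : δ ≤ 1) (hσ : 0 < σ) (hδσ : 4 * δ ^ 2 ≤ σ ^ 2)
    (ha : A ≤ a) (hab : a ≤ b) (hs : StrictMono s) {n n' : ℕ} (hn : 1 ≤ s n) (hnn : n ≤ n')
    (hI : 1 ≤ δ ^ 2 * (b - a) * Dv ξ (s n) a) (hI' : 1 ≤ δ ^ 2 * (b - a) * Dv ξ (s n') a) :
    |∫ x in a..b, f (ξ * x ^ s n) * f (ξ * x ^ s n')| ≤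
      6 * (1 + 1 / ξ) * σ * (β⁻¹ ^ (n' - n) + δ) * (b - a) := by
  have ha0 : 0 < a := by linarith
  have hfm := h.meas
  have hss : s n ≤ s n' := hs.monotone hnn
  have hn' : 1 ≤ s n' := hn.trans hss
  have hβ0 : 0 < β := by linarith
  set r := n' - n with hr
  set q := β⁻¹ with hq
  have hq0 : 0 < q := by positivity
  have hq1 : q ≤ 1 := inv_le_one_of_one_le₀ hβ.le
  have hrs : r ≤ s n' - s n := by
    have : ∀ k, s n + k ≤ s (n + k) := by
      intro k
      induction k with
      | zero => simp
      | succ k ih => have := hs (show n + k < n + (k + 1) by omega); omega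
    have := this r
    rw [show n + r = n' by omega] at this; omega
  have hba : 0 ≤ b - a := by linarith
  have hξ' : 0 < 1 / ξ := by positivity
  set κ := 1 + 1 / ξ with hκ
  have hκ1 : 1 ≤ κ := by linarith
  have hb4 : ∀ x, |f x ^ 2| ≤ 4 := fun x => by
    have := abs_le.1 (h.bd x); rw [abs_of_nonneg (sq_nonneg _)]; nlinarith
  -- first bound
  have hB1 : |∫ x in a..b, f (ξ * x ^ s n) * f (ξ * x ^ s n')| ≤ 2 * σ ^ 2 * (b - a) := by
    have e1 := est2 h hξ hn ha0 hab hI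
    have e2 := est2 h hξ hn' ha0 hab hI'
    have i1 : IntervalIntegrable (fun x => f (ξ * x ^ s n) ^ 2) volume a b :=
      ii_of_bdd (by fun_prop) (fun x => hb4 _) a b
    have i2 : IntervalIntegrable (fun x => f (ξ * x ^ s n') ^ 2) volume a b :=
      ii_of_bdd (by fun_prop) (fun x => hb4 _) a b
    have : |∫ x in a..b, f (ξ * x ^ s n) * f (ξ * x ^ s n')| ≤
        ∫ x in a..b, (1/2) * (f (ξ * x ^ s n) ^ 2 + f (ξ * x ^ s n') ^ 2) := by
      rw [← Real.norm_eq_abs]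
      refine intervalIntegral.norm_integral_le_of_norm_le hab ?_ ((i1.add i2).const_mul (1/2))
      refine Eventually.of_forall fun x _ => ?_
      rw [Real.norm_eq_abs, abs_le]
      constructor <;> nlinarith [sq_nonneg (f (ξ * x ^ s n) + f (ξ * x ^ s n')),
        sq_nonneg (f (ξ * x ^ s n) - f (ξ * x ^ s n'))]
    rw [intervalIntegral.integral_const_mul, intervalIntegral.integral_add i1 i2] at this
    nlinarith
  -- second bound
  have hB2 : |∫ x in a..b, f (ξ * x ^ s n) * f (ξ * x ^ s n')| ≤
      16 * κ * (q ^ r + δ) ^ 2 * (b - a) := by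
    have hδ2 : δ ^ 2 ≤ 1 := pow_le_one₀ hδ.le hδ1
    have e := est4 (θ := q ^ (2 * r)) h hξ hn hA ha hab hI hδ2 hss (by positivity)
      (pow_le_one₀ hq0.le hq1)
    refine e.trans ?_
    apply mul_le_mul_of_nonneg_right _ hba
    have hAr : β ^ (4 * r) ≤ A ^ (s n' - s n) := by
      rw [pow_mul]
      calc (β ^ 4) ^ r ≤ A ^ r := by gcongr
        _ ≤ A ^ (s n' - s n) := pow_le_pow_right₀ hA hrs
    have h1 : 8 * κ / (q ^ (2 * r) * A ^ (s n' - s n)) ≤ 8 * κ * q ^ (2 * r) := by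
      rw [div_le_iff₀ (by positivity)]
      have : 1 ≤ q ^ (2 * r) * (q ^ (2 * r) * A ^ (s n' - s n)) := by
        calc (1:ℝ) = q ^ (2 * r) * (q ^ (2 * r) * β ^ (4 * r)) := by
              rw [hq, show 4 * r = 2 * r + 2 * r by ring, pow_add, inv_pow]
              field_simp
          _ ≤ _ := by gcongr
      nlinarith
    have h2 : q ^ (2 * r) = (q ^ r) ^ 2 := by rw [← pow_mul, mul_comm]
    rw [h2] at h1
    rw [h2]
    have h3 : 0 < q ^ r := by positivity
    nlinarith [mul_pos h3 hδ, sq_nonneg (q ^ r), sq_nonneg δ, mul_pos (mul_pos h3 hδ) (show 0 < κ by linarith), mul_nonneg (show 0 ≤ κ - 1 by linarith) (sq_nonneg (q ^ r)), mul_nonneg (show 0 ≤ κ - 1 by linarith) (sq_nonneg δ)]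
  have hnn0 := abs_nonneg (∫ x in a..b, f (ξ * x ^ s n) * f (ξ * x ^ s n'))
  have hY : 0 ≤ 6 * κ * σ * (q ^ r + δ) * (b - a) := by positivity
  apply le_of_sq_le_sq _ hY
  calc _ = |∫ x in a..b, f (ξ * x ^ s n) * f (ξ * x ^ s n')| *
        |∫ x in a..b, f (ξ * x ^ s n) * f (ξ * x ^ s n')| := sq _
    _ ≤ (2 * σ ^ 2 * (b - a)) * (16 * κ * (q ^ r + δ) ^ 2 * (b - a)) :=
      mul_le_mul hB1 hB2 hnn0 (by positivity)
    _ = 32 * κ * (σ * (q ^ r + δ) * (b - a)) ^ 2 := by ring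
    _ ≤ 36 * κ ^ 2 * (σ * (q ^ r + δ) * (b - a)) ^ 2 := by
      apply mul_le_mul_of_nonneg_right _ (sq_nonneg _); nlinarith
    _ = _ := by ring

lemma block2 (h : GF f V σ v) (hξ : 0 < ξ) (hA : 1 ≤ A) (hβ : 1 < β) (hβA : β ^ 4 ≤ A)
    (hδ : 0 < δ) (hδ1 : δ ≤ 1) (hσ : 0 < σ) (hδσ : 4 * δ ^ 2 ≤ σ ^ 2)
    (ha : A ≤ a) (hab : a ≤ b) (hs : StrictMono s) {u p : ℕ} (hpδ : p * δ ≤ 1)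
    (hI : ∀ n ∈ Finset.Ioc u (u + p), 1 ≤ s n ∧ 1 ≤ δ ^ 2 * (b - a) * Dv ξ (s n) a) :
    ∫ x in a..b, Bl f ξ s u p x ^ 2 ≤
      6 * (1 + 1 / ξ) * (2 / (1 - β⁻¹) + 1) * σ * p * (b - a) := by
  have hfm := h.meas
  have hprodb : ∀ y z, |f y * f z| ≤ 4 := fun y z => by
    rw [abs_mul]
    have h1 := h.bd y; have h2 := h.bd z
    nlinarith [abs_nonneg (f y), abs_nonneg (f z)]
  have hq0 : 0 ≤ β⁻¹ := by positivity
  have hq1 : β⁻¹ < 1 := inv_lt_one_of_one_lt₀ hβ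
  have hexp : ∀ x, Bl f ξ s u p x ^ 2 = ∑ n ∈ Finset.Ioc u (u + p), ∑ k ∈ Finset.Ioc u (u + p),
      f (ξ * x ^ s n) * f (ξ * x ^ s k) := by
    intro x
    unfold Bl
    rw [sq, Finset.sum_mul_sum]
  have hint : ∫ x in a..b, Bl f ξ s u p x ^ 2 =
      ∑ n ∈ Finset.Ioc u (u + p), ∑ k ∈ Finset.Ioc u (u + p),
        ∫ x in a..b, f (ξ * x ^ s n) * f (ξ * x ^ s k) := by
    simp_rw [hexp]
    rw [intervalIntegral.integral_finsetSum]
    · apply Finset.sum_congr rfl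
      intro n _
      exact intervalIntegral.integral_finsetSum fun k _ =>
        ii_of_bdd (by fun_prop) (fun x => hprodb _ _) a b
    · intro n _
      refine ii_of_bdd (G := ∑ k ∈ Finset.Ioc u (u + p), 4) (by fun_prop) (fun x => ?_) a b
      exact (Finset.abs_sum_le_sum_abs _ _).trans (Finset.sum_le_sum fun k _ => hprodb _ _)
  rw [hint]
  have hterm : ∀ n ∈ Finset.Ioc u (u + p), ∀ k ∈ Finset.Ioc u (u + p),
      ∫ x in a..b, f (ξ * x ^ s n) * f (ξ * x ^ s k) ≤
        6 * (1 + 1 / ξ) * σ * (β⁻¹ ^ ((n - k) + (k - n)) + δ) * (b - a) := by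
    intro n hn k hk
    rcases le_total n k with hnk | hnk
    · have := corr h hξ hA hβ hβA hδ hδ1 hσ hδσ ha hab hs (hI n hn).1 hnk (hI n hn).2 (hI k hk).2
      rw [show (n - k) + (k - n) = k - n by omega]
      exact (le_abs_self _).trans this
    · have := corr h hξ hA hβ hβA hδ hδ1 hσ hδσ ha hab hs (hI k hk).1 hnk (hI k hk).2 (hI n hn).2
      rw [show (n - k) + (k - n) = n - k by omega]
      simp_rw [mul_comm (f (ξ * _ ^ s n))]
      exact (le_abs_self _).trans this
  have hba : 0 ≤ b - a := by linarith
  have hC : 0 ≤ 6 * (1 + 1 / ξ) * σ := by positivity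
  calc _ ≤ ∑ n ∈ Finset.Ioc u (u + p), ∑ k ∈ Finset.Ioc u (u + p),
        6 * (1 + 1 / ξ) * σ * (β⁻¹ ^ ((n - k) + (k - n)) + δ) * (b - a) :=
        Finset.sum_le_sum fun n hn => Finset.sum_le_sum fun k hk => hterm n hn k hk
    _ ≤ ∑ n ∈ Finset.Ioc u (u + p), 6 * (1 + 1 / ξ) * σ * (2 / (1 - β⁻¹) + 1) * (b - a) := by
        apply Finset.sum_le_sum
        intro n _
        rw [← Finset.sum_mul, ← Finset.mul_sum, Finset.sum_add_distrib]
        apply mul_le_mul_of_nonneg_right _ hba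
        apply mul_le_mul_of_nonneg_left _ hC
        apply add_le_add (geom_dist hq0 hq1 _ n)
        simpa using hpδ
    _ = _ := by
        rw [Finset.sum_const, Nat.card_Ioc, nsmul_eq_mul, Nat.add_sub_cancel_left]; ring

set_option maxHeartbeats 2000000 in
lemma mgf (h : GF f V σ v) (hξ : 0 < ξ) (hA : 1 ≤ A) (hβ : 1 < β) (hβA : β ^ 4 ≤ A)
    (hδ : 0 < δ) (hδ1 : δ ≤ 1) (hσ : 0 < σ) (hδσ : 4 * δ ^ 2 ≤ σ ^ 2)
    (ha : A ≤ a) (hab : a ≤ b) (hs : StrictMono s) {u p : ℕ} (hpδ : p * δ ≤ 1)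
    (hI : ∀ n ∈ Finset.Ioc u (u + p), 1 ≤ s n ∧ 1 ≤ δ ^ 2 * (b - a) * Dv ξ (s n) a)
    {η l : ℝ} (hη : 0 ≤ η) (hη1 : η ≤ 1) (hl : 0 ≤ l) (hlp : 6 * l * p ≤ 1) :
    ∫ x in a..b, Real.exp (l * (Bl f ξ s u p x + Bl (Wf V η) ξ s u p x)) ≤
      (b - a) * Real.exp (l * p * (4 * η + 6 * δ ^ 2) +
        2 * l ^ 2 * (6 * (1 + 1 / ξ) * (2 / (1 - β⁻¹) + 1) * σ * p + 4 * p ^ 2 * (4 * η + 6 * δ ^ 2))) := by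
  have hfm := h.meas
  have hWm := h.W_meas η
  have ha0 : 0 < a := by linarith
  have hba : 0 ≤ b - a := by linarith
  have hWb : ∀ y, |Wf V η y| ≤ 4 := fun x => by
    rw [abs_of_nonneg (h.W_nonneg hη _)]; exact h.W_le hη1 _
  set X := Bl f ξ s u p with hX
  set W := Bl (Wf V η) ξ s u p with hW
  have hXm : Measurable X := Bl_meas hfm ξ s u p
  have hWM : Measurable W := Bl_meas hWm ξ s u p
  have hXb : ∀ x, |X x| ≤ p * 2 := Bl_abs h.bd ξ s u p
  have hWb' : ∀ x, |W x| ≤ p * 4 := Bl_abs hWb ξ s u p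
  have hW0 : ∀ x, 0 ≤ W x := fun x => Finset.sum_nonneg fun n _ => h.W_nonneg hη _
  have hp0 : (0:ℝ) ≤ p := Nat.cast_nonneg p
  have IX := ii_of_bdd hXm hXb a b
  have IW := ii_of_bdd hWM hWb' a b
  have hX2b : ∀ x, |X x ^ 2| ≤ (p * 2) ^ 2 := fun x => by
    rw [abs_pow]; exact pow_le_pow_left₀ (abs_nonneg _) (hXb x) 2
  have IX2 : IntervalIntegrable (fun x => X x ^ 2) volume a b := ii_of_bdd (by fun_prop) hX2b a b
  have EX : ∫ x in a..b, X x ≤ 2 * δ ^ 2 * p * (b - a) := by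
    rw [hX, Bl_int hfm h.bd]
    calc _ ≤ ∑ n ∈ Finset.Ioc u (u + p), 2 * δ ^ 2 * (b - a) :=
          Finset.sum_le_sum fun n hn =>
            (le_abs_self _).trans (est1 h hξ (hI n hn).1 ha0 hab (hI n hn).2)
      _ = _ := by
          rw [Finset.sum_const, Nat.card_Ioc, nsmul_eq_mul, Nat.add_sub_cancel_left]; ring
  have EW : ∫ x in a..b, W x ≤ (4 * η + 4 * δ ^ 2) * p * (b - a) := by
    rw [hW, Bl_int hWm hWb]
    calc _ ≤ ∑ n ∈ Finset.Ioc u (u + p), (4 * η + 4 * δ ^ 2) * (b - a) :=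
          Finset.sum_le_sum fun n hn => est3 h hξ (hI n hn).1 ha0 hab (hI n hn).2 hη hη1
      _ = _ := by
          rw [Finset.sum_const, Nat.card_Ioc, nsmul_eq_mul, Nat.add_sub_cancel_left]; ring
  have EX2 := block2 h hξ hA hβ hβA hδ hδ1 hσ hδσ ha hab hs hpδ hI
  rw [← hX] at EX2
  set C2 := 6 * (1 + 1 / ξ) * (2 / (1 - β⁻¹) + 1) with hC2
  have hpt : ∀ x, Real.exp (l * (X x + W x)) ≤
      1 + l * X x + (l + 8 * l ^ 2 * p) * W x + 2 * l ^ 2 * X x ^ 2 := by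
    intro x
    have h1 := abs_le.1 (hXb x)
    have h2 := abs_le.1 (hWb' x)
    have h3 : |l * (X x + W x)| ≤ 1 := by
      rw [abs_mul, abs_of_nonneg hl]
      have : |X x + W x| ≤ 6 * p := by rw [abs_le]; constructor <;> linarith
      calc l * |X x + W x| ≤ l * (6 * p) := mul_le_mul_of_nonneg_left this hl
        _ ≤ 1 := by linarith
    have h4 := (abs_le.1 (Real.abs_exp_sub_one_sub_id_le h3)).2
    have h5 : W x ^ 2 ≤ 4 * p * W x := by nlinarith [hW0 x]
    have h6 : (X x + W x) ^ 2 ≤ 2 * X x ^ 2 + 2 * (4 * p * W x) := by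
      nlinarith [sq_nonneg (X x - W x)]
    have h7 := mul_le_mul_of_nonneg_left h6 (sq_nonneg l)
    nlinarith
  have hmono : ∫ x in a..b, Real.exp (l * (X x + W x)) ≤
      ∫ x in a..b, (1 + l * X x + (l + 8 * l ^ 2 * p) * W x + 2 * l ^ 2 * X x ^ 2) := by
    apply intervalIntegral.integral_mono_on hab
    · refine ii_of_bdd (G := Real.exp 1) (by fun_prop) (fun x => ?_) a b
      rw [abs_of_pos (Real.exp_pos _)]
      apply Real.exp_le_exp.2
      have h1 := abs_le.1 (hXb x)
      have h2 := abs_le.1 (hWb' x)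
      nlinarith
    · exact (((intervalIntegrable_const).add (IX.const_mul l)).add (IW.const_mul _)).add
        (IX2.const_mul _)
    · intro x _; exact hpt x
  rw [intervalIntegral.integral_add (((intervalIntegrable_const).add (IX.const_mul l)).add
      (IW.const_mul _)) (IX2.const_mul _),
    intervalIntegral.integral_add ((intervalIntegrable_const).add (IX.const_mul l)) (IW.const_mul _),
    intervalIntegral.integral_add intervalIntegrable_const (IX.const_mul l),
    intervalIntegral.integral_const_mul, intervalIntegral.integral_const_mul,
    intervalIntegral.integral_const_mul, intervalIntegral.integral_const, smul_eq_mul, mul_one] at hmono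
  have g1 := mul_le_mul_of_nonneg_left EX hl
  have g2 := mul_le_mul_of_nonneg_left EW (show 0 ≤ l + 8 * l ^ 2 * p by positivity)
  have g3 := mul_le_mul_of_nonneg_left EX2 (show 0 ≤ 2 * l ^ 2 by positivity)
  set E := l * p * (4 * η + 6 * δ ^ 2) + 2 * l ^ 2 * (C2 * σ * p + 4 * p ^ 2 * (4 * η + 6 * δ ^ 2)) with hE
  have g4 : (b - a) * (E + 1) ≤ (b - a) * Real.exp E :=
    mul_le_mul_of_nonneg_left (Real.add_one_le_exp E) hba
  refine le_trans ?_ g4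
  refine hmono.trans ?_
  have g5 : 0 ≤ l ^ 2 * p ^ 2 * δ ^ 2 * (b - a) := by positivity
  rw [hE]
  nlinarith
end blk

lemma cover_Icc {x : ℕ → ℝ} (K : ℕ) (hK : K ≠ 0) {z : ℝ} (h0 : x 0 ≤ z) (h1 : z ≤ x K) :
    ∃ i < K, x i ≤ z ∧ z ≤ x (i + 1) := by
  induction K with
  | zero => exact absurd rfl hK
  | succ K ih =>
    by_cases hz : x K ≤ z
    · exact ⟨K, by omega, hz, h1⟩
    · push Not at hz
      have hK0 : K ≠ 0 := by rintro rfl; linarith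
      obtain ⟨i, hi, hh⟩ := ih hK0 hz.le
      exact ⟨i, by omega, hh⟩

lemma pow_diff_mono {c d : ℝ} (hc : 1 ≤ c) (hcd : c ≤ d) {s t : ℕ} (hst : s ≤ t) :
    d ^ s - c ^ s ≤ d ^ t - c ^ t := by
  induction t, hst using Nat.le_induction with
  | base => exact le_rfl
  | succ t _ ih =>
    have h1 : c ^ t ≤ d ^ t := by gcongr
    have hd0 : 0 ≤ d := by linarith
    have h2 : 0 ≤ d ^ t := by positivity
    have h3 : 0 ≤ c ^ t := by positivity
    rw [pow_succ, pow_succ]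
    nlinarith [mul_nonneg (sub_nonneg.2 hcd) h2, mul_nonneg (sub_nonneg.2 hc) (sub_nonneg.2 h1)]

lemma strictMono_sub {s : ℕ → ℕ} (hs : StrictMono s) (n k : ℕ) : s n + k ≤ s (n + k) := by
  induction k with
  | zero => simp
  | succ k ih => have := hs (show n + k < n + (k + 1) by omega); omega

lemma Bl_osc {f V : ℝ → ℝ} {σ v : ℝ} (h : GF f V σ v) {ξ : ℝ} (hξ : 0 < ξ) {s : ℕ → ℕ}
    (hs : StrictMono s) {u p : ℕ} {c d η : ℝ} (hc : 1 ≤ c) (hcd : c ≤ d)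
    (hη : ξ * d ^ s (u + p) - ξ * c ^ s (u + p) ≤ η) {x z : ℝ} (hx : x ∈ Set.Icc c d)
    (hz : z ∈ Set.Icc c d) :
    Bl f ξ s u p z ≤ Bl f ξ s u p x + Bl (Wf V η) ξ s u p x := by
  unfold Bl
  rw [← Finset.sum_add_distrib]
  apply Finset.sum_le_sum
  intro n hn
  apply h.osc_le_W
  have hn' : s n ≤ s (u + p) := hs.monotone (Finset.mem_Ioc.1 hn).2
  have h1 := mul_le_mul_of_nonneg_left (pow_diff_mono hc hcd hn') hξ.le
  have hc0 : 0 ≤ c := by linarith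
  have hx0 : 0 ≤ x := hc0.trans hx.1
  have hz0 : 0 ≤ z := hc0.trans hz.1
  have a1 : c ^ s n ≤ x ^ s n := pow_le_pow_left₀ hc0 hx.1 _
  have a2 : c ^ s n ≤ z ^ s n := pow_le_pow_left₀ hc0 hz.1 _
  have a3 : x ^ s n ≤ d ^ s n := pow_le_pow_left₀ hx0 hx.2 _
  have a4 : z ^ s n ≤ d ^ s n := pow_le_pow_left₀ hz0 hz.2 _
  have b1 := mul_le_mul_of_nonneg_left a1 hξ.le
  have b2 := mul_le_mul_of_nonneg_left a2 hξ.le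
  have b3 := mul_le_mul_of_nonneg_left a3 hξ.le
  have b4 := mul_le_mul_of_nonneg_left a4 hξ.le
  rw [abs_le]; constructor <;> linarith

lemma max_ineq_rec {f V : ℝ → ℝ} {σ v : ℝ} {ξ A β δ : ℝ} {s : ℕ → ℕ}
    (h : GF f V σ v) (hξ : 0 < ξ) (hA : 1 ≤ A) (hβ : 1 < β) (hβA : β ^ 4 ≤ A)
    (hδ : 0 < δ) (hδ1 : δ ≤ 1) (hσ : 0 < σ) (hδσ : 4 * δ ^ 2 ≤ σ ^ 2)
    (hs : StrictMono s) {p : ℕ} (hp : 1 ≤ p) (hpδ : p * δ ≤ 1)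
    {η l : ℝ} (hη : 0 < η) (hη1 : η ≤ 1) (hl : 0 ≤ l) (hlp : 6 * l * p ≤ 1)
    (hstep : 2 * (1 + 1 / ξ) ≤ δ ^ 2 * η * A ^ p) {E : ℝ} (hE0 : 0 ≤ E)
    (hE : E = l * p * (4 * η + 6 * δ ^ 2) +
        2 * l ^ 2 * (6 * (1 + 1 / ξ) * (2 / (1 - β⁻¹) + 1) * σ * p + 4 * p ^ 2 * (4 * η + 6 * δ ^ 2)))
    (k : ℕ) : ∀ (u : ℕ) (a b y : ℝ), A ≤ a → a ≤ b →
      (∀ n, u < n → 1 ≤ s n ∧ 1 ≤ δ ^ 2 * (b - a) * Dv ξ (s n) a) →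
      volume {x ∈ Set.Icc a b | ∃ k' ≤ k, y ≤ ∑ j ∈ Finset.range k', Bl f ξ s (u + 2 * p * j) p x} ≤
        ENNReal.ofReal ((b - a) * Real.exp (-l * y) * Real.exp E ^ k) := by
  have hR1 : 1 ≤ Real.exp E := Real.one_le_exp hE0
  have htriv : ∀ (k u : ℕ) (a b y : ℝ), a ≤ b → y ≤ 0 → 
      volume {x ∈ Set.Icc a b | ∃ k' ≤ k, y ≤ ∑ j ∈ Finset.range k', Bl f ξ s (u + 2 * p * j) p x} ≤
        ENNReal.ofReal ((b - a) * Real.exp (-l * y) * Real.exp E ^ k) := by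
    intro k u a b y hab hy
    calc _ ≤ volume (Set.Icc a b) := measure_mono fun x hx => hx.1
      _ = ENNReal.ofReal (b - a) := Real.volume_Icc
      _ ≤ _ := by
        apply ENNReal.ofReal_le_ofReal
        have h1 : 1 ≤ Real.exp (-l * y) := Real.one_le_exp (by nlinarith)
        have h2 : 1 ≤ Real.exp E ^ k := one_le_pow₀ hR1
        have h3 : 0 ≤ b - a := by linarith
        calc b - a = (b - a) * 1 * 1 := by ring
          _ ≤ _ := by gcongr
  induction k with
  | zero =>
    intro u a b y ha hab hI
    by_cases hy : y ≤ 0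
    · exact htriv 0 u a b y hab hy
    · have : {x ∈ Set.Icc a b | ∃ k' ≤ 0, y ≤ ∑ j ∈ Finset.range k', Bl f ξ s (u + 2 * p * j) p x} = ∅ := by
        ext x
        simp only [Set.mem_setOf_eq, Set.mem_empty_iff_false, iff_false, not_and]
        rintro _ ⟨k', hk', hh⟩
        obtain rfl : k' = 0 := by omega
        simp at hh; exact hy hh
      rw [this]; simp
  | succ k ih =>
    intro u a b y ha hab hI
    by_cases hy : y ≤ 0
    · exact htriv (k+1) u a b y hab hy
    push Not at hy
    have ha0 : 0 < a := by linarith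
    have hlast := hI (u + p) (by omega)
    have hba : 0 ≤ b - a := by linarith
    have hL : η ≤ ξ * b ^ s (u + p) - ξ * a ^ s (u + p) := by
      have h1 := phi_sub_ge hξ hlast.1 ha0.le hab
      have h2 := hlast.2
      have h3 : δ ^ 2 ≤ 1 := pow_le_one₀ hδ.le hδ1
      have h4 : 0 ≤ Dv ξ (s (u + p)) a * (b - a) := mul_nonneg (Dv_pos hξ hlast.1 ha0).le hba
      nlinarith
    obtain ⟨K, x, hxm, hx0, hxK, hx⟩ := partition hξ hlast.1 ha0 hab hη hL
    have hK0 : K ≠ 0 := by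
      rintro rfl
      rw [hx0] at hxK
      rw [hxK] at hL; linarith
    have hxa : ∀ i, a ≤ x i := fun i => hx0 ▸ hxm (Nat.zero_le i)
    set X := Bl f ξ s u p with hX
    set W := Bl (Wf V η) ξ s u p with hW
    have hfm := h.meas
    have hWm := h.W_meas η
    have hWb : ∀ y, |Wf V η y| ≤ 4 := fun x => by
      rw [abs_of_nonneg (h.W_nonneg hη.le _)]; exact h.W_le hη1 _
    have hXm : Measurable X := Bl_meas hfm ξ s u p
    have hWM : Measurable W := Bl_meas hWm ξ s u p
    have hXb : ∀ x, |X x| ≤ p * 2 := Bl_abs h.bd ξ s u p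
    have hWb' : ∀ x, |W x| ≤ p * 4 := Bl_abs hWb ξ s u p
    have hexpi : ∀ c d, IntervalIntegrable (fun z => Real.exp (l * (X z + W z))) volume c d := by
      intro c d
      refine ii_of_bdd (G := Real.exp 1) (by fun_prop) (fun x => ?_) c d
      rw [abs_of_pos (Real.exp_pos _)]
      apply Real.exp_le_exp.2
      have h1 := abs_le.1 (hXb x)
      have h2 := abs_le.1 (hWb' x)
      nlinarith
    set S : ℕ → ℝ := fun i => sSup (X '' Set.Icc (x i) (x (i + 1))) with hS
    have hbddS : ∀ i, BddAbove (X '' Set.Icc (x i) (x (i + 1))) := by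
      rintro i
      refine ⟨p * 2, ?_⟩
      rintro _ ⟨z, _, rfl⟩
      exact (abs_le.1 (hXb z)).2
    have hXS : ∀ i, ∀ z ∈ Set.Icc (x i) (x (i + 1)), X z ≤ S i := fun i z hz =>
      le_csSup (hbddS i) ⟨z, hz, rfl⟩
    have hSX : ∀ i < K, ∀ z ∈ Set.Icc (x i) (x (i + 1)), S i ≤ X z + W z := by
      intro i hi z hz
      apply csSup_le (Set.Nonempty.image _ ⟨z, hz⟩)
      rintro _ ⟨w, hw, rfl⟩
      exact Bl_osc h hξ hs (by linarith [hxa i]) (hxm (Nat.le_succ i)) (hx i hi).2 hz hw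
    have hSint : ∀ i < K, (x (i + 1) - x i) * Real.exp (l * S i) ≤
        ∫ z in (x i)..(x (i + 1)), Real.exp (l * (X z + W z)) := by
      intro i hi
      have hle := hxm (Nat.le_succ i)
      have := intervalIntegral.integral_mono_on (μ := volume) (f := fun _ => Real.exp (l * S i)) hle
        intervalIntegrable_const (hexpi _ _) (fun z hz => Real.exp_le_exp.2
          (mul_le_mul_of_nonneg_left (hSX i hi z hz) hl))
      rwa [intervalIntegral.integral_const, smul_eq_mul] at this
    set T : ℕ → Set ℝ := fun i => {z ∈ Set.Icc (x i) (x (i + 1)) | ∃ k' ≤ k, y - S i ≤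
      ∑ j ∈ Finset.range k', Bl f ξ s ((u + 2 * p) + 2 * p * j) p z} with hT
    have hTv : ∀ i < K, volume (T i) ≤ ENNReal.ofReal ((x (i + 1) - x i) *
        Real.exp (-l * (y - S i)) * Real.exp E ^ k) := by
      intro i hi
      have hle := hxm (Nat.le_succ i)
      apply ih (u + 2 * p) (x i) (x (i + 1)) (y - S i) (ha.trans (hxa i)) hle
      intro n hn
      refine ⟨(hI n (by omega)).1, ?_⟩
      have hc1 : 1 ≤ x i := by linarith [hxa i]
      have g1 := piece hξ hlast.1 hc1 hle hη1 (hx i hi).1 (hx i hi).2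
      have hss : s (u + p) + p ≤ s n := (strictMono_sub hs (u + p) p).trans (hs.monotone (by omega))
      have g2 := Dv_mono hξ hlast.1 (show s (u + p) ≤ s n by omega) hA (ha.trans (hxa i))
      have g3 : A ^ p ≤ A ^ (s n - s (u + p)) := pow_le_pow_right₀ hA (by omega)
      have hD := Dv_pos hξ hlast.1 (show 0 < x i by linarith)
      set D := Dv ξ (s (u + p)) (x i) with hDd
      have g4 : A ^ p * D ≤ Dv ξ (s n) (x i) := (mul_le_mul_of_nonneg_right g3 hD.le).trans g2
      set κ := 1 + 1 / ξ with hκ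
      have hκ0 : 0 < κ := by positivity
      have hdc : 0 ≤ x (i + 1) - x i := by linarith
      have g5 : δ ^ 2 * (x (i + 1) - x i) * (A ^ p * D) ≤ δ ^ 2 * (x (i + 1) - x i) * Dv ξ (s n) (x i) :=
        mul_le_mul_of_nonneg_left g4 (by positivity)
      refine le_trans ?_ g5
      have g6 : δ ^ 2 * A ^ p * (η / 2) ≤ δ ^ 2 * A ^ p * (κ * D * (x (i + 1) - x i)) :=
        mul_le_mul_of_nonneg_left g1 (by positivity)
      have g7 : κ * 1 ≤ κ * (δ ^ 2 * (x (i + 1) - x i) * (A ^ p * D)) := by linarith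
      exact le_of_mul_le_mul_left g7 hκ0
    have hsub : {z ∈ Set.Icc a b | ∃ k' ≤ k + 1, y ≤
        ∑ j ∈ Finset.range k', Bl f ξ s (u + 2 * p * j) p z} ⊆ ⋃ i ∈ Finset.range K, T i := by
      rintro z ⟨hz, k', hk', hh⟩
      obtain ⟨i, hi, hzi⟩ := cover_Icc (x := x) K hK0 (hx0 ▸ hz.1) (hxK ▸ hz.2)
      simp only [Set.mem_iUnion, Finset.mem_range]
      refine ⟨i, hi, hzi, ?_⟩
      cases k' with
      | zero => simp at hh; linarith
      | succ k' =>
        refine ⟨k', by omega, ?_⟩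
        rw [Finset.sum_range_succ'] at hh
        have h1 := hXS i z hzi
        have h2 : ∑ j ∈ Finset.range k', Bl f ξ s (u + 2 * p * (j + 1)) p z =
            ∑ j ∈ Finset.range k', Bl f ξ s ((u + 2 * p) + 2 * p * j) p z := by
          apply Finset.sum_congr rfl; intro j _; congr 1; ring
        rw [h2, Nat.mul_zero, Nat.add_zero] at hh
        linarith
    have hm := mgf h hξ hA hβ hβA hδ hδ1 hσ hδσ ha hab hs hpδ
      (fun n hn => hI n (Finset.mem_Ioc.1 hn).1) hη.le hη1 hl hlp
    rw [← hE, ← hX, ← hW] at hm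
    have hsumint : ∑ i ∈ Finset.range K, ∫ z in (x i)..(x (i + 1)), Real.exp (l * (X z + W z)) =
        ∫ z in a..b, Real.exp (l * (X z + W z)) := by
      rw [intervalIntegral.sum_integral_adjacent_intervals (fun i _ => hexpi _ _), hx0, hxK]
    calc _ ≤ volume (⋃ i ∈ Finset.range K, T i) := measure_mono hsub
      _ ≤ ∑ i ∈ Finset.range K, volume (T i) := measure_biUnion_finset_le _ _
      _ ≤ ∑ i ∈ Finset.range K, ENNReal.ofReal (Real.exp (-l * y) * Real.exp E ^ k *
          ∫ z in (x i)..(x (i + 1)), Real.exp (l * (X z + W z))) := by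
        apply Finset.sum_le_sum
        intro i hi
        have hi := Finset.mem_range.1 hi
        refine (hTv i hi).trans (ENNReal.ofReal_le_ofReal ?_)
        calc _ = Real.exp (-l * y) * Real.exp E ^ k * ((x (i + 1) - x i) * Real.exp (l * S i)) := by
              rw [show -l * (y - S i) = -l * y + l * S i by ring, Real.exp_add]; ring
          _ ≤ _ := mul_le_mul_of_nonneg_left (hSint i hi) (by positivity)
      _ = ENNReal.ofReal (Real.exp (-l * y) * Real.exp E ^ k *
          ∫ z in a..b, Real.exp (l * (X z + W z))) := by
        rw [← ENNReal.ofReal_sum_of_nonneg, ← Finset.mul_sum, hsumint]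
        intro i hi
        have := hSint i (Finset.mem_range.1 hi)
        have hle := hxm (Nat.le_succ i)
        have h0 : 0 ≤ (x (i + 1) - x i) * Real.exp (l * S i) :=
          mul_nonneg (by simpa using hle) (Real.exp_pos _).le
        exact mul_nonneg (by positivity) (h0.trans this)
      _ ≤ _ := by
        apply ENNReal.ofReal_le_ofReal
        calc _ ≤ Real.exp (-l * y) * Real.exp E ^ k * ((b - a) * Real.exp E) :=
              mul_le_mul_of_nonneg_left hm (by positivity)
          _ = _ := by ring

lemma decomp_blocks (F : ℕ → ℝ) (p q : ℕ) :
    ∑ n ∈ Finset.Ioc 0 (p * (q + 1)), F n = ∑ n ∈ Finset.Ioc 0 p, F n +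
      ∑ j ∈ Finset.range ((q + 1) / 2), ∑ n ∈ Finset.Ioc (p + 2 * p * j) (p + 2 * p * j + p), F n +
      ∑ j ∈ Finset.range (q / 2),
        ∑ n ∈ Finset.Ioc (2 * p + 2 * p * j) (2 * p + 2 * p * j + p), F n := by
  induction q with
  | zero => simp
  | succ q ih =>
    have hsplit : ∑ n ∈ Finset.Ioc 0 (p * (q + 1 + 1)), F n = ∑ n ∈ Finset.Ioc 0 (p * (q + 1)), F n +
        ∑ n ∈ Finset.Ioc (p * (q + 1)) (p * (q + 1) + p), F n := by
      rw [Finset.sum_Ioc_consecutive _ (Nat.zero_le _) (Nat.le_add_right _ _)]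
      congr 1
    rw [hsplit, ih]
    rcases Nat.even_or_odd' q with ⟨r, rfl | rfl⟩
    · rw [show (2 * r + 1) / 2 = r by omega, show (2 * r + 1 + 1) / 2 = r + 1 by omega,
        show 2 * r / 2 = r by omega, Finset.sum_range_succ _ r,
        show p * (2 * r + 1) = p + 2 * p * r by ring]
      ring
    · rw [show (2 * r + 1 + 1) / 2 = r + 1 by omega, show (2 * r + 1) / 2 = r by omega,
        show (2 * r + 1 + 1 + 1) / 2 = r + 1 by omega, 
        Finset.sum_range_succ (fun j => ∑ n ∈ Finset.Ioc (2 * p + 2 * p * j) (2 * p + 2 * p * j + p), F n) r,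
        show p * (2 * r + 1 + 1) = 2 * p + 2 * p * r by ring]
      ring

lemma sum_Ioc_bd {F : ℕ → ℝ} (hF : ∀ n, |F n| ≤ 2) {u v p : ℕ} (h : v ≤ u + p) :
    |∑ n ∈ Finset.Ioc u v, F n| ≤ 2 * p := by
  refine (Finset.abs_sum_le_sum_abs _ _).trans ((Finset.sum_le_sum fun n _ => hF n).trans ?_)
  rw [Finset.sum_const, Nat.card_Ioc, nsmul_eq_mul]
  have : ((v - u : ℕ) : ℝ) ≤ p := by exact_mod_cast (by omega : v - u ≤ p)
  linarith

lemma decomp {F : ℕ → ℝ} (hF : ∀ n, |F n| ≤ 2) {p : ℕ} (hp : 1 ≤ p) {N M : ℕ} (hM : M ≤ N) :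
    ∃ k0 ≤ N / p, ∃ k1 ≤ N / p, |∑ n ∈ Finset.Icc 1 M, F n| ≤ 4 * p +
      |∑ j ∈ Finset.range k0, ∑ n ∈ Finset.Ioc (p + 2 * p * j) (p + 2 * p * j + p), F n| +
      |∑ j ∈ Finset.range k1,
        ∑ n ∈ Finset.Ioc (2 * p + 2 * p * j) (2 * p + 2 * p * j + p), F n| := by
  have e : Finset.Icc 1 M = Finset.Ioc 0 M := by ext; simp [Nat.lt_iff_add_one_le]
  rw [e]
  by_cases hMp : M < p
  · refine ⟨0, Nat.zero_le _, 0, Nat.zero_le _, ?_⟩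
    have := sum_Ioc_bd hF (u := 0) (v := M) (p := p) (by omega)
    have hp0 : (0:ℝ) ≤ p := Nat.cast_nonneg p
    simp only [Finset.range_zero, Finset.sum_empty, abs_zero]; linarith
  push Not at hMp
  have hq1 : 1 ≤ M / p := (Nat.le_div_iff_mul_le (by omega)).2 (by omega)
  obtain ⟨q, hq⟩ := Nat.exists_eq_add_of_le' hq1
  have hqN : q + 1 ≤ N / p := hq ▸ Nat.div_le_div_right hM
  have hdm := Nat.div_add_mod M p
  have hml := Nat.mod_lt M (show 0 < p by omega)
  rw [hq] at hdm
  refine ⟨(q + 1) / 2, by omega, q / 2, by omega, ?_⟩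
  have hsplit : ∑ n ∈ Finset.Ioc 0 M, F n = ∑ n ∈ Finset.Ioc 0 (p * (q + 1)), F n +
      ∑ n ∈ Finset.Ioc (p * (q + 1)) M, F n := 
    (Finset.sum_Ioc_consecutive _ (Nat.zero_le _) (by omega)).symm
  rw [hsplit, decomp_blocks]
  have h1 := sum_Ioc_bd hF (u := 0) (v := p) (p := p) (by omega)
  have h2 := sum_Ioc_bd hF (u := p * (q + 1)) (v := M) (p := p) (by omega)
  set a := ∑ n ∈ Finset.Ioc 0 p, F n
  set b := ∑ n ∈ Finset.Ioc (p * (q + 1)) M, F n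
  set Y0 := ∑ j ∈ Finset.range ((q + 1) / 2), ∑ n ∈ Finset.Ioc (p + 2 * p * j) (p + 2 * p * j + p), F n
  set Y1 := ∑ j ∈ Finset.range (q / 2), ∑ n ∈ Finset.Ioc (2 * p + 2 * p * j) (2 * p + 2 * p * j + p), F n
  have t1 := abs_add_le (a + Y0 + Y1) b
  have t2 := abs_add_le (a + Y0) Y1
  have t3 := abs_add_le a Y0
  linarith

lemma Bl_neg (f : ℝ → ℝ) (ξ : ℝ) (s : ℕ → ℕ) (u p : ℕ) (x : ℝ) :
    Bl (fun y => - f y) ξ s u p x = - Bl f ξ s u p x := by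
  unfold Bl; rw [Finset.sum_neg_distrib]

lemma max_ineq {f V : ℝ → ℝ} {σ v : ℝ} {ξ A B β δ : ℝ} {s : ℕ → ℕ} (hAB : B - A = 1)
    (h : GF f V σ v) (hξ : 0 < ξ) (hA : 1 ≤ A) (hβ : 1 < β) (hβA : β ^ 4 ≤ A)
    (hδ : 0 < δ) (hδ1 : δ ≤ 1) (hσ : 0 < σ) (hδσ : 4 * δ ^ 2 ≤ σ ^ 2)
    (hs : StrictMono s) {p : ℕ} (hp : 1 ≤ p) (hpδ : p * δ ≤ 1)
    {η l : ℝ} (hη : 0 < η) (hη1 : η ≤ 1) (hl : 0 ≤ l) (hlp : 6 * l * p ≤ 1)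
    (hstep : 2 * (1 + 1 / ξ) ≤ δ ^ 2 * η * A ^ p) (hinit : 1 ≤ δ ^ 2 * ξ * A ^ p)
    {E : ℝ} (hE0 : 0 ≤ E)
    (hE : E = l * p * (4 * η + 6 * δ ^ 2) +
        2 * l ^ 2 * (6 * (1 + 1 / ξ) * (2 / (1 - β⁻¹) + 1) * σ * p + 4 * p ^ 2 * (4 * η + 6 * δ ^ 2)))
    (N : ℕ) (t : ℝ) :
    volume {x ∈ Set.Icc A B | ∃ M : ℕ, 1 ≤ M ∧ M ≤ N ∧ t ≤ |∑ n ∈ Finset.Icc 1 M, f (ξ * x ^ s n)|} ≤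
      ENNReal.ofReal (4 * (Real.exp (-l * (t / 2 - 2 * p)) * Real.exp E ^ (N / p))) := by
  set y := t / 2 - 2 * p with hy
  set R := Real.exp (-l * y) * Real.exp E ^ (N / p) with hR
  have hR0 : 0 ≤ R := by positivity
  have hI : ∀ n, p < n → 1 ≤ s n ∧ 1 ≤ δ ^ 2 * (B - A) * Dv ξ (s n) A := by
    intro n hn
    have hsn : n ≤ s n := hs.le_apply
    refine ⟨by omega, ?_⟩
    rw [hAB, mul_one]
    refine hinit.trans ?_
    unfold Dv
    have h1 : (1:ℝ) ≤ s n := by exact_mod_cast (by omega : 1 ≤ s n)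
    have h2 : A ^ p ≤ A ^ (s n - 1) := pow_le_pow_right₀ hA (by omega)
    calc δ ^ 2 * ξ * A ^ p = δ ^ 2 * (ξ * 1 * A ^ p) := by ring
      _ ≤ _ := by gcongr
  have key : ∀ (g : ℝ → ℝ), GF g V σ v → ∀ u, p ≤ u →
      volume {x ∈ Set.Icc A B | ∃ k' ≤ N / p, y ≤ ∑ j ∈ Finset.range k', Bl g ξ s (u + 2 * p * j) p x} ≤
        ENNReal.ofReal R := by
    intro g hg u hu
    have := max_ineq_rec hg hξ hA hβ hβA hδ hδ1 hσ hδσ hs hp hpδ hη hη1 hl hlp hstep hE0 hE (N / p)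
      u A B y le_rfl (by linarith) (fun n hn => hI n (by omega))
    rwa [hAB, one_mul] at this
  set T : (ℝ → ℝ) → ℕ → Set ℝ := fun g u =>
    {x ∈ Set.Icc A B | ∃ k' ≤ N / p, y ≤ ∑ j ∈ Finset.range k', Bl g ξ s (u + 2 * p * j) p x} with hT
  have hsub : {x ∈ Set.Icc A B | ∃ M : ℕ, 1 ≤ M ∧ M ≤ N ∧
      t ≤ |∑ n ∈ Finset.Icc 1 M, f (ξ * x ^ s n)|} ⊆
      (T f p ∪ T (fun z => - f z) p) ∪ (T f (2 * p) ∪ T (fun z => - f z) (2 * p)) := by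
    rintro x ⟨hx, M, _, hM, hh⟩
    obtain ⟨k0, hk0, k1, hk1, hd⟩ := decomp (F := fun n => f (ξ * x ^ s n)) (fun n => h.bd _) hp hM
    have hor : ∀ u k, k ≤ N / p → y ≤ |∑ j ∈ Finset.range k, Bl f ξ s (u + 2 * p * j) p x| →
        x ∈ T f u ∪ T (fun z => - f z) u := by
      intro u k hk hle
      rcases le_abs.1 hle with h1 | h1
      · exact Or.inl ⟨hx, k, hk, h1⟩
      · refine Or.inr ⟨hx, k, hk, ?_⟩
        simp only [Bl_neg, Finset.sum_neg_distrib]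
        exact h1
    by_cases h0 : y ≤ |∑ j ∈ Finset.range k0, Bl f ξ s (p + 2 * p * j) p x|
    · exact Or.inl (hor _ _ hk0 h0)
    · refine Or.inr (hor _ _ hk1 ?_)
      push Not at h0
      unfold Bl at h0 ⊢
      linarith
  have e4 : ENNReal.ofReal (4 * R) = (ENNReal.ofReal R + ENNReal.ofReal R) +
      (ENNReal.ofReal R + ENNReal.ofReal R) := by
    rw [← ENNReal.ofReal_add hR0 hR0, ← ENNReal.ofReal_add (by linarith) (by linarith)]
    congr 1; ring
  rw [e4]
  refine (measure_mono hsub).trans ((measure_union_le _ _).trans ?_)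
  exact add_le_add
    ((measure_union_le _ _).trans (add_le_add (key f h p le_rfl) (key _ h.neg p le_rfl)))
    ((measure_union_le _ _).trans (add_le_add (key f h _ (by omega)) (key _ h.neg _ (by omega))))

set_option maxHeartbeats 1000000 in
lemma core {f V : ℝ → ℝ} {σ v : ℝ} {ξ A B β C2 : ℝ} {s : ℕ → ℕ} (hAB : B - A = 1)
    (h : GF f V σ v) (hξ : 0 < ξ) (hA : 1 ≤ A) (hβ : 1 < β) (hβA : β ^ 4 ≤ A)
    (hC2 : C2 = 6 * (1 + 1 / ξ) * (2 / (1 - β⁻¹) + 1))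
    (hs : StrictMono s) {p N : ℕ} (hp : 1 ≤ p) {w τ S γ : ℝ} (hw : 4 ≤ w) (hN : (N : ℝ) = w ^ 16)
    (hw1 : 2 * (1 + 1 / ξ) ≤ w) (hAp : (w ^ 16) ^ 4 ≤ A ^ p) (hS : 1 ≤ S)
    (hpS : 48 * S * p ≤ w) (hτ : 0 < τ) (hστ : σ = τ ^ 4) (hτw : 1 ≤ 2 * τ * w)
    (hγ : 1 ≤ γ) (hγw : γ ≤ w ^ 4) :
    volume {x ∈ Set.Icc A B | ∃ M : ℕ, 1 ≤ M ∧ M ≤ N ∧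
      84 * γ * (1 + C2) * τ * (w ^ 8 * S) ≤ |∑ n ∈ Finset.Icc 1 M, f (ξ * x ^ s n)|} ≤
      ENNReal.ofReal (4 * Real.exp 5 * Real.exp (-(γ * τ⁻¹ ^ 2 * S ^ 2))) := by
  have hw0 : 0 < w := by linarith
  have hp1 : (1:ℝ) ≤ p := by exact_mod_cast hp
  have hp0 : (0:ℝ) < p := by linarith
  have hq1 : β⁻¹ < 1 := inv_lt_one_of_one_lt₀ hβ
  have hC20 : 0 ≤ C2 := by
    rw [hC2]
    have : 0 < 1 - β⁻¹ := by linarith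
    positivity
  have hw16 : w ≤ w ^ 16 := le_self_pow₀ (by linarith) (by norm_num)
  have hσ : 0 < σ := by rw [hστ]; positivity
  set δ := (w ^ 16)⁻¹ with hδd
  have hδ : 0 < δ := by positivity
  have hδN : δ * w ^ 16 = 1 := inv_mul_cancel₀ (by positivity)
  have hδ1 : δ ≤ 1 := inv_le_one_of_one_le₀ (by linarith)
  have hδσ : 4 * δ ^ 2 ≤ σ ^ 2 := by
    have h1 : δ ≤ τ ^ 4 / 2 := by
      rw [hδd, inv_le_iff_one_le_mul₀ (by positivity)]
      have h2 : 1 ≤ (2 * τ * w) ^ 4 := one_le_pow₀ hτw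
      have h3 : (4:ℝ) ^ 12 ≤ w ^ 12 := by gcongr
      have h4 : 0 < τ ^ 4 * w ^ 4 := by positivity
      have h5 := mul_le_mul_of_nonneg_left h3 h4.le
      have h6 : (2 * τ * w) ^ 4 = 16 * (τ ^ 4 * w ^ 4) := by ring
      have h7 : τ ^ 4 / 2 * w ^ 16 = (τ ^ 4 * w ^ 4) * w ^ 12 / 2 := by ring
      rw [h7]; rw [h6] at h2
      norm_num at h5
      linarith
    rw [hστ]
    nlinarith
  have hpw : (p:ℝ) ≤ w := by nlinarith
  have hpδ : p * δ ≤ 1 := by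
    calc p * δ ≤ w ^ 16 * δ := by gcongr; linarith
      _ = 1 := by rw [mul_comm]; exact hδN
  set l := γ * τ⁻¹ ^ 3 * S / w ^ 8 with hld
  have hl : 0 ≤ l := by positivity
  have hτi : τ⁻¹ ≤ 2 * w := by
    rw [inv_le_iff_one_le_mul₀ hτ]; linarith
  have hlp : 6 * l * p ≤ 1 := by
    have h1 : l ≤ w ^ 4 * (2 * w) ^ 3 * S / w ^ 8 := by rw [hld]; gcongr
    have h2 : w ^ 4 * (2 * w) ^ 3 * S / w ^ 8 = 8 * S / w := by field_simp; norm_num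
    rw [h2] at h1
    calc 6 * l * p ≤ 6 * (8 * S / w) * p := by gcongr
      _ = 48 * S * p / w := by ring
      _ ≤ 1 := by rw [div_le_one hw0]; exact hpS
  have hA4 : δ ^ 3 * (w ^ 16) ^ 4 = w ^ 16 := by
    calc _ = (δ * w ^ 16) ^ 3 * w ^ 16 := by ring
      _ = _ := by rw [hδN]; ring
  have hbase : w ≤ δ ^ 2 * δ * A ^ p := by
    calc w ≤ δ ^ 3 * (w ^ 16) ^ 4 := by rw [hA4]; exact hw16
      _ ≤ δ ^ 3 * A ^ p := by gcongr
      _ = _ := by ring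
  have hstep : 2 * (1 + 1 / ξ) ≤ δ ^ 2 * δ * A ^ p := hw1.trans hbase
  have hinit : 1 ≤ δ ^ 2 * ξ * A ^ p := by
    have h1 : w ≤ δ ^ 2 * A ^ p := by
      refine hbase.trans ?_
      have : 0 ≤ δ ^ 2 * A ^ p := by positivity
      nlinarith
    have h2 : 1 / ξ ≤ w := by
      have : 0 < 1 / ξ := by positivity
      linarith
    have h3 : 1 ≤ w * ξ := by rwa [div_le_iff₀ hξ] at h2
    calc 1 ≤ w * ξ := h3
      _ ≤ (δ ^ 2 * A ^ p) * ξ := by gcongr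
      _ = _ := by ring
  set E := l * p * (4 * δ + 6 * δ ^ 2) + 2 * l ^ 2 * (C2 * σ * p + 4 * p ^ 2 * (4 * δ + 6 * δ ^ 2)) with hE
  have hE0 : 0 ≤ E := by positivity
  have hm := max_ineq (N := N) (t := 84 * γ * (1 + C2) * τ * (w ^ 8 * S)) hAB h hξ hA hβ hβA hδ hδ1
    hσ hδσ hs hp hpδ hδ hδ1 hl hlp hstep hinit hE0 (by rw [hE, hC2])
  refine hm.trans (ENNReal.ofReal_le_ofReal ?_)
  rw [← Real.exp_nat_mul, ← Real.exp_add, mul_assoc 4 (Real.exp 5), ← Real.exp_add]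
  apply mul_le_mul_of_nonneg_left _ (by norm_num)
  apply Real.exp_le_exp.2
  -- block count
  set k := N / p with hk
  have hkp : (k:ℝ) * p ≤ w ^ 16 := by rw [← hN]; exact_mod_cast Nat.div_mul_le_self N p
  have hk0 : (0:ℝ) ≤ k := Nat.cast_nonneg k
  set G := γ ^ 2 * τ⁻¹ ^ 2 * S ^ 2 with hG
  have hlt : l * (84 * γ * (1 + C2) * τ * (w ^ 8 * S)) = 84 * (1 + C2) * G := by
    rw [hld, hG]; field_simp
  have hl2 : l ^ 2 * σ * w ^ 16 = G := by
    rw [hld, hG, hστ]; field_simp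
  have hlp6 : l * p ≤ 1 / 6 := by linarith
  have hl6 : l ≤ 1 / 6 := (le_mul_of_one_le_right hl hp1).trans hlp6
  have hlp0 : 0 ≤ l * p := by positivity
  have h10 : (4 * δ + 6 * δ ^ 2) ≤ 10 * δ := by nlinarith
  have h11 : w ^ 16 * (4 * δ + 6 * δ ^ 2) ≤ 10 := by
    calc _ ≤ w ^ 16 * (10 * δ) := by gcongr
      _ = 10 * (δ * w ^ 16) := by ring
      _ = 10 := by rw [hδN]; ring
  have hZ0 : 0 ≤ 4 * δ + 6 * δ ^ 2 := by positivity
  set Z := 4 * δ + 6 * δ ^ 2 with hZ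
  have hkpZ : k * p * Z ≤ 10 := (mul_le_mul_of_nonneg_right hkp hZ0).trans h11
  have hkpZ0 : 0 ≤ k * p * Z := by positivity
  have hkE : k * E = l * (k * p * Z) + 2 * C2 * (l ^ 2 * σ * (k * p)) + 8 * l * (l * p) * (k * p * Z) := by
    rw [hE]; ring
  have a1 : l * (k * p * Z) ≤ 1 / 6 * 10 := by gcongr
  have a2 : 2 * C2 * (l ^ 2 * σ * (k * p)) ≤ 2 * C2 * G := by
    rw [← hl2]; gcongr
  have a3 : 8 * l * (l * p) * (k * p * Z) ≤ 8 * (1 / 6) * (1 / 6) * 10 := by gcongr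
  have hGG : γ * τ⁻¹ ^ 2 * S ^ 2 ≤ G := by
    rw [hG]
    have : γ ≤ γ ^ 2 := by nlinarith
    gcongr
  have hG0 : 0 ≤ G := by positivity
  have hCG : 0 ≤ C2 * G := by positivity
  rw [hkE]
  have e1 : -l * (84 * γ * (1 + C2) * τ * (w ^ 8 * S) / 2 - 2 * p) =
      -(l * (84 * γ * (1 + C2) * τ * (w ^ 8 * S))) / 2 + 2 * (l * p) := by ring
  rw [e1, hlt]
  linarith

lemma plog_one_le (x : ℝ) : 1 ≤ plog x := le_max_left _ _

lemma plog_le_self {x : ℝ} (hx : 1 ≤ x) : plog x ≤ x :=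
  max_le hx ((Real.log_le_sub_one_of_pos (by linarith)).trans (by linarith))

lemma plog_two_pow {m : ℕ} (hm : 1 ≤ m) : plog ((2:ℝ) ^ m) ≤ m := by
  have h1 : (1:ℝ) ≤ m := by exact_mod_cast hm
  refine max_le h1 ?_
  rw [Real.log_pow]
  have := Real.log_two_lt_d9
  nlinarith

set_option maxHeartbeats 2000000 in
theorem stmt10_aux (ξ A B : ℝ) (hξ : 0 < ξ) (hA : 1 < A) (hAB : B - A = 1) :
    ∃ (c C : ℝ) (m₀ : ℕ), 1 ≤ c ∧ 0 < C ∧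
      ∀ m : ℕ, m₀ ≤ m →
      ∀ s : ℕ → ℕ, StrictMono s → (∀ n, 1 ≤ n → 1 ≤ s n) →
      ∀ f : ℝ → ℝ, (∀ x : ℝ, f (x + 1) = f x) → (∫ x in (0:ℝ)..1, f x) = 0 →
        eVariationOn f (Set.Icc (0:ℝ) 1) ≤ 2 →
        (2 : ℝ) ^ (-(m : ℝ) / 4) / Real.sqrt 2 ≤ fnorm A B f →
      ∀ γ : ℝ, 1 ≤ γ →
        (volume {x ∈ Set.Icc A B | ∃ M : ℕ, 1 ≤ M ∧ M ≤ 2 ^ m ∧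
            84 * γ * c * fnorm A B f ^ ((1:ℝ)/4) *
                Real.sqrt ((2 : ℝ) ^ m * plog (plog ((2 : ℝ) ^ m))) ≤
              |∑ n ∈ Finset.Icc 1 M, f (ξ * x ^ s n)|}).toReal ≤
          C * (Real.exp (-γ * fnorm A B f ^ (-(1/2) : ℝ) * plog (plog ((2 : ℝ) ^ m)))
              + (2 : ℝ) ^ (-(3 * m : ℤ))) := by
  obtain ⟨K, hK⟩ := pow_unbounded_of_one_lt 16 hA
  have hK1 : 1 ≤ K := by
    by_contra hc
    obtain rfl : K = 0 := by omega
    norm_num at hK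
  have hA0 : 0 < A := by linarith
  set β := A ^ ((1:ℝ) / 4) with hβd
  have hβ : 1 < β := Real.one_lt_rpow hA (by norm_num)
  have hβA : β ^ 4 ≤ A := by
    rw [hβd, ← Real.rpow_natCast, ← Real.rpow_mul hA0.le]; norm_num
  set C2 := 6 * (1 + 1 / ξ) * (2 / (1 - β⁻¹) + 1) with hC2
  have hC20 : 0 ≤ C2 := by
    have hq1 : β⁻¹ < 1 := inv_lt_one_of_one_lt₀ hβ
    have : 0 < 1 - β⁻¹ := by linarith
    positivity
  set r := (2:ℝ) ^ ((1:ℝ) / 16) with hr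
  have hr1 : 1 < r := Real.one_lt_rpow (by norm_num) (by norm_num)
  have hr0 : 0 < r := by linarith
  have hr16 : r ^ 16 = 2 := by
    rw [hr, ← Real.rpow_natCast, ← Real.rpow_mul (by norm_num)]; norm_num
  set D := 48 * (K:ℝ) + 4 + 2 * (1 + 1 / ξ) with hD
  have hK0 : (1:ℝ) ≤ K := by exact_mod_cast hK1
  have hκ0 : 0 < 2 * (1 + 1 / ξ) := by positivity
  have hD0 : 0 < D := by linarith
  have hev : ∀ᶠ m : ℕ in atTop, D * (m:ℝ) ^ 2 ≤ r ^ m := by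
    have ht := tendsto_pow_const_div_const_pow_of_one_lt 2 hr1
    filter_upwards [ht.eventually (gt_mem_nhds (show (0:ℝ) < D⁻¹ by positivity))] with m hm
    rw [div_lt_iff₀ (by positivity)] at hm
    have := mul_le_mul_of_nonneg_left hm.le hD0.le
    rwa [← mul_assoc, mul_inv_cancel₀ hD0.ne', one_mul] at this
  obtain ⟨m₁, hm₁⟩ := eventually_atTop.1 hev
  refine ⟨1 + C2, 4 * Real.exp 5, max 1 m₁, by linarith, by positivity, ?_⟩
  intro m hm s hs hs1 f hper hzero hvar hnorm γ hγ
  have hm1 : 1 ≤ m := (le_max_left _ _).trans hm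
  have hmR : (1:ℝ) ≤ m := by exact_mod_cast hm1
  have hw := hm₁ m ((le_max_right _ _).trans hm)
  obtain ⟨V, v, hGF⟩ := exists_GF hper hzero hvar A B hAB
  change GF f V (fnorm A B f) v at hGF
  set σ := fnorm A B f with hσd
  set w := r ^ m with hwd
  have hw0 : 0 < w := by positivity
  have hw16 : w ^ 16 = (2:ℝ) ^ m := by rw [hwd, ← pow_mul, mul_comm, pow_mul, hr16]
  have hm2 : (1:ℝ) ≤ (m:ℝ) ^ 2 := one_le_pow₀ hmR
  have hDm : D ≤ w := by nlinarith
  have hw4 : 4 ≤ w := by linarith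
  have hw1 : 2 * (1 + 1 / ξ) ≤ w := by linarith
  have hw48 : 48 * (K:ℝ) * (m:ℝ) ^ 2 ≤ w := by
    refine le_trans ?_ hw
    gcongr
    linarith
  set L := plog (plog ((2:ℝ) ^ m)) with hL
  have hL1 : 1 ≤ L := plog_one_le _
  have hLm : L ≤ m := (plog_le_self (plog_one_le _)).trans (plog_two_pow hm1)
  set S := Real.sqrt L with hS
  have hSS : S ^ 2 = L := Real.sq_sqrt (by linarith)
  have hS1 : 1 ≤ S := Real.one_le_sqrt.2 hL1
  have hSm : S ≤ m := by nlinarith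
  have hσpos : 0 < σ := lt_of_lt_of_le (by positivity) hnorm
  set τ := σ ^ ((1:ℝ) / 4) with hτd
  have hτ : 0 < τ := by positivity
  have hτ4 : σ = τ ^ 4 := by
    rw [hτd, ← Real.rpow_natCast, ← Real.rpow_mul hσpos.le]; norm_num
  have hτ2 : σ ^ (-(1/2) : ℝ) = τ⁻¹ ^ 2 := by
    rw [hτd, inv_pow, ← Real.rpow_natCast, ← Real.rpow_mul hσpos.le, ← Real.rpow_neg hσpos.le]
    norm_num
  have hsq : Real.sqrt ((2:ℝ) ^ m * L) = w ^ 8 * S := by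
    rw [← hw16, Real.sqrt_mul (by positivity), show w ^ 16 = (w ^ 8) ^ 2 by ring,
      Real.sqrt_sq (by positivity)]
  have hw4' : (2:ℝ) ^ (-(m:ℝ) / 4) = (w ^ 4)⁻¹ := by
    rw [hwd, hr, ← pow_mul, ← Real.rpow_natCast, ← Real.rpow_mul (by norm_num),
      ← Real.rpow_neg (by norm_num)]
    congr 1; push_cast; ring
  have hτw : 1 ≤ 2 * τ * w := by
    have h2 : Real.sqrt 2 ≤ 2 := by
      rw [Real.sqrt_le_left (by norm_num)]; norm_num
    have h3 : (w ^ 4)⁻¹ / 2 ≤ τ ^ 4 := by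
      rw [← hτ4]
      refine le_trans ?_ hnorm
      rw [hw4']
      gcongr
    have h4 : 1 / 2 ≤ τ ^ 4 * w ^ 4 := by
      calc (1:ℝ) / 2 = (w ^ 4)⁻¹ / 2 * w ^ 4 := by field_simp
        _ ≤ _ := by gcongr
    by_contra hc
    push Not at hc
    have h5 : (2 * τ * w) ^ 4 ≤ 1 := pow_le_one₀ (by positivity) hc.le
    have h6 : (2 * τ * w) ^ 4 = 16 * (τ ^ 4 * w ^ 4) := by ring
    linarith
  have hAp : (w ^ 16) ^ 4 ≤ A ^ (K * m) := by
    rw [hw16, pow_mul A, ← pow_mul, mul_comm m 4, pow_mul]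
    norm_num
    exact pow_le_pow_left₀ (by norm_num) hK.le m
  have hp1 : 1 ≤ K * m := Nat.mul_pos hK1 hm1
  have hpS : 48 * S * ((K * m : ℕ) : ℝ) ≤ w := by
    refine le_trans ?_ hw48
    push_cast
    calc 48 * S * (K * m) ≤ 48 * m * (K * m) := by gcongr
      _ = _ := by ring
  have hcore := fun (γ' : ℝ) (h1 : 1 ≤ γ') (h2 : γ' ≤ w ^ 4) =>
    core (N := 2 ^ m) hAB hGF hξ hA.le hβ hβA hC2 hs hp1 hw4 (by rw [hw16]; norm_num) hw1 hAp hS1 hpS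
      hτ hτ4 hτw h1 h2
  rw [hsq, hτ2]
  have hz : (0:ℝ) < (2:ℝ) ^ (-(3 * m : ℤ)) := by positivity
  by_cases hγw : γ ≤ w ^ 4
  · have := ENNReal.toReal_le_of_le_ofReal (by positivity) (hcore γ hγ hγw)
    refine this.trans ?_
    apply mul_le_mul_of_nonneg_left _ (by positivity)
    rw [hSS, show -γ * τ⁻¹ ^ 2 * L = -(γ * τ⁻¹ ^ 2 * L) by ring]
    linarith
  · push Not at hγw
    have h1 := hcore (w ^ 4) (one_le_pow₀ (by linarith)) le_rfl
    have hsub : {x ∈ Set.Icc A B | ∃ M : ℕ, 1 ≤ M ∧ M ≤ 2 ^ m ∧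
        84 * γ * (1 + C2) * τ * (w ^ 8 * S) ≤ |∑ n ∈ Finset.Icc 1 M, f (ξ * x ^ s n)|} ⊆
        {x ∈ Set.Icc A B | ∃ M : ℕ, 1 ≤ M ∧ M ≤ 2 ^ m ∧
        84 * w ^ 4 * (1 + C2) * τ * (w ^ 8 * S) ≤ |∑ n ∈ Finset.Icc 1 M, f (ξ * x ^ s n)|} := by
      rintro x ⟨hx, M, hM1, hM2, hh⟩
      refine ⟨hx, M, hM1, hM2, le_trans ?_ hh⟩
      gcongr
    have := ENNReal.toReal_le_of_le_ofReal (by positivity) ((measure_mono hsub).trans h1)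
    refine this.trans ?_
    apply mul_le_mul_of_nonneg_left _ (by positivity)
    have h2 : Real.exp (-(w ^ 4 * τ⁻¹ ^ 2 * S ^ 2)) ≤ (2:ℝ) ^ (-(3 * m : ℤ)) := by
      have e1 : (2:ℝ) ^ (-(3 * m : ℤ)) = ((2:ℝ) ^ (3 * m))⁻¹ := by
        rw [zpow_neg]; norm_cast
      rw [e1, Real.exp_neg]
      apply inv_anti₀ (by positivity)
      have e2 : (2:ℝ) ≤ Real.exp 1 := by linarith [Real.add_one_le_exp (1:ℝ)]
      calc (2:ℝ) ^ (3 * m) ≤ Real.exp 1 ^ (3 * m) := by gcongr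
        _ = Real.exp (3 * m) := by rw [← Real.exp_nat_mul]; push_cast; ring_nf
        _ ≤ _ := by
          apply Real.exp_le_exp.2
          have hσ2 : σ ≤ 2 := by
            have h0 := hGF.sq_le
            apply le_of_sq_le_sq _ (by norm_num)
            linarith
          have hτ22 : τ ^ 2 ≤ 2 := by
            apply le_of_sq_le_sq _ (by norm_num)
            calc (τ ^ 2) ^ 2 = σ := by rw [hτ4]; ring
              _ ≤ 2 ^ 2 := by linarith
          have h3 : 1 / 2 ≤ τ⁻¹ ^ 2 := by
            rw [inv_pow, one_div]
            exact inv_anti₀ (by positivity) hτ22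
          have h4 : w ≤ w ^ 4 := le_self_pow₀ (by linarith) (by norm_num)
          have h5 : 48 * (m:ℝ) ≤ w := by
            refine le_trans ?_ hw48
            calc 48 * (m:ℝ) = 48 * 1 * (m * 1) := by ring
              _ ≤ 48 * K * (m * m) := by gcongr
              _ = _ := by ring
          calc 3 * (m:ℝ) ≤ (48 * m) * (1 / 2) * 1 := by linarith
            _ ≤ _ := by
              rw [hSS]
              gcongr
              linarith
    have h6 := (Real.exp_pos (-γ * τ⁻¹ ^ 2 * L)).le
    linarith

theorem stmt10 (ξ A B : ℝ) (hξ : 0 < ξ) (hA : 1 < A) (hAB : B - A = 1) :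
    ∃ (c C : ℝ) (m₀ : ℕ), 1 ≤ c ∧ 0 < C ∧
      ∀ m : ℕ, m₀ ≤ m →
      ∀ s : ℕ → ℕ, StrictMono s → (∀ n, 1 ≤ n → 1 ≤ s n) →
      ∀ f : ℝ → ℝ, (∀ x : ℝ, f (x + 1) = f x) → (∫ x in (0:ℝ)..1, f x) = 0 →
        eVariationOn f (Set.Icc (0:ℝ) 1) ≤ 2 →
        (2 : ℝ) ^ (-(m : ℝ) / 4) / Real.sqrt 2 ≤ fnorm A B f →
      ∀ γ : ℝ, 1 ≤ γ →
        (volume {x ∈ Set.Icc A B | ∃ M : ℕ, 1 ≤ M ∧ M ≤ 2 ^ m ∧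
            84 * γ * c * fnorm A B f ^ ((1:ℝ)/4) *
                Real.sqrt ((2 : ℝ) ^ m * plog (plog ((2 : ℝ) ^ m))) ≤
              |∑ n ∈ Finset.Icc 1 M, f (ξ * x ^ s n)|}).toReal ≤
          C * (Real.exp (-γ * fnorm A B f ^ (-(1/2) : ℝ) * plog (plog ((2 : ℝ) ^ m)))
              + (2 : ℝ) ^ (-(3 * m : ℤ))) := by
  exact stmt10_aux ξ A B hξ hA hAB
end
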